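/- For every integer k ≥ 1 there exists a real ℓ_* > 1 with the following property (and when k ∈ {1,2} the property below holds for every ℓ > 1): for every real ℓ with 1 < ℓ < ℓ_* there exist a real β with 0 < β < k, functions ϱ̂, û⁰, û : [0,∞) → ℝ that are infinitely differentiable on [0,∞), and reals ϱ_* > 0, u⁰_* ≠ 0 and u_*, such that ϱ̂(Z) > 0, û⁰(Z) < 0 and û⁰(Z)² − û(Z)² = 1 for all Z ≥ 0, û(0) = 0, the two profile equations (βℓ/(ℓ+1))·û⁰(Z) + Z·(û⁰)′(Z) + û′(Z) + (k/Z)·û(Z) + (ℓ/(ℓ+1))·(Z·û⁰(Z) + û(Z))·(ϱ̂′(Z)/ϱ̂(Z)) = 0 and (β/(ℓ+1))·û(Z) + Z·û′(Z) + (û⁰)′(Z) + (1/(ℓ+1))·(Z·û(Z) + û⁰(Z))·(ϱ̂′(Z)/ϱ̂(Z)) = 0 hold for all Z > 0, and Z^β·ϱ̂(Z) → ϱ_*, û⁰(Z) → u⁰_* and û(Z) → u_* as Z → +∞. -/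

import Mathlib

open Real Set Filter Topology

/-- clamp to `[a,b]` -/
noncomputable def cl (a b x : ℝ) : ℝ := max a (min b x)

lemma cl_lip (a b : ℝ) : LipschitzWith 1 (cl a b) := (LipschitzWith.id.const_min b).const_max a
lemma cl_mem {a b : ℝ} (h : a ≤ b) (x : ℝ) : cl a b x ∈ Icc a b :=
  ⟨le_max_left _ _, max_le h (min_le_left _ _)⟩
lemma cl_eq {a b x : ℝ} (h : x ∈ Icc a b) : cl a b x = x := by
  unfold cl; rw [min_eq_right h.2, max_eq_right h.1]
lemma cl_cont (a b : ℝ) : Continuous (cl a b) := (cl_lip a b).continuous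

lemma lip_of_contDiffAt {E F : Type*} [NormedAddCommGroup E] [NormedSpace ℝ E]
    [NormedAddCommGroup F] [NormedSpace ℝ F] {f : E → F} {s : Set E} (hs : IsCompact s)
    (h : ∀ x ∈ s, ContDiffAt ℝ 1 f x) : ∃ K, LipschitzOnWith K f s := by
  apply LocallyLipschitzOn.exists_lipschitzOnWith_of_compact hs
  intro x hx
  obtain ⟨K, t, ht, hl⟩ := (h x hx).exists_lipschitzOnWith
  exact ⟨K, s ∩ t, inter_mem self_mem_nhdsWithin (mem_nhdsWithin_of_mem_nhds ht), hl.mono inter_subset_right⟩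

/-- Global solutions of clamped scalar ODEs with a parameter, and continuity in the parameter. -/
theorem ode_solve (F : ℝ × ℝ × ℝ → ℝ) (J : Set ℝ) (t0 p1 p2 c d : ℝ)
    (hp : p1 ≤ p2) (hcd : c ≤ d) (ht0 : t0 ∈ J)
    (hJ : ∀ s ∈ J, t0 ≤ s ∧ Icc t0 s ⊆ J) (hJ' : ∀ s ∈ J, ∃ s' ∈ J, s < s')
    (hF : ∀ t ∈ J, ∀ p ∈ Icc p1 p2, ∀ y ∈ Icc c d, ContDiffAt ℝ 1 F (t, p, y))
    (y0 : ℝ → ℝ) (hy0 : ContinuousOn y0 (Icc p1 p2)) :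
    ∃ Y : ℝ → ℝ → ℝ, (∀ p ∈ Icc p1 p2, Y p t0 = y0 p) ∧
      (∀ p ∈ Icc p1 p2, ∀ t ∈ J, HasDerivWithinAt (Y p) (F (t, p, cl c d (Y p t))) (Ici t0) t) ∧
      (∀ t ∈ J, ContinuousOn (fun p => Y p t) (Icc p1 p2)) := by
  have key : ∀ s ∈ J, ∃ K C : NNReal, ∀ p ∈ Icc p1 p2, ∀ q ∈ Icc p1 p2, ∀ t ∈ Icc t0 s,
      (∀ y, |F (t, p, cl c d y)| ≤ C) ∧
      ∀ y z, |F (t, p, cl c d y) - F (t, q, cl c d z)| ≤ K * max |p - q| |y - z| := by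
    intro s hs
    have hc : IsCompact (Icc t0 s ×ˢ (Icc p1 p2 ×ˢ Icc c d)) :=
      isCompact_Icc.prod (isCompact_Icc.prod isCompact_Icc)
    have hcd' : ∀ x ∈ (Icc t0 s ×ˢ (Icc p1 p2 ×ˢ Icc c d)), ContDiffAt ℝ 1 F x := by
      rintro ⟨t, p, y⟩ ⟨h1, h2, h3⟩
      exact hF t ((hJ s hs).2 h1) p h2 y h3
    obtain ⟨K, hK⟩ := lip_of_contDiffAt hc hcd'
    obtain ⟨C, hC⟩ := hc.exists_bound_of_continuousOn
      (fun x hx => (hcd' x hx).continuousAt.continuousWithinAt)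
    refine ⟨K, C.toNNReal, fun p hp' q hq t ht => ⟨fun y => ?_, fun y z => ?_⟩⟩
    · exact (hC (t, p, cl c d y) ⟨ht, hp', cl_mem hcd y⟩).trans (Real.le_coe_toNNReal C)
    · have := hK.dist_le_mul (t, p, cl c d y) ⟨ht, hp', cl_mem hcd y⟩
        (t, q, cl c d z) ⟨ht, hq, cl_mem hcd z⟩
      rw [Real.dist_eq] at this
      refine this.trans (mul_le_mul_of_nonneg_left ?_ K.2)
      have h2 := (cl_lip c d).dist_le_mul y z
      simp only [Prod.dist_eq, dist_self, Real.dist_eq, NNReal.coe_one, one_mul] at h2 ⊢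
      exact max_le (le_max_of_le_left (abs_nonneg _)) (max_le_max le_rfl h2)
  -- existence on compact intervals
  have ex : ∀ p ∈ Icc p1 p2, ∀ s ∈ J, ∃ Y : ℝ → ℝ, Y t0 = y0 p ∧ ∀ t ∈ Icc t0 s,
      HasDerivWithinAt Y (F (t, p, cl c d (Y t))) (Icc t0 s) t := by
    intro p hp' s hs
    obtain ⟨K, C, hKC⟩ := key s hs
    have h0 : t0 ≤ s := (hJ s hs).1
    have pl : IsPicardLindelof (fun t y => F (t, p, cl c d y)) (⟨t0, left_mem_Icc.2 h0⟩ : Icc t0 s)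
        (y0 p) (C * (s - t0).toNNReal) 0 C K := by
      refine ⟨fun t ht => ?_, fun x _ => ?_, fun t ht x _ => (hKC p hp' p hp' t ht).1 x, ?_⟩
      · apply LipschitzWith.lipschitzOnWith
        apply LipschitzWith.of_dist_le_mul
        intro y z
        have := (hKC p hp' p hp' t ht).2 y z
        simpa [Real.dist_eq] using this
      · intro t ht
        have h1 := (hF t ((hJ s hs).2 ht) p hp' (cl c d x) (cl_mem hcd x)).continuousAt
        have h2 : ContinuousAt (fun t : ℝ => (t, p, cl c d x)) t := by fun_prop
        exact (ContinuousAt.comp (f := fun t : ℝ => (t, p, cl c d x)) h1 h2).continuousWithinAt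
      · have : (0:ℝ) ≤ s - t0 := by linarith
        simp [this]
    obtain ⟨Y, h1, h2⟩ := pl.exists_eq_forall_mem_Icc_hasDerivWithinAt₀
    exact ⟨Y, h1, h2⟩
  -- comparison
  have cmp : ∀ s ∈ J, ∃ K : NNReal, ∀ p ∈ Icc p1 p2, ∀ q ∈ Icc p1 p2, ∀ Y Z : ℝ → ℝ,
      Y t0 = y0 p → Z t0 = y0 q →
      (∀ t ∈ Icc t0 s, HasDerivWithinAt Y (F (t, p, cl c d (Y t))) (Icc t0 s) t) →
      (∀ t ∈ Icc t0 s, HasDerivWithinAt Z (F (t, q, cl c d (Z t))) (Icc t0 s) t) →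
      ∀ t ∈ Icc t0 s, |Y t - Z t| ≤ (max |p - q| |y0 p - y0 q|) * exp (K * (t - t0)) := by
    intro s hs
    obtain ⟨K, C, hKC⟩ := key s hs
    refine ⟨K, fun p hp' q hq Y Z hY0 hZ0 hY hZ t ht => ?_⟩
    have := dist_le_of_trajectories_ODE_of_mem (E := ℝ × ℝ) (K := K)
      (v := fun t z => (0, F (t, z.1, cl c d z.2))) (s := fun _ => Icc p1 p2 ×ˢ univ)
      (f := fun t => (p, Y t)) (g := fun t => (q, Z t)) (a := t0) (b := s)
      (δ := max |p - q| |y0 p - y0 q|) ?_ ?_ ?_ ?_ ?_ ?_ ?_ ?_ t ht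
    · simp only [Prod.dist_eq, Real.dist_eq] at this
      exact (le_max_right _ _).trans this
    · intro t ht
      apply LipschitzOnWith.of_dist_le_mul
      rintro ⟨a, y⟩ ⟨ha, -⟩ ⟨b, z⟩ ⟨hb, -⟩
      have := (hKC a ha b hb t (Ico_subset_Icc_self ht)).2 y z
      simp only [Prod.dist_eq, Real.dist_eq, dist_self]
      exact max_le (mul_nonneg K.2 (le_max_of_le_left (abs_nonneg _))) this
    · exact continuousOn_const.prodMk fun t ht => (hY t ht).continuousWithinAt
    · intro t ht
      exact (hasDerivWithinAt_const _ _ _).prodMk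
        (((hY t (Ico_subset_Icc_self ht)).mono_of_mem_nhdsWithin (Icc_mem_nhdsGE_of_mem ht)))
    · intro t ht; exact ⟨hp', trivial⟩
    · exact continuousOn_const.prodMk fun t ht => (hZ t ht).continuousWithinAt
    · intro t ht
      exact (hasDerivWithinAt_const _ _ _).prodMk
        (((hZ t (Ico_subset_Icc_self ht)).mono_of_mem_nhdsWithin (Icc_mem_nhdsGE_of_mem ht)))
    · intro t ht; exact ⟨hq, trivial⟩
    · simp [Prod.dist_eq, Real.dist_eq, hY0, hZ0]
  choose! nx hnx hnx' using hJ'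
  choose! Y hY0 hY using ex
  have agree : ∀ p ∈ Icc p1 p2, ∀ s ∈ J, ∀ s' ∈ J, s ≤ s' → ∀ t ∈ Icc t0 s, Y p s t = Y p s' t := by
    intro p hp' s hs s' hs' hss t ht
    obtain ⟨K, hK⟩ := cmp s hs
    have := hK p hp' p hp' (Y p s) (Y p s') (hY0 p hp' s hs) (hY0 p hp' s' hs') (hY p hp' s hs)
      (fun t ht => (hY p hp' s' hs' t ⟨ht.1, ht.2.trans hss⟩).mono (Icc_subset_Icc_right hss)) t ht
    simp at this
    linarith
  have agree' : ∀ p ∈ Icc p1 p2, ∀ s ∈ J, ∀ t ∈ Icc t0 s, Y p (nx t) t = Y p s t := by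
    intro p hp' s hs t ht
    have htJ := (hJ s hs).2 ht
    rcases le_total (nx t) s with h | h
    · exact agree p hp' _ (hnx t htJ) s hs h t ⟨ht.1, (hnx' t htJ).le⟩
    · exact (agree p hp' _ hs _ (hnx t htJ) h t ht).symm
  refine ⟨fun p t => Y p (nx t) t, fun p hp' => hY0 p hp' _ (hnx _ ht0), ?_, ?_⟩
  · intro p hp' t ht
    have hn := hnx t ht
    have h1 := hY p hp' _ hn t ⟨(hJ t ht).1, (hnx' t ht).le⟩
    have h2 : Icc t0 (nx t) ∈ 𝓝[Ici t0] t := by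
      rw [← Ici_inter_Iic]
      exact inter_mem self_mem_nhdsWithin (mem_nhdsWithin_of_mem_nhds (Iic_mem_nhds (hnx' t ht)))
    refine (h1.mono_of_mem_nhdsWithin h2).congr_of_eventuallyEq ?_ rfl
    filter_upwards [h2] with τ hτ
    exact agree' p hp' _ hn τ hτ
  · intro t ht p hp'
    obtain ⟨K, hK⟩ := cmp t ht
    have h1 : ∀ q ∈ Icc p1 p2, |Y q (nx t) t - Y p (nx t) t| ≤
        (max |q - p| |y0 q - y0 p|) * exp (K * (t - t0)) := by
      intro q hq
      have htt : t ∈ Icc t0 t := ⟨(hJ t ht).1, le_rfl⟩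
      rw [agree' p hp' t ht t htt, agree' q hq t ht t htt]
      exact hK q hq p hp' _ _ (hY0 q hq t ht) (hY0 p hp' t ht) (hY q hq t ht) (hY p hp' t ht) t htt
    rw [ContinuousWithinAt, tendsto_iff_norm_sub_tendsto_zero]
    refine squeeze_zero' (g := fun q => (max |q - p| |y0 q - y0 p|) * exp (K * (t - t0)))
      (Eventually.of_forall fun _ => norm_nonneg _) ?_ ?_
    · filter_upwards [self_mem_nhdsWithin] with q hq using h1 q hq
    · have h3 : ContinuousWithinAt (fun q => (max |q - p| |y0 q - y0 p|) * exp (K * (t - t0))) (Icc p1 p2) p := by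
        have := hy0 p hp'
        fun_prop
      simpa [ContinuousWithinAt] using h3


noncomputable def JJ (μ : ℝ) (h : ℝ → ℝ) (x : ℝ) : ℝ := ∫ t in (0:ℝ)..1, t^μ * h (t*x)

lemma JJ_cont {μ r : ℝ} (hμ : 0 ≤ μ) {h : ℝ → ℝ} (hh : ContinuousOn h (Ioo (-r) r)) :
    ContinuousOn (JJ μ h) (Ioo (-r) r) := by
  intro x hx
  obtain ⟨ρ, hρ1, hρ2⟩ := exists_between (abs_lt.2 hx)
  have hρ0 : 0 ≤ ρ := (abs_nonneg x).trans hρ1.le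
  have hc : Continuous (fun x => h (cl (-ρ) ρ x)) := by
    rw [continuous_iff_continuousAt]; intro z
    have hz := cl_mem (show -ρ ≤ ρ by linarith) z
    have := (hh (cl (-ρ) ρ z) ⟨by linarith [hz.1], by linarith [hz.2]⟩).continuousAt
      (Ioo_mem_nhds (by linarith [hz.1]) (by linarith [hz.2]))
    exact ContinuousAt.comp (f := cl (-ρ) ρ) this (cl_cont _ _).continuousAt
  have h1 : Continuous (fun x => ∫ t in (0:ℝ)..1, t^μ * h (cl (-ρ) ρ (t*x))) := by
    apply intervalIntegral.continuous_parametric_intervalIntegral_of_continuous'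
    have h2 : Continuous (fun p : ℝ × ℝ => p.2 ^ μ) := (continuous_rpow_const hμ).comp continuous_snd
    exact h2.mul (hc.comp (by fun_prop : Continuous (fun p : ℝ × ℝ => p.2 * p.1)))
  refine (h1.continuousAt.congr ?_).continuousWithinAt
  filter_upwards [Ioo_mem_nhds (neg_lt_of_abs_lt hρ1) (lt_of_abs_lt hρ1)] with z hz
  apply intervalIntegral.integral_congr
  intro t ht
  rw [uIcc_of_le zero_le_one] at ht
  simp only
  rw [cl_eq]
  have : |t*z| ≤ ρ := by
    rw [abs_mul, abs_of_nonneg ht.1]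
    have : |z| ≤ ρ := (abs_lt.2 hz).le
    nlinarith [ht.2, abs_nonneg z, ht.1]
  exact abs_le.1 this

lemma JJ_deriv {μ r : ℝ} (hμ : 0 ≤ μ) {h h' : ℝ → ℝ} (hh : ∀ x ∈ Ioo (-r) r, HasDerivAt h (h' x) x)
    (hh' : ContinuousOn h' (Ioo (-r) r)) {x : ℝ} (hx : x ∈ Ioo (-r) r) :
    HasDerivAt (JJ μ h) (JJ (μ+1) h' x) x := by
  obtain ⟨ρ, hρ1, hρ2⟩ := exists_between (abs_lt.2 hx)
  have hρ0 : 0 ≤ ρ := (abs_nonneg x).trans hρ1.le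
  have hsub : Icc (-ρ) ρ ⊆ Ioo (-r) r := fun z hz => ⟨by linarith [hz.1], by linarith [hz.2]⟩
  obtain ⟨C, hC⟩ := (isCompact_Icc (a := -ρ) (b := ρ)).exists_bound_of_continuousOn (hh'.mono hsub)
  have hhc : ContinuousOn h (Ioo (-r) r) := fun z hz => (hh z hz).continuousAt.continuousWithinAt
  have hm : ∀ t ∈ Icc (0:ℝ) 1, ∀ z ∈ Ioo (-ρ) ρ, t*z ∈ Icc (-ρ) ρ := by
    intro t ht z hz
    have : |t*z| ≤ ρ := by
      rw [abs_mul, abs_of_nonneg ht.1]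
      have : |z| ≤ ρ := (abs_lt.2 hz).le
      nlinarith [ht.2, abs_nonneg z, ht.1]
    exact abs_le.1 this
  have hnb : Ioo (-ρ) ρ ∈ 𝓝 x := Ioo_mem_nhds (neg_lt_of_abs_lt hρ1) (lt_of_abs_lt hρ1)
  have hci : ∀ z ∈ Ioo (-ρ) ρ, ContinuousOn (fun t:ℝ => t^μ * h (t*z)) (Icc 0 1) := by
    intro z hz
    refine (continuous_rpow_const hμ).continuousOn.mul ?_
    exact hhc.comp (f := fun t => t*z) (by fun_prop) (fun t ht => hsub (hm t ht z hz))
  have hci' : ContinuousOn (fun t:ℝ => t^μ * (h' (t*x) * t)) (Icc 0 1) := by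
    refine (continuous_rpow_const hμ).continuousOn.mul (ContinuousOn.mul ?_ continuousOn_id)
    exact hh'.comp (f := fun t => t*x) (by fun_prop) (fun t ht => hsub (hm t ht x (mem_of_mem_nhds hnb)))
  have := intervalIntegral.hasDerivAt_integral_of_dominated_loc_of_deriv_le (μ := MeasureTheory.volume)
    (F := fun z t => t^μ * h (t*z)) (F' := fun z t => t^μ * (h' (t*z) * t)) (x₀ := x) (a := 0) (b := 1)
    (bound := fun _ => C) hnb ?_ ?_ ?_ ?_ ?_ ?_
  · have h2 := this.2
    have e : JJ (μ+1) h' x = ∫ (t : ℝ) in (0:ℝ)..1, t ^ μ * (h' (t * x) * t) := by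
      apply intervalIntegral.integral_congr
      intro t ht
      rw [uIcc_of_le zero_le_one] at ht
      simp only
      rw [rpow_add_one' ht.1 (by linarith)]; ring
    rw [e]; exact h2
  · filter_upwards [hnb] with z hz
    rw [uIoc_of_le zero_le_one]
    exact ((hci z hz).mono Ioc_subset_Icc_self).aestronglyMeasurable measurableSet_Ioc
  · apply ContinuousOn.intervalIntegrable
    rw [uIcc_of_le zero_le_one]; exact hci x (mem_of_mem_nhds hnb)
  · rw [uIoc_of_le zero_le_one]
    exact (hci'.mono Ioc_subset_Icc_self).aestronglyMeasurable measurableSet_Ioc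
  · refine Eventually.of_forall fun t ht z hz => ?_
    rw [uIoc_of_le zero_le_one] at ht
    have ht' : t ∈ Icc (0:ℝ) 1 := Ioc_subset_Icc_self ht
    have h1 := hC _ (hm t ht' z hz)
    rw [norm_mul, norm_mul, norm_of_nonneg (rpow_nonneg ht'.1 _), norm_of_nonneg ht'.1]
    have h2 : t^μ ≤ 1 := rpow_le_one ht'.1 ht'.2 hμ
    have h3 : 0 ≤ t^μ := rpow_nonneg ht'.1 _
    calc t^μ * (‖h' (t*z)‖ * t) ≤ 1 * (‖h' (t*z)‖ * 1) := by
          have := norm_nonneg (h' (t*z))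
          have h4 : ‖h' (t*z)‖ * t ≤ ‖h' (t*z)‖ * 1 := mul_le_mul_of_nonneg_left ht'.2 this
          exact mul_le_mul h2 h4 (mul_nonneg this ht'.1) zero_le_one
      _ ≤ C := by simpa using h1
  · exact intervalIntegrable_const
  · refine Eventually.of_forall fun t ht z hz => ?_
    rw [uIoc_of_le zero_le_one] at ht
    have ht' : t ∈ Icc (0:ℝ) 1 := Ioc_subset_Icc_self ht
    have h1 := (hh _ (hsub (hm t ht' z hz))).comp z ((hasDerivAt_id z).const_mul t)
    simpa using h1.const_mul (t^μ)

lemma JJ_contDiff (r : ℝ) (n : ℕ) : ∀ (μ : ℝ), 0 ≤ μ → ∀ h : ℝ → ℝ,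
    ContDiffOn ℝ n h (Ioo (-r) r) → ContDiffOn ℝ n (JJ μ h) (Ioo (-r) r) := by
  induction n with
  | zero => intro μ hμ h hh
            simp only [CharP.cast_eq_zero, contDiffOn_zero] at hh ⊢
            exact JJ_cont hμ hh
  | succ n ih =>
    intro μ hμ h hh
    rw [Nat.cast_succ] at hh ⊢
    rw [contDiffOn_succ_iff_deriv_of_isOpen isOpen_Ioo] at hh ⊢
    have hd : ∀ x ∈ Ioo (-r) r, HasDerivAt h (deriv h x) x := fun x hx =>
      (hh.1.differentiableAt (isOpen_Ioo.mem_nhds hx)).hasDerivAt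
    have hd2 := fun x (hx : x ∈ Ioo (-r) r) => JJ_deriv hμ hd hh.2.2.continuousOn hx
    refine ⟨fun x hx => (hd2 x hx).differentiableAt.differentiableWithinAt, by simp, ?_⟩
    exact (ih (μ+1) (by linarith) _ hh.2.2).congr fun x hx => (hd2 x hx).deriv

lemma JJ_pos {μ x : ℝ} (hx : 0 < x) (h : ℝ → ℝ) :
    x * JJ μ h x = x^(-μ) * ∫ s in (0:ℝ)..x, s^μ * h s := by
  unfold JJ
  have h1 := intervalIntegral.integral_comp_mul_right (a := 0) (b := 1) (fun s => s^μ * h s) hx.ne'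
  have h2 : (∫ t in (0:ℝ)..1, t^μ * h (t*x)) = x^(-μ) * ∫ t in (0:ℝ)..1, (t*x)^μ * h (t*x) := by
    rw [← intervalIntegral.integral_const_mul]
    apply intervalIntegral.integral_congr
    intro t ht
    rw [uIcc_of_le zero_le_one] at ht
    simp only
    rw [mul_rpow ht.1 hx.le, rpow_neg hx.le]
    have : x^μ ≠ 0 := (rpow_pos_of_pos hx μ).ne'
    field_simp
  rw [h2, h1]
  simp only [zero_mul, one_mul, smul_eq_mul]
  field_simp

lemma xJJ_deriv_pos {μ r : ℝ} (hμ : 0 ≤ μ) {h : ℝ → ℝ} (hh : ContinuousOn h (Ioo (-r) r)) {x : ℝ}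
    (hx : 0 < x) (hxr : x < r) : HasDerivAt (fun x => x * JJ μ h x) (h x - μ * JJ μ h x) x := by
  have hc : ContinuousOn (fun s => s^μ * h s) (Ioo (-r) r) :=
    (continuous_rpow_const hμ).continuousOn.mul hh
  have hxm : x ∈ Ioo (-r) r := ⟨by linarith, hxr⟩
  have h1 : HasDerivAt (fun x => ∫ s in (0:ℝ)..x, s^μ * h s) (x^μ * h x) x := by
    apply intervalIntegral.integral_hasDerivAt_right
    · apply ContinuousOn.intervalIntegrable
      rw [uIcc_of_le hx.le]
      exact hc.mono fun s hs => ⟨by linarith [hs.1], by linarith [hs.2]⟩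
    · exact hc.stronglyMeasurableAtFilter isOpen_Ioo _ hxm
    · exact hc.continuousAt (isOpen_Ioo.mem_nhds hxm)
  have h2 : HasDerivAt (fun x : ℝ => x^(-μ)) (-μ * x^(-μ-1)) x := hasDerivAt_rpow_const (Or.inl hx.ne')
  have h3 := h2.mul h1
  have h4 : HasDerivAt (fun x => x * JJ μ h x) _ x := h3.congr_of_eventuallyEq (by
    filter_upwards [Ioi_mem_nhds hx] with z hz
    exact JJ_pos hz h)
  convert h4 using 1
  have h5 := JJ_pos (μ := μ) hx h
  have h6 : x^(-μ-1) = x^(-μ) / x := rpow_sub_one hx.ne' _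
  have h7 : x^(-μ) * x^μ = 1 := by rw [← rpow_add hx]; simp
  have h8 : JJ μ h x = (x^(-μ) * ∫ s in (0:ℝ)..x, s^μ * h s) / x := by
    rw [← h5]; field_simp
  rw [h6, h8]
  linear_combination -(h x) * h7

lemma JJ_neg (μ : ℝ) (h : ℝ → ℝ) (x : ℝ) : JJ μ h x = JJ μ (fun s => h (-s)) (-x) := by
  unfold JJ; simp

lemma xJJ_deriv {μ r : ℝ} (hμ : 0 ≤ μ) {h : ℝ → ℝ} (hh : ContinuousOn h (Ioo (-r) r)) {x : ℝ}
    (hx : x ∈ Ioo (-r) r) : HasDerivAt (fun x => x * JJ μ h x) (h x - μ * JJ μ h x) x := by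
  have hne : ∀ x ∈ Ioo (-r) r, x ≠ 0 → HasDerivAt (fun x => x * JJ μ h x) (h x - μ * JJ μ h x) x := by
    intro x hx h0
    rcases lt_or_gt_of_ne h0 with hn | hp
    · have h1 : ContinuousOn (fun s => h (-s)) (Ioo (-r) r) := hh.comp (by fun_prop)
        fun s hs => ⟨by linarith [hs.2], by linarith [hs.1]⟩
      have h2 := xJJ_deriv_pos hμ h1 (show 0 < -x by linarith) (show -x < r by linarith [hx.1])
      have h3 := (h2.comp x (hasDerivAt_neg x)).neg
      have e1 : (fun x => x * JJ μ h x) = -(fun x => x * JJ μ (fun s => h (-s)) x) ∘ Neg.neg := by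
        funext z; simp only [Pi.neg_apply, Function.comp]; rw [JJ_neg μ h z]; ring
      have e2 : h x - μ * JJ μ h x = -((h (- -x) - μ * JJ μ (fun s => h (-s)) (-x)) * -1) := by
        rw [JJ_neg μ h x]; simp
      rw [e1, e2]; exact h3
    · exact xJJ_deriv_pos hμ hh hp hx.2
  by_cases h0 : x = 0
  · subst h0
    have hJ := JJ_cont hμ hh
    have hJ0 : JJ μ h 0 = h 0 / (μ+1) := by
      unfold JJ
      simp only [mul_zero, intervalIntegral.integral_mul_const]
      rw [integral_rpow (Or.inl (by linarith))]
      rw [one_rpow, zero_rpow (by linarith)]; ring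
    have h1 : h 0 - μ * JJ μ h 0 = JJ μ h 0 := by
      rw [hJ0]; have : μ + 1 ≠ 0 := by linarith
      field_simp; ring
    rw [h1, hasDerivAt_iff_tendsto_slope]
    have h2 : Tendsto (JJ μ h) (𝓝[≠] 0) (𝓝 (JJ μ h 0)) :=
      ((hJ 0 hx).continuousAt (isOpen_Ioo.mem_nhds hx)).tendsto.mono_left nhdsWithin_le_nhds
    refine h2.congr' ?_
    filter_upwards [self_mem_nhdsWithin] with z hz
    have : z ≠ 0 := hz
    simp [slope_def_field]; field_simp
  · exact hne x hx h0

/-- Solutions of the singular integral equation are smooth and solve the singular ODE. -/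
lemma sing_smooth {μ r c : ℝ} (hμ : 0 < μ) {ξ : ℝ → ℝ} {f : ℝ × ℝ → ℝ}
    (hξ : ContinuousOn ξ (Ioo (-r) r))
    (hf : ∀ x ∈ Ioo (-r) r, ContDiffAt ℝ (⊤ : ℕ∞) f (x, ξ x))
    (heq : ∀ x ∈ Ioo (-r) r, ξ x = c/μ + x * ∫ t in (0:ℝ)..1, t^μ * f (t*x, ξ (t*x))) :
    ContDiffOn ℝ (⊤ : ℕ∞) ξ (Ioo (-r) r) ∧
      ∀ x ∈ Ioo (-r) r, ∃ ξ', HasDerivAt ξ ξ' x ∧ x * ξ' = -μ * ξ x + c + x * f (x, ξ x) := by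
  set h : ℝ → ℝ := fun x => f (x, ξ x) with hh
  have heq' : ∀ x ∈ Ioo (-r) r, ξ x = c/μ + x * JJ μ h x := heq
  have hcomp : ∀ n : ℕ, ContDiffOn ℝ n ξ (Ioo (-r) r) → ContDiffOn ℝ n h (Ioo (-r) r) := by
    intro n hn x hx
    have h1 : ContDiffAt ℝ n f (x, ξ x) := (hf x hx).of_le (by exact_mod_cast le_top)
    have h2 : ContDiffWithinAt ℝ n (fun x => (x, ξ x)) (Ioo (-r) r) x :=
      contDiffWithinAt_id.prodMk (hn x hx)
    exact ContDiffAt.comp_contDiffWithinAt (f := fun x => (x, ξ x)) x h1 h2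
  have hhc : ContinuousOn h (Ioo (-r) r) :=
    (contDiffOn_zero.1 (hcomp 0 (by simpa [contDiffOn_zero] using hξ)))
  have hd : ∀ x ∈ Ioo (-r) r, HasDerivAt ξ (h x - μ * JJ μ h x) x := by
    intro x hx
    refine ((xJJ_deriv hμ.le hhc hx).const_add (c/μ)).congr_of_eventuallyEq ?_
    filter_upwards [isOpen_Ioo.mem_nhds hx] with z hz using heq' z hz
  constructor
  · rw [contDiffOn_infty]
    intro n
    induction n with
    | zero => simpa [contDiffOn_zero] using hξ
    | succ n ih =>
      rw [Nat.cast_succ, contDiffOn_succ_iff_deriv_of_isOpen isOpen_Ioo]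
      refine ⟨fun x hx => (hd x hx).differentiableAt.differentiableWithinAt, by simp, ?_⟩
      have h1 := hcomp n ih
      exact (h1.sub (contDiffOn_const.mul (JJ_contDiff r n μ hμ.le h h1))).congr
        fun x hx => (hd x hx).deriv
  · intro x hx
    refine ⟨_, hd x hx, ?_⟩
    have := heq' x hx
    simp only [hh] at *
    rw [this]; field_simp; ring


theorem sing_picard {E : Type*} [NormedAddCommGroup E] [NormedSpace ℝ E] (Φ : ℝ × ℝ × E → ℝ)
    (q : ℝ → E) (c μ : ℝ → ℝ) (p1 p2 r0 M : ℝ) (hp : p1 ≤ p2) (hr0 : 0 < r0)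
    (hq : ContinuousOn q (Icc p1 p2)) (hc : ContinuousOn c (Icc p1 p2))
    (hμ : ContinuousOn μ (Icc p1 p2)) (hμ0 : ∀ p ∈ Icc p1 p2, 0 < μ p)
    (hM : ∀ p ∈ Icc p1 p2, |c p / μ p| < M)
    (hΦ : ∀ x ∈ Icc (-r0) r0, ∀ ξ ∈ Icc (-M) M, ∀ p ∈ Icc p1 p2, ContDiffAt ℝ 1 Φ (x, ξ, q p)) :
    ∃ r, 0 < r ∧ r ≤ r0 ∧ ∃ ξ : ℝ → ℝ → ℝ,
      (∀ p, Continuous (ξ p)) ∧ (∀ x, Continuous (fun p => ξ p x)) ∧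
      (∀ p ∈ Icc p1 p2, ∀ x ∈ Icc (-r) r, |ξ p x| ≤ M) ∧
      (∀ p ∈ Icc p1 p2, ∀ x ∈ Icc (-r) r,
        ξ p x = c p / μ p + x * ∫ t in (0:ℝ)..1, t^(μ p) * Φ (t*x, ξ p (t*x), q p)) := by
  have hcl : ∀ {g : ℝ → ℝ}, ContinuousOn g (Icc p1 p2) → Continuous (fun p => g (cl p1 p2 p)) :=
    fun hg => hg.comp_continuous (cl_cont _ _) (cl_mem hp)
  have hqc : Continuous (fun p => q (cl p1 p2 p)) :=
    hq.comp_continuous (cl_cont _ _) (cl_mem hp)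
  have hμc := hcl hμ
  have hcμ : ContinuousOn (fun p => c p / μ p) (Icc p1 p2) := hc.div hμ fun p hp => (hμ0 p hp).ne'
  obtain ⟨pm, hpm, hmax⟩ := isCompact_Icc.exists_isMaxOn (nonempty_Icc.2 hp) hcμ.abs
  set A := |c pm / μ pm| with hA
  have hAM : A < M := hM pm hpm
  have hA0 : 0 ≤ A := abs_nonneg _
  have hAb : ∀ p ∈ Icc p1 p2, |c p / μ p| ≤ A := fun p hp => hmax hp
  have hMM : -M ≤ M := by linarith
  have hrr : -r0 ≤ r0 := by linarith
  set K0 : Set (ℝ × ℝ × E) := Icc (-r0) r0 ×ˢ (Icc (-M) M ×ˢ (q '' Icc p1 p2)) with hK0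
  have hK0c : IsCompact K0 := isCompact_Icc.prod (isCompact_Icc.prod (isCompact_Icc.image_of_continuousOn hq))
  have hK0d : ∀ z ∈ K0, ContDiffAt ℝ 1 Φ z := by
    rintro ⟨x, ξ, e⟩ ⟨hx, hξ, p, hp', rfl⟩
    exact hΦ x hx ξ hξ p hp'
  obtain ⟨K, hK⟩ := lip_of_contDiffAt hK0c hK0d
  have hΦc : ContinuousOn Φ K0 := fun z hz => (hK0d z hz).continuousAt.continuousWithinAt
  obtain ⟨C, hC⟩ := hK0c.exists_bound_of_continuousOn hΦc
  set f : ℝ → ℝ → ℝ → ℝ := fun x ξ p => Φ (cl (-r0) r0 x, cl (-M) M ξ, q (cl p1 p2 p)) with hf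
  have hmem : ∀ x ξ p, (cl (-r0) r0 x, cl (-M) M ξ, q (cl p1 p2 p)) ∈ K0 := fun x ξ p =>
    ⟨cl_mem hrr x, cl_mem hMM ξ, mem_image_of_mem _ (cl_mem hp p)⟩
  have hfb : ∀ x ξ p, |f x ξ p| ≤ C := fun x ξ p => hC _ (hmem x ξ p)
  have hC0 : 0 ≤ C := (abs_nonneg _).trans (hfb 0 0 0)
  have hfl : ∀ x ξ ξ' p, |f x ξ p - f x ξ' p| ≤ K * |ξ - ξ'| := by
    intro x ξ ξ' p
    have h1 := hK.dist_le_mul _ (hmem x ξ p) _ (hmem x ξ' p)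
    rw [Real.dist_eq] at h1
    refine h1.trans (mul_le_mul_of_nonneg_left ?_ K.2)
    have h2 := (cl_lip (-M) M).dist_le_mul ξ ξ'
    simpa [Prod.dist_eq, Real.dist_eq] using h2
  have hfc : Continuous (fun z : ℝ × ℝ × ℝ => f z.1 z.2.1 z.2.2) := by
    refine hΦc.comp_continuous ?_ (fun z => hmem _ _ _)
    exact ((cl_cont (-r0) r0).comp continuous_fst).prodMk
      (((cl_cont (-M) M).comp (continuous_fst.comp continuous_snd)).prodMk
        (hqc.comp (continuous_snd.comp continuous_snd)))
  set r := min r0 (min ((M - A)/(C+1)) (1/(2*(K+1)))) with hr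
  have hKnn : (0:ℝ) ≤ K := K.2
  have hrpos : 0 < r := by
    refine lt_min hr0 (lt_min (div_pos (by linarith) (by linarith)) (by positivity))
  have hr1 : r ≤ r0 := min_le_left _ _
  have hr2 : r * C ≤ M - A := by
    have h1 : r ≤ (M-A)/(C+1) := (min_le_right _ _).trans (min_le_left _ _)
    rw [le_div_iff₀ (by linarith)] at h1
    nlinarith
  have hr3 : r * K ≤ 1/2 := by
    have h1 : r ≤ 1/(2*(K+1)) := (min_le_right _ _).trans (min_le_right _ _)
    rw [le_div_iff₀ (by positivity)] at h1
    nlinarith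
  have hrr' : -r ≤ r := by linarith
  have hxh : ∀ x, |cl (-r) r x| ≤ r := fun x => abs_le.2 (cl_mem hrr' x)
  have hrp : Continuous (fun z : ℝ × ℝ => |z.2| ^ (μ (cl p1 p2 z.1))) := by
    apply Continuous.rpow (by fun_prop) (hμc.comp continuous_fst)
    intro z; right; exact hμ0 _ (cl_mem hp _)
  have hI : ∀ η : BoundedContinuousFunction (ℝ × ℝ) ℝ,
      Continuous (fun w : (ℝ × ℝ) × ℝ => |w.2|^(μ (cl p1 p2 w.1.1)) *
        f (w.2 * cl (-r) r w.1.2) (η (w.1.1, w.2 * cl (-r) r w.1.2)) w.1.1) := by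
    intro η
    have h1 := cl_cont (-r) r
    have h2 := η.continuous
    refine (hrp.comp (by fun_prop : Continuous fun w : (ℝ × ℝ) × ℝ => (w.1.1, w.2))).mul ?_
    exact hfc.comp (by fun_prop : Continuous fun w : (ℝ × ℝ) × ℝ =>
      (w.2 * cl (-r) r w.1.2, η (w.1.1, w.2 * cl (-r) r w.1.2), w.1.1))
  set S : BoundedContinuousFunction (ℝ × ℝ) ℝ → ℝ × ℝ → ℝ := fun η z =>
    c (cl p1 p2 z.1) / μ (cl p1 p2 z.1) + cl (-r) r z.2 * ∫ t in (0:ℝ)..1,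
      |t|^(μ (cl p1 p2 z.1)) * f (t * cl (-r) r z.2) (η (z.1, t * cl (-r) r z.2)) z.1 with hS
  have hintg : ∀ (η : BoundedContinuousFunction (ℝ × ℝ) ℝ) (z : ℝ × ℝ), IntervalIntegrable (fun t => |t|^(μ (cl p1 p2 z.1)) * f (t * cl (-r) r z.2)
      (η (z.1, t * cl (-r) r z.2)) z.1) MeasureTheory.volume 0 1 := fun η z =>
    ((hI η).comp (by fun_prop : Continuous fun t : ℝ => (z, t))).intervalIntegrable 0 1
  have hSc : ∀ η, Continuous (S η) := by
    intro η
    have h1 := cl_cont (-r) r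
    have h2 : Continuous (fun z : ℝ × ℝ => c (cl p1 p2 z.1) / μ (cl p1 p2 z.1)) :=
      (hcl hcμ).comp continuous_fst
    refine h2.add (Continuous.mul (by fun_prop) ?_)
    exact intervalIntegral.continuous_parametric_intervalIntegral_of_continuous' (hI η) 0 1
  have htp : ∀ t ∈ Set.uIoc (0:ℝ) 1, ∀ p, |t|^(μ (cl p1 p2 p)) ≤ 1 := by
    intro t ht p
    rw [uIoc_of_le zero_le_one] at ht
    rw [abs_of_pos ht.1]
    exact rpow_le_one ht.1.le ht.2 (hμ0 _ (cl_mem hp p)).le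
  have hSi : ∀ (η : BoundedContinuousFunction (ℝ × ℝ) ℝ) (z : ℝ × ℝ), |∫ t in (0:ℝ)..1, |t|^(μ (cl p1 p2 z.1)) * f (t * cl (-r) r z.2)
      (η (z.1, t * cl (-r) r z.2)) z.1| ≤ C := by
    intro η z
    have := intervalIntegral.norm_integral_le_of_norm_le_const (a := 0) (b := 1) (C := C)
      (f := fun t => |t|^(μ (cl p1 p2 z.1)) * f (t * cl (-r) r z.2) (η (z.1, t * cl (-r) r z.2)) z.1) ?_
    · simpa using this
    · intro t ht
      rw [norm_mul, Real.norm_eq_abs, Real.norm_eq_abs, abs_of_nonneg (by positivity)]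
      calc _ ≤ 1 * C := mul_le_mul (htp t ht _) (hfb _ _ _) (abs_nonneg _) zero_le_one
        _ = C := one_mul C
  have hSb : ∀ (η : BoundedContinuousFunction (ℝ × ℝ) ℝ) (z : ℝ × ℝ), |S η z| ≤ M := by
    intro η z
    have h1 := hSi η z
    have h2 := hxh z.2
    have h3 := hAb _ (cl_mem hp z.1)
    calc |S η z| ≤ A + r * C := by
          refine (abs_add_le _ _).trans (add_le_add h3 ?_)
          rw [abs_mul]
          exact mul_le_mul h2 h1 (abs_nonneg _) hrpos.le
      _ ≤ M := by linarith
  let T : BoundedContinuousFunction (ℝ × ℝ) ℝ → BoundedContinuousFunction (ℝ × ℝ) ℝ := fun η =>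
    BoundedContinuousFunction.ofNormedAddCommGroup (S η) (hSc η) M (hSb η)
  have hT : ContractingWith (1/2) T := by
    refine ⟨by norm_num, LipschitzWith.of_dist_le_mul fun η η' => ?_⟩
    rw [BoundedContinuousFunction.dist_le (by positivity)]
    intro z
    show dist (S η z) (S η' z) ≤ _
    rw [Real.dist_eq]
    simp only [hS]
    rw [add_sub_add_left_eq_sub, ← mul_sub, ← intervalIntegral.integral_sub (hintg η z) (hintg η' z), abs_mul]
    have := intervalIntegral.norm_integral_le_of_norm_le_const (a := 0) (b := 1) (C := K * dist η η')
      (f := fun t => |t|^(μ (cl p1 p2 z.1)) * f (t * cl (-r) r z.2) (η (z.1, t * cl (-r) r z.2)) z.1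
        - |t|^(μ (cl p1 p2 z.1)) * f (t * cl (-r) r z.2) (η' (z.1, t * cl (-r) r z.2)) z.1) ?_
    · rw [Real.norm_eq_abs] at this
      have h2 := hxh z.2
      have hd : 0 ≤ dist η η' := dist_nonneg
      calc _ ≤ r * (K * dist η η' * |1 - 0|) := mul_le_mul h2 this (abs_nonneg _) hrpos.le
        _ = (r * K) * dist η η' := by simp; ring
        _ ≤ 1/2 * dist η η' := mul_le_mul_of_nonneg_right hr3 hd
        _ = _ := by simp
    · intro t ht
      rw [← mul_sub, norm_mul, Real.norm_eq_abs, Real.norm_eq_abs, abs_of_nonneg (by positivity)]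
      have h1 := hfl (t * cl (-r) r z.2) (η (z.1, t * cl (-r) r z.2)) (η' (z.1, t * cl (-r) r z.2)) z.1
      have h2 : |η (z.1, t * cl (-r) r z.2) - η' (z.1, t * cl (-r) r z.2)| ≤ dist η η' := by
        rw [← Real.dist_eq]; exact BoundedContinuousFunction.dist_coe_le_dist _
      calc _ ≤ 1 * (K * dist η η') := mul_le_mul (htp t ht _)
            (h1.trans (mul_le_mul_of_nonneg_left h2 hKnn)) (abs_nonneg _) zero_le_one
        _ = _ := one_mul _
  set η := ContractingWith.fixedPoint T hT with hη
  have hfix : T η = η := hT.fixedPoint_isFixedPt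
  have hfix' : ∀ z, η z = S η z := fun z => (DFunLike.congr_fun hfix z).symm
  refine ⟨r, hrpos, hr1, fun p x => η (p, x), fun p => by fun_prop, fun x => by fun_prop, ?_, ?_⟩
  · intro p hp' x hx
    show |η (p, x)| ≤ M
    rw [hfix']; exact hSb η _
  · intro p hp' x hx
    show η (p, x) = _
    rw [hfix']
    simp only [hS, cl_eq hp', cl_eq hx]
    congr 2
    apply intervalIntegral.integral_congr
    intro t ht
    rw [uIcc_of_le zero_le_one] at ht
    simp only [hf]
    rw [abs_of_nonneg ht.1, cl_eq hp', cl_eq (x := t*x), cl_eq (x := η (p, t*x))]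
    · rw [hfix']; exact abs_le.1 (hSb _ _)
    · have : |t*x| ≤ r0 := by
        rw [abs_mul, abs_of_nonneg ht.1]
        have := abs_le.2 hx
        nlinarith [ht.2, ht.1, abs_nonneg x]
      exact abs_le.1 this


theorem ode_smooth {F : ℝ × ℝ → ℝ} {s : Set ℝ} (hs : IsOpen s) {y : ℝ → ℝ}
    (hy : ∀ t ∈ s, HasDerivAt y (F (t, y t)) t)
    (hF : ∀ t ∈ s, ContDiffAt ℝ (⊤:ℕ∞) F (t, y t)) : ContDiffOn ℝ (⊤:ℕ∞) y s := by
  rw [contDiffOn_infty]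
  intro n
  induction n with
  | zero =>
    exact contDiffOn_zero.2 fun t ht => (hy t ht).continuousAt.continuousWithinAt
  | succ n ih =>
    push_cast
    rw [contDiffOn_succ_iff_deriv_of_isOpen hs]
    refine ⟨fun t ht => (hy t ht).differentiableAt.differentiableWithinAt, by simp, ?_⟩
    have h1 : ContDiffOn ℝ n (fun t => F (t, y t)) s := by
      intro t ht
      have h2 : ContDiffAt ℝ n (fun t => (t, y t)) t :=
        contDiffAt_id.prodMk ((ih t ht).contDiffAt (hs.mem_nhds ht))
      have h3 : ContDiffAt ℝ n F (t, y t) := (hF t ht).of_le (by exact_mod_cast le_top)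
      exact (h3.comp t h2).contDiffWithinAt
    exact h1.congr fun t ht => (hy t ht).deriv

theorem ode_uniq {F : ℝ × ℝ → ℝ} {a b : ℝ} {y1 y2 : ℝ → ℝ}
    (h1 : ∀ t ∈ Ioo a b, HasDerivAt y1 (F (t, y1 t)) t)
    (h2 : ∀ t ∈ Ioo a b, HasDerivAt y2 (F (t, y2 t)) t)
    (hF : ∀ t ∈ Ioo a b, ContDiffAt ℝ 1 F (t, y1 t)) {t0 : ℝ} (ht0 : t0 ∈ Ioo a b)
    (h0 : y1 t0 = y2 t0) : ∀ t ∈ Ioo a b, y1 t = y2 t := by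
  have hc : ContinuousOn (fun t => y1 t - y2 t) (Ioo a b) := fun t ht =>
    ((h1 t ht).continuousAt.sub (h2 t ht).continuousAt).continuousWithinAt
  have key : Ioo a b ⊆ {t | y1 t = y2 t} ∩ Ioo a b := by
    have hop : IsOpen ({t | y1 t = y2 t} ∩ Ioo a b) := by
      rw [isOpen_iff_mem_nhds]
      rintro t ⟨ht, hta⟩
      simp only [mem_setOf_eq] at ht
      obtain ⟨K, u, hu, hK⟩ := (hF t hta).exists_lipschitzOnWith
      have hu1 : ∀ᶠ s in 𝓝 t, (s, y1 s) ∈ u :=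
        (continuousAt_id.prodMk (h1 t hta).continuousAt).eventually hu
      have hu2 : ∀ᶠ s in 𝓝 t, (s, y2 s) ∈ u := by
        have : ContinuousAt (fun s => (s, y2 s)) t := continuousAt_id.prodMk (h2 t hta).continuousAt
        apply this.eventually
        show u ∈ 𝓝 (t, y2 t)
        rw [← ht]; exact hu
      have hI : ∀ᶠ s in 𝓝 t, s ∈ Ioo a b := isOpen_Ioo.mem_nhds hta
      have := ODE_solution_unique_of_eventually (v := fun s z => F (s, z)) (K := K)
        (s := fun s => {z | (s, z) ∈ u}) (f := y1) (g := y2) (t₀ := t)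
        (Eventually.of_forall fun s => by
          apply LipschitzOnWith.of_dist_le_mul
          intro z hz z' hz'
          have := hK.dist_le_mul _ hz _ hz'
          simpa [Prod.dist_eq] using this)
        (by filter_upwards [hu1, hI] with s hs hs'; exact ⟨h1 s hs', hs⟩)
        (by filter_upwards [hu2, hI] with s hs hs'; exact ⟨h2 s hs', hs⟩) ht
      filter_upwards [this, hI] with s hs hs'
      exact ⟨hs, hs'⟩
    apply isPreconnected_Ioo.subset_of_closure_inter_subset hop ⟨t0, ht0, h0, ht0⟩
    rintro t ⟨htc, hta⟩
    refine ⟨?_, hta⟩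
    have h3 : ContinuousWithinAt (fun t => y1 t - y2 t) ({t | y1 t = y2 t} ∩ Ioo a b) t :=
      (hc t hta).mono inter_subset_right
    have h4 := h3.mem_closure_image htc
    have h5 : (fun t => y1 t - y2 t) '' ({t | y1 t = y2 t} ∩ Ioo a b) ⊆ {0} := by
      rintro _ ⟨s, ⟨hs, _⟩, rfl⟩
      simp only [mem_setOf_eq] at hs
      simp [hs]
    have h6 := closure_mono h5 h4
    rw [closure_singleton] at h6
    exact sub_eq_zero.1 h6
  exact fun t ht => (key ht).1

/-- gluing of solutions -/
theorem ode_glue {F : ℝ × ℝ → ℝ} {a t0 c : ℝ} {J : Set ℝ} (ha : a < t0) (hc : t0 < c)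
    (hJ : ∀ s ∈ J, t0 < s → ∃ s' ∈ J, s < s')
    {y1 y2 : ℝ → ℝ} (h0 : y1 t0 = y2 t0) (ht0 : t0 ∈ J)
    (h1 : ∀ t ∈ Ioo a c, HasDerivAt y1 (F (t, y1 t)) t)
    (h2 : ∀ t ∈ J, HasDerivWithinAt y2 (F (t, y2 t)) (Ici t0) t) :
    let y := fun t => if t ≤ t0 then y1 t else y2 t
    (∀ t ≤ t0, y t = y1 t) ∧ (∀ t ≥ t0, y t = y2 t) ∧
    (∀ t, a < t → (t ≤ t0 ∨ t ∈ J) → HasDerivAt y (F (t, y t)) t) := by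
  intro y
  have e1 : ∀ t ≤ t0, y t = y1 t := fun t ht => if_pos ht
  have e2 : ∀ t ≥ t0, y t = y2 t := by
    intro t ht
    rcases eq_or_lt_of_le ht with rfl | h
    · rw [e1 _ le_rfl, h0]
    · exact if_neg (not_le.2 h)
  refine ⟨e1, e2, ?_⟩
  intro t hat ht
  rcases lt_trichotomy t t0 with h | h | h
  · rw [e1 t h.le]
    refine (h1 t ⟨hat, h.trans hc⟩).congr_of_eventuallyEq ?_
    filter_upwards [Iio_mem_nhds h] with s hs using e1 s (le_of_lt hs)
  · subst h
    have d1 : HasDerivWithinAt y (F (t, y t)) (Iic t) t := by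
      rw [e1 t le_rfl]
      exact (h1 t ⟨hat, hc⟩).hasDerivWithinAt.congr (fun s hs => e1 s hs) (e1 t le_rfl)
    have d2 : HasDerivWithinAt y (F (t, y t)) (Ici t) t := by
      rw [e2 t le_rfl]
      exact (h2 t ht0).congr (fun s hs => e2 s hs) (e2 t le_rfl)
    have := d1.union d2
    rwa [Iic_union_Ici, hasDerivWithinAt_univ] at this
  · have ht' : t ∈ J := ht.resolve_left (not_le.2 h)
    rw [e2 t h.le]
    refine ((h2 t ht').hasDerivAt (Ici_mem_nhds h)).congr_of_eventuallyEq ?_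
    filter_upwards [Ioi_mem_nhds h] with s hs using e2 s (le_of_lt hs)

/-- bootstrap: an open-and-closed style continuity argument -/
theorem bootstrap {n : ℝ → ℝ} {t0 δ : ℝ} {b : ℝ} (hn : ContinuousOn n (Ico t0 b))
    (h0 : δ < n t0)
    (h : ∀ T ∈ Ico t0 b, (∀ t ∈ Ico t0 T, δ < n t) → δ < n T) : ∀ t ∈ Ico t0 b, δ < n t := by
  by_contra! hcon
  obtain ⟨t1, ht1, hle⟩ := hcon
  set s := {t | t ∈ Icc t0 t1 ∧ n t ≤ δ} with hs
  have hcl : IsClosed s := by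
    have : ContinuousOn n (Icc t0 t1) := hn.mono fun t ht => ⟨ht.1, ht.2.trans_lt ht1.2⟩
    have := this.preimage_isClosed_of_isClosed isClosed_Icc (isClosed_Iic (a := δ))
    exact this
  have hne : s.Nonempty := ⟨t1, ⟨ht1.1, le_rfl⟩, hle⟩
  have hbd : BddBelow s := ⟨t0, fun t ht => ht.1.1⟩
  have hmem := hcl.csInf_mem hne hbd
  have hT : sInf s ∈ Ico t0 b := ⟨hmem.1.1, hmem.1.2.trans_lt ht1.2⟩
  have := h (sInf s) hT fun t ht => by
    by_contra! h'
    have : sInf s ≤ t := csInf_le hbd ⟨⟨ht.1, (ht.2.trans_le hmem.1.2).le⟩, h'⟩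
    linarith [ht.2]
  linarith [hmem.2]

/-- first-exit barrier: if at every zero the derivative is positive, then positivity persists -/
theorem barrier {d d' : ℝ → ℝ} {t0 b : ℝ}
    (hd : ∀ t ∈ Ico t0 b, HasDerivWithinAt d (d' t) (Ici t0) t)
    (h0 : 0 < d t0) (h : ∀ t ∈ Ioo t0 b, (∀ s ∈ Ico t0 t, 0 < d s) → d t = 0 → 0 < d' t) :
    ∀ t ∈ Ico t0 b, 0 < d t := by
  apply bootstrap (fun t ht => ((hd t ht).continuousWithinAt).mono fun s hs => hs.1) h0
  intro T hT hpos
  rcases eq_or_lt_of_le hT.1 with rfl | hlt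
  · exact h0
  by_contra! hle
  have hcw : ContinuousWithinAt d (Ico t0 T) T :=
    ((hd T hT).continuousWithinAt).mono fun s hs => hs.1
  have hne : (𝓝[Ico t0 T] T).NeBot := by
    rw [← mem_closure_iff_nhdsWithin_neBot, closure_Ico hlt.ne]
    exact ⟨hlt.le, le_rfl⟩
  have hge : 0 ≤ d T := ge_of_tendsto hcw (by
    filter_upwards [self_mem_nhdsWithin] with s hs using (hpos s hs).le)
  have hz : d T = 0 := le_antisymm hle hge
  have hp := h T ⟨hlt, hT.2⟩ hpos hz
  have hD : HasDerivAt d (d' T) T := (hd T hT).hasDerivAt (Ici_mem_nhds hlt)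
  have h3 := hD.hasDerivWithinAt (s := Iio T)
  rw [hasDerivWithinAt_iff_tendsto_slope' (by simp)] at h3
  have h4 : ∀ᶠ s in 𝓝[<] T, 0 < slope d T s := h3.eventually (lt_mem_nhds hp)
  have h5 : ∀ᶠ s in 𝓝[<] T, s ∈ Ioo t0 T := Ioo_mem_nhdsLT hlt
  obtain ⟨s, hs1, hs2⟩ := (h4.and h5).exists
  have h6 := hpos s ⟨hs2.1.le, hs2.2⟩
  rw [slope_def_field, hz, sub_zero] at hs1
  have : d s / (s - T) < 0 := div_neg_of_pos_of_neg h6 (by linarith [hs2.2])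
  linarith


theorem conv_sing0 {D A a : ℝ → ℝ} {r L a0 : ℝ} (hr : 0 < r) (ha0 : 0 < a0)
    (hD : ∀ x ∈ Ioo (-r) 0, HasDerivAt D ((A x + a x * D x)/x) x)
    (hε : Tendsto (fun x => A x + a x * L) (𝓝[<] 0) (𝓝 0)) (e1 : ∀ᶠ x in 𝓝[<] (0:ℝ), a0/2 < a x) :
    Tendsto D (𝓝[<] 0) (𝓝 L) := by
  rw [Metric.tendsto_nhds]
  intro η hη
  have e2 : ∀ᶠ x in 𝓝[<] (0:ℝ), |A x + a x * L| < a0*η/8 := by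
    have := (Metric.tendsto_nhds.1 hε) (a0*η/8) (by positivity)
    simpa [Real.dist_eq] using this
  have e3 : ∀ᶠ x in 𝓝[<] (0:ℝ), x ∈ Ioo (-r) 0 := Ioo_mem_nhdsLT (by linarith)
  obtain ⟨x1, hx1, hx1'⟩ := (mem_nhdsLT_iff_exists_Ioo_subset).1 (e1.and (e2.and e3))
  simp only [mem_Iio] at hx1
  set q := fun x => (D x - L)^2 with hq
  set x2 := x1/2
  have hx2 : x1 < x2 ∧ x2 < 0 := by constructor <;> simp only [x2] <;> linarith
  have hsub : ∀ x ∈ Ico x2 0, x ∈ Ioo x1 0 := fun x hx => ⟨hx2.1.trans_le hx.1, hx.2⟩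
  have hqd : ∀ x ∈ Ioo x1 0, HasDerivAt q (2*(D x - L)*((A x + a x * D x)/x)) x := by
    intro x hx
    have := ((hD x (hx1' hx).2.2).sub_const L).pow 2
    refine this.congr_deriv ?_
    simp
  have hqn : ∀ x ∈ Ioo x1 0, (η/2)^2 ≤ q x → 2*(D x - L)*((A x + a x * D x)/x) ≤ a0*(η/2)^2/2/x := by
    intro x hx hge
    obtain ⟨h1, h2, h3⟩ := hx1' hx
    rw [← mul_div_assoc]
    apply div_le_div_of_nonpos_of_le hx.2.le
    have e : A x + a x * D x = a x * (D x - L) + (A x + a x * L) := by ring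
    rw [e]
    have h2' := abs_lt.1 h2
    set d := D x - L
    set ε := A x + a x * L
    have hge' : (η/2)^2 ≤ d^2 := hge
    have hd : η/2 ≤ |d| := by
      have := sq_le_sq.1 hge'
      rwa [abs_of_pos (by linarith : 0 < η/2)] at this
    have h4 : -(a0/4*d^2) ≤ d*ε := by
      have : |d*ε| ≤ a0/4*d^2 := by
        rw [abs_mul, ← sq_abs d]
        nlinarith [abs_nonneg d, abs_nonneg ε, mul_le_mul_of_nonneg_left h2.le (abs_nonneg d), mul_le_mul_of_nonneg_left hd (mul_nonneg ha0.le (abs_nonneg d))]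
      exact (abs_le.1 this).1
    nlinarith [sq_nonneg d]
  -- once in, stays
  have stay : ∀ x3 ∈ Ico x2 0, q x3 < (η/2)^2*2 → ∀ x ∈ Ico x3 0, q x < (η/2)^2*2 := by
    intro x3 hx3 hin x hx
    have := barrier (d := fun x => (η/2)^2*2 - q x) (d' := fun x => -(2*(D x - L)*((A x + a x * D x)/x)))
      (t0 := x3) (b := 0) (fun t ht => by
        have := (hqd t (hsub t ⟨hx3.1.trans ht.1, ht.2⟩)).const_sub ((η/2)^2*2)
        exact this.hasDerivWithinAt) (by linarith)
      (fun t ht _ hz => by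
        have h1 := hqn t (hsub t ⟨hx3.1.trans ht.1.le, ht.2⟩) (by nlinarith)
        have h2 : a0*(η/2)^2/2/t < 0 := div_neg_of_pos_of_neg (by positivity) ht.2
        linarith) x hx
    linarith
  have ex : ∃ x3 ∈ Ico x2 0, q x3 < (η/2)^2*2 := by
    by_contra! hcon
    set m := a0*(η/2)^2/2 with hm
    have hmpos : 0 < m := by positivity
    have anti : AntitoneOn (fun x => q x - m * Real.log (-x)) (Ico x2 0) := by
      apply antitoneOn_of_hasDerivWithinAt_nonpos (convex_Ico _ _)
        (f' := fun x => 2*(D x - L)*((A x + a x * D x)/x) - m * (1/x))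
      · intro x hx
        have h1 := (hqd x (hsub x hx)).continuousAt
        have h2 : ContinuousAt (fun x => Real.log (-x)) x :=
          (Real.continuousAt_log (by linarith [hx.2] : -x ≠ 0)).comp continuous_neg.continuousAt
        exact (h1.sub (h2.const_mul m)).continuousWithinAt
      · intro x hx
        rw [interior_Ico] at hx
        have h1 := hqd x (hsub x ⟨hx.1.le, hx.2⟩)
        have h2 : HasDerivAt (fun x => Real.log (-x)) (1/x) x := by
          have := (hasDerivAt_neg x).log (by linarith [hx.2] : -x ≠ 0)
          refine this.congr_deriv ?_
          have : x ≠ 0 := hx.2.ne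
          field_simp
        exact (h1.sub (h2.const_mul m)).hasDerivWithinAt
      · intro x hx
        rw [interior_Ico] at hx
        have h1 := hqn x (hsub x ⟨hx.1.le, hx.2⟩) (by
          have := hcon x ⟨hx.1.le, hx.2⟩
          nlinarith)
        have : m * (1/x) = a0*(η/2)^2/2/x := by rw [hm]; ring
        linarith
    have hlog : Tendsto (fun x => Real.log (-x)) (𝓝[<] (0:ℝ)) atBot := by
      have : Tendsto (fun x : ℝ => -x) (𝓝[<] 0) (𝓝[≠] 0) := by
        apply tendsto_nhdsWithin_iff.2
        refine ⟨?_, ?_⟩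
        · have : Tendsto (fun x : ℝ => -x) (𝓝 0) (𝓝 (-0)) := continuous_neg.tendsto 0
          rw [neg_zero] at this
          exact this.mono_left nhdsWithin_le_nhds
        · filter_upwards [self_mem_nhdsWithin] with x hx
          simp only [mem_Iio] at hx
          simp; linarith
      exact Real.tendsto_log_nhdsNE_zero.comp this
    have hb := hlog.eventually (eventually_lt_atBot ((-(q x2 - m * Real.log (-x2)))/m))
    obtain ⟨x, hx, hx'⟩ := (hb.and (Ico_mem_nhdsLT hx2.2)).exists
    have h1 := anti ⟨le_rfl, hx2.2⟩ hx' hx'.1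
    simp only at h1
    rw [lt_div_iff₀ hmpos] at hx
    have : 0 ≤ q x := sq_nonneg _
    have h2 := hcon x hx'
    nlinarith
  obtain ⟨x3, hx3, hin⟩ := ex
  filter_upwards [Ico_mem_nhdsLT hx3.2] with x hx
  have h1 := stay x3 hx3 hin x hx
  rw [Real.dist_eq]
  have : (D x - L)^2 < η^2 := by
    have : q x = (D x - L)^2 := rfl
    nlinarith
  exact abs_lt_of_sq_lt_sq this hη.le

theorem conv_sing {D A a : ℝ → ℝ} {r A0 a0 : ℝ} (hr : 0 < r) (ha0 : 0 < a0)
    (hD : ∀ x ∈ Ioo (-r) 0, HasDerivAt D ((A x + a x * D x)/x) x)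
    (hA : Tendsto A (𝓝[<] 0) (𝓝 A0)) (ha : Tendsto a (𝓝[<] 0) (𝓝 a0)) :
    Tendsto D (𝓝[<] 0) (𝓝 (-A0/a0)) := by
  have hε : Tendsto (fun x => A x + a x * (-A0/a0)) (𝓝[<] 0) (𝓝 0) := by
    have := hA.add (ha.mul_const (-A0/a0))
    have h0 : A0 + a0 * (-A0/a0) = 0 := by field_simp; ring
    rwa [h0] at this
  exact conv_sing0 hr ha0 hD hε (ha.eventually (lt_mem_nhds (by linarith)))


theorem sing_gen {E : Type*} [NormedAddCommGroup E] [NormedSpace ℝ E] (n : ℕ)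
    (Eh Mh Ah Kh q b : ℝ × E → ℝ) (E0 M0 d0 : E → ℝ)
    (hEh : ContDiff ℝ (⊤:ℕ∞) Eh) (hMh : ContDiff ℝ (⊤:ℕ∞) Mh) (hAh : ContDiff ℝ (⊤:ℕ∞) Ah)
    (hKh : ContDiff ℝ (⊤:ℕ∞) Kh) (hq : ContDiff ℝ (⊤:ℕ∞) q) (hb : ContDiff ℝ (⊤:ℕ∞) b)
    (hE0 : ContDiff ℝ (⊤:ℕ∞) E0) (hM0 : ContDiff ℝ (⊤:ℕ∞) M0) (hd0 : ContDiff ℝ (⊤:ℕ∞) d0)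
    (p1 p2 : ℝ) (hp : p1 ≤ p2) (w : ℝ → E) (hw : ContinuousOn w (Icc p1 p2))
    (hd : ∀ p ∈ Icc p1 p2, d0 (w p) ≠ 0) (hμ : ∀ p ∈ Icc p1 p2, 0 < -(M0 (w p)/(2*d0 (w p))))
    (hqb : ∀ x e, q (x,e) * b (x,e) = d0 e + x*Kh (x,e)) :
    ∃ r, 0 < r ∧ ∃ ζ : ℝ → ℝ → ℝ, (∀ x ∈ Ioo (-r) r, ContinuousOn (fun p => ζ p x) (Icc p1 p2)) ∧
      ∀ p ∈ Icc p1 p2, ContDiffOn ℝ (⊤:ℕ∞) (ζ p) (Ioo (-r) r) ∧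
        (∀ x ∈ Ioo (-r) r, 0 < d0 (w p) * (q (x, w p) * (b (x, w p) + x^(n+1)*ζ p x))) ∧
        (∀ x ∈ Ioo (-r) r, ∃ ζ', HasDerivAt (ζ p) ζ' x ∧
          2*(q (x, w p) * (b (x, w p) + x^(n+1)*ζ p x))*(x*ζ') =
            (E0 (w p) + x*Eh (x, w p)) + ζ p x * (M0 (w p) + x*Mh (x, w p))
              - x^(n+1)*Ah (x, w p)*(ζ p x)^2) ∧
        ζ p 0 * M0 (w p) = - E0 (w p) := by
  set c : ℝ → ℝ := fun p => E0 (w p)/(2*d0 (w p)) with hc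
  set μ : ℝ → ℝ := fun p => -(M0 (w p)/(2*d0 (w p))) with hμd
  have hcc : ContinuousOn c (Icc p1 p2) := by
    apply ContinuousOn.div (hE0.continuous.comp_continuousOn hw)
      (continuousOn_const.mul (hd0.continuous.comp_continuousOn hw))
    intro p hp; exact mul_ne_zero two_ne_zero (hd p hp)
  have hμc : ContinuousOn μ (Icc p1 p2) := by
    apply ContinuousOn.neg
    apply ContinuousOn.div (hM0.continuous.comp_continuousOn hw)
      (continuousOn_const.mul (hd0.continuous.comp_continuousOn hw))
    intro p hp; exact mul_ne_zero two_ne_zero (hd p hp)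
  obtain ⟨M, hM⟩ : ∃ M : ℝ, ∀ p ∈ Icc p1 p2, |c p/μ p| < M := by
    have h1 : ContinuousOn (fun p => |c p/μ p|) (Icc p1 p2) :=
      (hcc.div hμc (fun p hp => (hμ p hp).ne')).abs
    obtain ⟨C, hC⟩ := (isCompact_Icc.image_of_continuousOn h1).bddAbove
    exact ⟨C+1, fun p hp => by linarith [hC ⟨p, hp, rfl⟩]⟩
  have hK : IsCompact (Icc (-M) M ×ˢ (w '' Icc p1 p2)) := isCompact_Icc.prod (isCompact_Icc.image_of_continuousOn hw)
  have hev : ∀ᶠ x in 𝓝 (0:ℝ), ∀ z ∈ Icc (-M) M ×ˢ (w '' Icc p1 p2),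
      0 < d0 z.2 * (q (x, z.2) * (b (x, z.2) + x^(n+1)*z.1)) := by
    apply hK.eventually_forall_of_forall_eventually
    rintro ⟨ζ, e⟩ ⟨h1, p, hp, rfl⟩
    have hcont : Continuous (fun z : ℝ × ℝ × E => d0 z.2.2 * (q (z.1, z.2.2) * (b (z.1, z.2.2) + z.1^(n+1)*z.2.1))) := by
      have := hd0.continuous; have := hq.continuous; have := hb.continuous
      fun_prop
    refine ContinuousAt.eventually_lt continuousAt_const hcont.continuousAt ?_
    have := hqb 0 (w p)
    simp only [zero_mul, add_zero, zero_pow (Nat.succ_ne_zero n)] at this ⊢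
    rw [this]
    exact mul_self_pos.2 (hd p hp)
  obtain ⟨ε, hε, hpos⟩ := Metric.eventually_nhds_iff.1 hev
  have hpos' : ∀ x ∈ Icc (-(ε/2)) (ε/2), ∀ ζ ∈ Icc (-M) M, ∀ p ∈ Icc p1 p2,
      0 < d0 (w p) * (q (x, w p) * (b (x, w p) + x^(n+1)*ζ)) := by
    intro x hx ζ hζ p hp
    refine hpos (y := x) ?_ (ζ, w p) ⟨hζ, p, hp, rfl⟩
    rw [Real.dist_eq, sub_zero, abs_lt]
    constructor <;> linarith [hx.1, hx.2]
  set Φ : ℝ × ℝ × E → ℝ := fun z =>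
    ((Eh (z.1, z.2.2) + z.2.1*Mh (z.1, z.2.2) - z.1^n*Ah (z.1, z.2.2)*z.2.1^2)*d0 z.2.2
      - (E0 z.2.2 + z.2.1*M0 z.2.2)*(Kh (z.1, z.2.2) + q (z.1, z.2.2)*z.1^n*z.2.1))
    / (2*(q (z.1, z.2.2) * (b (z.1, z.2.2) + z.1^(n+1)*z.2.1))*d0 z.2.2) with hΦ
  have hΦs : ∀ x ∈ Icc (-(ε/2)) (ε/2), ∀ ζ ∈ Icc (-M) M, ∀ p ∈ Icc p1 p2,
      ContDiffAt ℝ (⊤:ℕ∞) Φ (x, ζ, w p) := by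
    intro x hx ζ hζ p hp
    have h0 := hpos' x hx ζ hζ p hp
    apply ContDiffAt.div
    · apply ContDiff.contDiffAt; fun_prop
    · apply ContDiff.contDiffAt; fun_prop
    · intro h
      simp only [mul_eq_zero] at h
      rcases h with h | h
      · rcases h with h | h
        · norm_num at h
        · rcases h with h | h <;> simp [h] at h0
      · simp [h] at h0
  obtain ⟨r, hr, hr', ξ, hξc, hξp, hξM, hξe⟩ := sing_picard Φ w c μ p1 p2 (ε/2) M hp (by linarith) hw hcc hμc hμ hM
    (fun x hx ζ hζ p hp => (hΦs x hx ζ hζ p hp).of_le (by exact_mod_cast le_top))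
  refine ⟨r, hr, ξ, fun x _ => (hξp x).continuousOn, fun p hp => ?_⟩
  have hmem : ∀ x ∈ Ioo (-r) r, x ∈ Icc (-(ε/2)) (ε/2) := fun x hx => ⟨by linarith [hx.1], by linarith [hx.2]⟩
  have hmem2 : ∀ x ∈ Ioo (-r) r, ξ p x ∈ Icc (-M) M := fun x hx => abs_le.1 (hξM p hp x ⟨hx.1.le, hx.2.le⟩)
  have hs := sing_smooth (hμ p hp) (f := fun z : ℝ × ℝ => Φ (z.1, z.2, w p)) (c := c p) (hξc p).continuousOn
    (fun x hx => by
      have h2 : ContDiffAt ℝ (⊤:ℕ∞) Φ (x, ξ p x, w p) := hΦs x (hmem x hx) _ (hmem2 x hx) p hp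
      exact ContDiffAt.comp (g := Φ) (f := fun z : ℝ × ℝ => (z.1, z.2, w p)) (x, ξ p x) h2
        (by apply ContDiff.contDiffAt; fun_prop))
    (fun x hx => hξe p hp x ⟨hx.1.le, hx.2.le⟩)
  refine ⟨hs.1, fun x hx => hpos' x (hmem x hx) _ (hmem2 x hx) p hp, fun x hx => ?_, ?_⟩
  · obtain ⟨ξ', h1, h2⟩ := hs.2 x hx
    refine ⟨ξ', h1, ?_⟩
    rw [h2]
    have hp0 := hpos' x (hmem x hx) _ (hmem2 x hx) p hp
    have hd' := hd p hp
    have hg : q (x, w p) * (b (x, w p) + x^(n+1)*ξ p x) ≠ 0 := fun h => by simp [h] at hp0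
    simp only [hc, hμd, hΦ]
    have hqbx := hqb x (w p)
    have hqg : q (x, w p) * (b (x, w p) + x^(n+1)*ξ p x) = d0 (w p) + x*(Kh (x,w p) + q (x, w p)*x^n*ξ p x) := by
      rw [mul_add, hqbx, pow_succ]; ring
    generalize q (x, w p) * (b (x, w p) + x^(n+1)*ξ p x) = G at *
    field_simp
    rw [hqg, pow_succ]; ring
  · have h0 := hξe p hp 0 ⟨by linarith, hr.le⟩
    rw [zero_mul, add_zero] at h0
    rw [h0]
    simp only [hc, hμd]
    have hd' := hd p hp
    have hM' : M0 (w p) ≠ 0 := by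
      intro h; have := hμ p hp; simp [h] at this
    field_simp


noncomputable section
def pb1 (k σ y : ℝ) : ℝ := (1-2*y)*(σ*k-(1-σ))
def pc1 (k σ y : ℝ) : ℝ := σ*k*(1-2*y)-2*(1-(1-σ)*y)
def pG (k σ y e : ℝ) : ℝ := pb1 k σ y * e - pc1 k σ y - (1+σ)*e^2
def pQ (k σ e : ℝ) : ℝ := (1-e)*(2*σ-(1-σ)/k*(1-e))
def pN (k σ y e γ : ℝ) : ℝ := 4*γ^2 - 4*(1+σ)*e*γ + pb1 k σ y*γ - pQ k σ e
def pW (k σ y e γ : ℝ) : ℝ := 4*γ-6*(1+σ)*e+pb1 k σ y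
end

structure Good (k σ y e R γ : ℝ) : Prop where
  hk : 1 ≤ k
  hs0 : 0 < σ
  hs1 : σ < 1
  y0 : 0 < y
  y1 : y < 1/2
  R3 : 3 ≤ R
  R4 : R ≤ 4
  e0 : 0 < e
  e1 : e < 1
  Re : 1 < R*e
  rb : k+2-k*y*(1+σ) = 2*(1+R)*e
  rc : k*((1-y)^2-σ*y^2) = 2*R*e^2
  hγ : 2*e*(R-2)*γ = pG k σ y e
  F1 : 0 < γ
  F2 : γ^2 < 2*pN k σ y e γ
  F3 : 4*e^2*σ*γ < pW k σ y e γ * pN k σ y e γ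
  F4 : e*(3*(1+σ)*γ+2*((1-σ)/k)) < 3*pN k σ y e γ
  F5 : 6*e*γ < 5*pN k σ y e γ
  F6 : (1-y)*(1-σ)*(1-e) < pG k σ y e

/-- facts from crude bounds -/
lemma good_aux {κ σ e γ b Q : ℝ} (hs0 : 0 < σ) (hs1 : σ < 1) (hκ0 : 0 ≤ κ)
  (he : 0 < e) (hγ : 0 < γ)
  (hN : 2*e*γ < 4*γ^2 - 4*(1+σ)*e*γ + b*γ - Q)
  (hN2 : γ^2 < 2*(4*γ^2 - 4*(1+σ)*e*γ + b*γ - Q))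
  (hκ : 2*κ ≤ 3*(1-σ)*γ) (hW : 2*e*σ ≤ 4*γ-6*(1+σ)*e+b) : 
  4*e^2*σ*γ < (4*γ-6*(1+σ)*e+b) * (4*γ^2 - 4*(1+σ)*e*γ + b*γ - Q) ∧
  e*(3*(1+σ)*γ+2*κ) < 3*(4*γ^2 - 4*(1+σ)*e*γ + b*γ - Q) := by
  set N := 4*γ^2 - 4*(1+σ)*e*γ + b*γ - Q
  set W := 4*γ-6*(1+σ)*e+b
  have h1 : 0 < e*σ := by positivity
  have h2 : 0 < e*γ := by positivity
  constructor
  · have : 0 < N := by nlinarith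
    calc 4*e^2*σ*γ = (2*e*σ)*(2*e*γ) := by ring
      _ < (2*e*σ)*N := by apply mul_lt_mul_of_pos_left hN; linarith
      _ ≤ W*N := by apply mul_le_mul_of_nonneg_right hW this.le
  · nlinarith [mul_le_mul_of_nonneg_left hκ he.le]

lemma k1A {y e : ℝ} (y0 : 0 < y) (y1 : y ≤ 1/4) (h1 : 1/4 < e) (h2 : e ≤ 3/8) :
    1.09 ≤ 2-2*y-(1-2*y)*e-e^2 := by nlinarith
lemma k1B {y e : ℝ} (y0 : 0 < y) (y1 : y ≤ 1/4) (h1 : 1/4 < e) (h2 : e ≤ 3/8) :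
    1.09 ≤ 1+2*y+(1-2*y)*e-2*e^2 := by nlinarith
lemma k1C {σ e γ b Q : ℝ} (hs0 : 0 < σ) (hs1 : σ < 1) (hγ2 : 0.94+0.14*σ ≤ γ)
    (hb1 : -1+1.5*σ ≤ b) (he5 : e ≤ 0.3834-0.05*σ) (h1 : 1/4 < e) (hQ : Q ≤ 1.5*σ-0.39*(1-σ)) :
    2*e*γ < 4*γ^2 - 4*(1+σ)*e*γ + b*γ - Q ∧ γ^2 < 2*(4*γ^2 - 4*(1+σ)*e*γ + b*γ - Q) ∧
    2*e*σ ≤ 4*γ-6*(1+σ)*e+b := by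
  have hγ0 : 0 < γ := by linarith
  have hσe : σ*e ≤ σ*(0.3834-0.05*σ) := mul_le_mul_of_nonneg_left he5 hs0.le
  have hss : σ*σ ≤ σ := by nlinarith
  have hq : σ/2 ≤ σ*σ + 1/16 := by nlinarith [sq_nonneg (σ-1/4)]
  have hq2 : σ ≤ σ*σ + 1/4 := by nlinarith [sq_nonneg (σ-1/2)]
  -- Q ≤ c γ
  have hQ' : Q ≤ (1.4*σ)*γ := by
    have : 1.4*σ*(0.94+0.14*σ) ≤ 1.4*σ*γ := mul_le_mul_of_nonneg_left hγ2 (by linarith)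
    nlinarith [sq_nonneg (σ-1)]
  have hL : 2*e < 4*γ - 4*(1+σ)*e + b - 1.4*σ := by nlinarith
  have hL2 : 0 < 7*γ - 8*(1+σ)*e + 2*b - 2*1.4*σ := by nlinarith
  refine ⟨?_, ?_, by nlinarith⟩
  · nlinarith [mul_pos hγ0 (sub_pos.2 hL)]
  · nlinarith [mul_pos hγ0 hL2]

set_option maxHeartbeats 1000000 in
lemma good_k1 {σ y e R γ : ℝ} (hs0 : 0 < σ) (hs1 : σ < 1) (y0 : 0 < y) (y1 : y ≤ 1/4)
  (R3 : 3 ≤ R) (R4 : R ≤ 4) (e0 : 0 < e) (e1 : e < 1) (Re : 1 < R*e)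
  (rb : 1+2-1*y*(1+σ) = 2*(1+R)*e) (rc : 1*((1-y)^2-σ*y^2) = 2*R*e^2)
  (hγ : 2*e*(R-2)*γ = pG 1 σ y e) : Good 1 σ y e R γ := by
  have he4 : 1/4 < e := by nlinarith
  have he38 : e ≤ 3/8 := by nlinarith [mul_pos y0 hs0]
  obtain ⟨h, hh⟩ : ∃ h, h = R*e-1 := ⟨_, rfl⟩
  have h0 : 0 < h := by linarith
  have hy : y*(1+σ) = 1-2*e-2*h := by rw [hh]; linarith
  have hhe : 2*h*(1-e) = (1-σ)*y*(1-y) := by rw [hh]; linear_combination -rb+ rc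
  have hb : h ≤ 0.15*(1-σ) := by
    have : y*(1-y) ≤ 3/16 := by nlinarith
    have : (1-σ)*(y*(1-y)) ≤ (1-σ)*(3/16) := mul_le_mul_of_nonneg_left this (by linarith)
    nlinarith
  have he3 : e ≤ (1+h)/3 := by rw [hh]; nlinarith
  have hm : 2*e*(R-2) ≤ 1+h := by rw [hh]; nlinarith
  have hm0 : 0 < 2*e*(R-2) := by nlinarith
  have A := k1A y0 y1 he4 he38
  have B := k1B y0 y1 he4 he38
  have hG : 1.09 ≤ pG 1 σ y e := by
    have : pG 1 σ y e = (1-σ)*(2-2*y-(1-2*y)*e-e^2) + σ*(1+2*y+(1-2*y)*e-2*e^2) := by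
      unfold pG pb1 pc1; ring
    rw [this]
    have := mul_le_mul_of_nonneg_left A (by linarith : 0 ≤ 1-σ)
    have := mul_le_mul_of_nonneg_left B hs0.le
    linarith
  have hγ0 : 0 < γ := by
    by_contra! hc
    have := mul_nonpos_of_nonneg_of_nonpos hm0.le hc
    linarith
  have hγ1 : 1.09 ≤ (1+h)*γ := by
    have := mul_le_mul_of_nonneg_right hm hγ0.le
    linarith
  have hγ2 : 0.94+0.14*σ ≤ γ := by
    have : (1+h)*γ ≤ (1.15-0.15*σ)*γ := mul_le_mul_of_nonneg_right (by linarith) hγ0.le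
    have h2 : 1.09 ≤ (1.15-0.15*σ)*γ := hγ1.trans this
    by_contra! hc
    have h3 := mul_lt_mul_of_pos_left hc (by linarith : 0 < 1.15-0.15*σ)
    have h4 := sq_nonneg (σ-0.5)
    ring_nf at h2 h3 h4
    linarith
  have hb1 : -1+1.5*σ ≤ pb1 1 σ y := by
    unfold pb1
    have := mul_pos y0 (sub_pos.2 hs1)
    have := mul_nonneg hs0.le (sub_nonneg.2 y1)
    linarith
  have he5 : e ≤ 0.3834-0.05*σ := by linarith
  have hQ : pQ 1 σ e ≤ 1.5*σ-0.39*(1-σ) := by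
    unfold pQ; simp only [div_one]
    have h1 : 0.39 ≤ (1-e)^2 := by
      have : (0.625:ℝ)^2 ≤ (1-e)^2 := pow_le_pow_left₀ (by norm_num) (by linarith) 2
      norm_num at this ⊢; linarith
    have h2 := mul_le_mul_of_nonneg_left h1 (by linarith : 0 ≤ 1-σ)
    have h3 := mul_le_mul_of_nonneg_left he4.le hs0.le
    linarith
  obtain ⟨c1, c2, c3⟩ := k1C hs0 hs1 hγ2 hb1 he5 he4 hQ
  obtain ⟨d1, d2⟩ := good_aux (κ := (1-σ)/1) hs0 hs1 (by rw [div_one]; linarith) e0 hγ0 c1 c2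
    (by rw [div_one]; linarith [mul_le_mul_of_nonneg_left (by linarith : 2/3 ≤ γ) (by linarith : 0 ≤ 1-σ)]) c3
  have d5 : 6*e*γ < 5*pN 1 σ y e γ := by
    have : 0 < e*γ := by positivity
    unfold pN; linarith
  have d6 : (1-y)*(1-σ)*(1-e) < pG 1 σ y e := by
    have : (1-y)*((1-σ)*(1-e)) < 1 := by
      have h1 : (1-σ)*(1-e) < 1 := by
        have := mul_pos hs0 (sub_pos.2 e1)
        linarith
      have h2 : 0 < (1-σ)*(1-e) := mul_pos (by linarith) (by linarith)
      have := mul_pos y0 h2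
      linarith
    rw [mul_assoc]; linarith
  exact ⟨le_rfl, hs0, hs1, y0, by linarith, R3, R4, e0, e1, Re, rb, rc, hγ, hγ0, c2, d1, d2, d5, d6⟩


set_option maxHeartbeats 1000000 in
lemma k2a {σ h e : ℝ} (hs0 : 0 ≤ σ) (hs1 : σ ≤ 1) (h0 : 0 ≤ h) (h1 : h ≤ 0.47*(1-σ))
   (e1 : 1+h ≤ 4*e) (e2 : 3*e ≤ 1+h) (hy : 1-e-h ≤ 3/8*(1+σ)) :
   (1+σ)*1.5*(1+h-2*e) ≤ (3*σ-1)*(σ-1+2*e+2*h)*e - (2*σ*(σ-1+2*e+2*h) -2*(1+σ)+2*(1-σ)*(1-e-h)) - (1+σ)^2*e^2 := by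
  nlinarith [mul_nonneg (sub_nonneg.2 e1) (sub_nonneg.2 e2), mul_nonneg hs0 (sub_nonneg.2 e2), mul_nonneg hs0 (sub_nonneg.2 e1), mul_nonneg hs0 (sub_nonneg.2 hs1), mul_nonneg hs0 h0, mul_nonneg hs0 (sub_nonneg.2 h1), mul_nonneg h0 (sub_nonneg.2 h1), mul_nonneg hs0 (mul_nonneg (sub_nonneg.2 e1) (sub_nonneg.2 e2)), mul_nonneg hs0 (sub_nonneg.2 hy), mul_nonneg h0 (sub_nonneg.2 hy)]

set_option maxHeartbeats 4000000 in
lemma k2b {σ h e y : ℝ} (hs0 : 0 ≤ σ) (c1 : 0 ≤ 1-σ) (h0 : 0 ≤ h) (c2 : 0 ≤ 0.47*(1-σ)-h)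
   (c3 : 0 ≤ 4*e-1-h) (c4 : 0 ≤ 1+h-3*e) (c5 : 0 ≤ 3/8-y) (hy : y*(1+σ) = 1-e-h) :
   0 < 2*((1-2*y)*(3*σ-1)*e - (2*σ*(1-2*y) -2*(1-(1-σ)*y)) - (1+σ)*e^2) -
     (1+h-2*e)*((6+4*σ)*e-(1-2*y)*(3*σ-1)+2*σ) := by
  have q1 : e*(y*(1+σ)) = e*(1-e-h) := by rw [hy]
  have q2 : h*(y*(1+σ)) = h*(1-e-h) := by rw [hy]
  have q3 : σ*(y*(1+σ)) = σ*(1-e-h) := by rw [hy]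
  have q4 : y*(y*(1+σ)) = y*(1-e-h) := by rw [hy]
  linarith [(mul_nonneg hs0 hs0), (mul_nonneg hs0 c1), (mul_nonneg hs0 h0), (mul_nonneg hs0 c2), (mul_nonneg hs0 c3), (mul_nonneg hs0 c4), (mul_nonneg hs0 c5), (mul_nonneg c1 c1), (mul_nonneg c1 h0), (mul_nonneg c1 c2), (mul_nonneg c1 c3), (mul_nonneg c1 c4), (mul_nonneg c1 c5), (mul_nonneg h0 h0), (mul_nonneg h0 c2), (mul_nonneg h0 c3), (mul_nonneg h0 c4), (mul_nonneg h0 c5), (mul_nonneg c2 c2), (mul_nonneg c2 c3), (mul_nonneg c2 c4), (mul_nonneg c2 c5), (mul_nonneg c3 c3), (mul_nonneg c3 c4), (mul_nonneg c3 c5), (mul_nonneg c4 c4), (mul_nonneg c4 c5), (mul_nonneg c5 c5), (mul_nonneg (mul_nonneg hs0 hs0) hs0), (mul_nonneg (mul_nonneg hs0 hs0) c1), (mul_nonneg (mul_nonneg hs0 hs0) h0), (mul_nonneg (mul_nonneg hs0 hs0) c2), (mul_nonneg (mul_nonneg hs0 hs0) c3), (mul_nonneg (mul_nonneg hs0 hs0)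 c4), (mul_nonneg (mul_nonneg hs0 hs0) c5), (mul_nonneg (mul_nonneg hs0 c1) c1), (mul_nonneg (mul_nonneg hs0 c1) h0), (mul_nonneg (mul_nonneg hs0 c1) c2), (mul_nonneg (mul_nonneg hs0 c1) c3), (mul_nonneg (mul_nonneg hs0 c1) c4), (mul_nonneg (mul_nonneg hs0 c1) c5), (mul_nonneg (mul_nonneg hs0 h0) h0), (mul_nonneg (mul_nonneg hs0 h0) c2), (mul_nonneg (mul_nonneg hs0 h0) c3), (mul_nonneg (mul_nonneg hs0 h0) c4), (mul_nonneg (mul_nonneg hs0 h0) c5), (mul_nonneg (mul_nonneg hs0 c2) c2), (mul_nonneg (mul_nonneg hs0 c2) c3), (mul_nonneg (mul_nonneg hs0 c2) c4), (mul_nonneg (mul_nonneg hs0 c2) c5), (mul_nonneg (mul_nonneg hs0 c3) c3), (mul_nonneg (mul_nonneg hs0 c3) c4), (mul_nonneg (mul_nonneg hs0 c3) c5), (mul_nonneg (mul_nonneg hs0 c4) c4), (mul_nonneg (mul_nonneg hs0 c4) c5), (mul_nonneg (mul_nonneg hs0 c5) c5), (mul_nonneg (mul_nonneg c1 c1) c1),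 (mul_nonneg (mul_nonneg c1 c1) h0), (mul_nonneg (mul_nonneg c1 c1) c2), (mul_nonneg (mul_nonneg c1 c1) c3), (mul_nonneg (mul_nonneg c1 c1) c4), (mul_nonneg (mul_nonneg c1 c1) c5), (mul_nonneg (mul_nonneg c1 h0) h0), (mul_nonneg (mul_nonneg c1 h0) c2), (mul_nonneg (mul_nonneg c1 h0) c3), (mul_nonneg (mul_nonneg c1 h0) c4), (mul_nonneg (mul_nonneg c1 h0) c5), (mul_nonneg (mul_nonneg c1 c2) c2), (mul_nonneg (mul_nonneg c1 c2) c3), (mul_nonneg (mul_nonneg c1 c2) c4), (mul_nonneg (mul_nonneg c1 c2) c5), (mul_nonneg (mul_nonneg c1 c3) c3), (mul_nonneg (mul_nonneg c1 c3) c4), (mul_nonneg (mul_nonneg c1 c3) c5), (mul_nonneg (mul_nonneg c1 c4) c4), (mul_nonneg (mul_nonneg c1 c4) c5), (mul_nonneg (mul_nonneg c1 c5) c5), (mul_nonneg (mul_nonneg h0 h0) h0), (mul_nonneg (mul_nonneg h0 h0) c2), (mul_nonneg (mul_nonneg h0 h0) c3), (mul_nonneg (mul_nonneg h0 h0) c4),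 (mul_nonneg (mul_nonneg h0 h0) c5), (mul_nonneg (mul_nonneg h0 c2) c2), (mul_nonneg (mul_nonneg h0 c2) c3), (mul_nonneg (mul_nonneg h0 c2) c4), (mul_nonneg (mul_nonneg h0 c2) c5), (mul_nonneg (mul_nonneg h0 c3) c3), (mul_nonneg (mul_nonneg h0 c3) c4), (mul_nonneg (mul_nonneg h0 c3) c5), (mul_nonneg (mul_nonneg h0 c4) c4), (mul_nonneg (mul_nonneg h0 c4) c5), (mul_nonneg (mul_nonneg h0 c5) c5), (mul_nonneg (mul_nonneg c2 c2) c2), (mul_nonneg (mul_nonneg c2 c2) c3), (mul_nonneg (mul_nonneg c2 c2) c4), (mul_nonneg (mul_nonneg c2 c2) c5), (mul_nonneg (mul_nonneg c2 c3) c3), (mul_nonneg (mul_nonneg c2 c3) c4), (mul_nonneg (mul_nonneg c2 c3) c5), (mul_nonneg (mul_nonneg c2 c4) c4), (mul_nonneg (mul_nonneg c2 c4) c5), (mul_nonneg (mul_nonneg c2 c5) c5), (mul_nonneg (mul_nonneg c3 c3) c3), (mul_nonneg (mul_nonneg c3 c3) c4), (mul_nonneg (mul_nonneg c3 c3) c5),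 (mul_nonneg (mul_nonneg c3 c4) c4), (mul_nonneg (mul_nonneg c3 c4) c5), (mul_nonneg (mul_nonneg c3 c5) c5), (mul_nonneg (mul_nonneg c4 c4) c4), (mul_nonneg (mul_nonneg c4 c4) c5), (mul_nonneg (mul_nonneg c4 c5) c5), (mul_nonneg (mul_nonneg c5 c5) c5)]

set_option maxHeartbeats 4000000 in
lemma k2c {σ h e y : ℝ} (hs0 : 0 ≤ σ) (c1 : 0 ≤ 1-σ) (h0 : 0 ≤ h) (c2 : 0 ≤ 0.47*(1-σ)-h)
   (c3 : 0 ≤ 4*e-1-h) (c4 : 0 ≤ 1+h-3*e) (c5 : 0 ≤ 3/8-y) (hy : y*(1+σ) = 1-e-h) :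
   0 < 7*((1-2*y)*(3*σ-1)*e - (2*σ*(1-2*y) -2*(1-(1-σ)*y)) - (1+σ)*e^2) -
     2*(1+h-2*e)*(8*(1+σ)*e-2*(1-2*y)*(3*σ-1)+4*σ) := by
  have q1 : e*(y*(1+σ)) = e*(1-e-h) := by rw [hy]
  have q2 : h*(y*(1+σ)) = h*(1-e-h) := by rw [hy]
  have q3 : σ*(y*(1+σ)) = σ*(1-e-h) := by rw [hy]
  have q4 : y*(y*(1+σ)) = y*(1-e-h) := by rw [hy]
  linarith [(mul_nonneg hs0 hs0), (mul_nonneg hs0 c1), (mul_nonneg hs0 h0), (mul_nonneg hs0 c2), (mul_nonneg hs0 c3), (mul_nonneg hs0 c4), (mul_nonneg hs0 c5), (mul_nonneg c1 c1), (mul_nonneg c1 h0), (mul_nonneg c1 c2), (mul_nonneg c1 c3), (mul_nonneg c1 c4), (mul_nonneg c1 c5), (mul_nonneg h0 h0), (mul_nonneg h0 c2), (mul_nonneg h0 c3), (mul_nonneg h0 c4), (mul_nonneg h0 c5), (mul_nonneg c2 c2), (mul_nonneg c2 c3), (mul_nonneg c2 c4), (mul_nonneg c2 c5), (mul_nonneg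 c3 c3), (mul_nonneg c3 c4), (mul_nonneg c3 c5), (mul_nonneg c4 c4), (mul_nonneg c4 c5), (mul_nonneg c5 c5), (mul_nonneg (mul_nonneg hs0 hs0) hs0), (mul_nonneg (mul_nonneg hs0 hs0) c1), (mul_nonneg (mul_nonneg hs0 hs0) h0), (mul_nonneg (mul_nonneg hs0 hs0) c2), (mul_nonneg (mul_nonneg hs0 hs0) c3), (mul_nonneg (mul_nonneg hs0 hs0) c4), (mul_nonneg (mul_nonneg hs0 hs0) c5), (mul_nonneg (mul_nonneg hs0 c1) c1), (mul_nonneg (mul_nonneg hs0 c1) h0), (mul_nonneg (mul_nonneg hs0 c1) c2), (mul_nonneg (mul_nonneg hs0 c1) c3), (mul_nonneg (mul_nonneg hs0 c1) c4), (mul_nonneg (mul_nonneg hs0 c1) c5), (mul_nonneg (mul_nonneg hs0 h0) h0), (mul_nonneg (mul_nonneg hs0 h0) c2), (mul_nonneg (mul_nonneg hs0 h0) c3), (mul_nonneg (mul_nonneg hs0 h0) c4), (mul_nonneg (mul_nonneg hs0 h0) c5), (mul_nonneg (mul_nonneg hs0 c2) c2), (mul_nonneg (mul_nonneg hs0 c2)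 c3), (mul_nonneg (mul_nonneg hs0 c2) c4), (mul_nonneg (mul_nonneg hs0 c2) c5), (mul_nonneg (mul_nonneg hs0 c3) c3), (mul_nonneg (mul_nonneg hs0 c3) c4), (mul_nonneg (mul_nonneg hs0 c3) c5), (mul_nonneg (mul_nonneg hs0 c4) c4), (mul_nonneg (mul_nonneg hs0 c4) c5), (mul_nonneg (mul_nonneg hs0 c5) c5), (mul_nonneg (mul_nonneg c1 c1) c1), (mul_nonneg (mul_nonneg c1 c1) h0), (mul_nonneg (mul_nonneg c1 c1) c2), (mul_nonneg (mul_nonneg c1 c1) c3), (mul_nonneg (mul_nonneg c1 c1) c4), (mul_nonneg (mul_nonneg c1 c1) c5), (mul_nonneg (mul_nonneg c1 h0) h0), (mul_nonneg (mul_nonneg c1 h0) c2), (mul_nonneg (mul_nonneg c1 h0) c3), (mul_nonneg (mul_nonneg c1 h0) c4), (mul_nonneg (mul_nonneg c1 h0) c5), (mul_nonneg (mul_nonneg c1 c2) c2), (mul_nonneg (mul_nonneg c1 c2) c3), (mul_nonneg (mul_nonneg c1 c2) c4), (mul_nonneg (mul_nonneg c1 c2) c5), (mul_nonneg (mul_nonneg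 c1 c3) c3), (mul_nonneg (mul_nonneg c1 c3) c4), (mul_nonneg (mul_nonneg c1 c3) c5), (mul_nonneg (mul_nonneg c1 c4) c4), (mul_nonneg (mul_nonneg c1 c4) c5), (mul_nonneg (mul_nonneg c1 c5) c5), (mul_nonneg (mul_nonneg h0 h0) h0), (mul_nonneg (mul_nonneg h0 h0) c2), (mul_nonneg (mul_nonneg h0 h0) c3), (mul_nonneg (mul_nonneg h0 h0) c4), (mul_nonneg (mul_nonneg h0 h0) c5), (mul_nonneg (mul_nonneg h0 c2) c2), (mul_nonneg (mul_nonneg h0 c2) c3), (mul_nonneg (mul_nonneg h0 c2) c4), (mul_nonneg (mul_nonneg h0 c2) c5), (mul_nonneg (mul_nonneg h0 c3) c3), (mul_nonneg (mul_nonneg h0 c3) c4), (mul_nonneg (mul_nonneg h0 c3) c5), (mul_nonneg (mul_nonneg h0 c4) c4), (mul_nonneg (mul_nonneg h0 c4) c5), (mul_nonneg (mul_nonneg h0 c5) c5), (mul_nonneg (mul_nonneg c2 c2) c2), (mul_nonneg (mul_nonneg c2 c2) c3), (mul_nonneg (mul_nonneg c2 c2) c4), (mul_nonneg (mul_nonneg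 c2 c2) c5), (mul_nonneg (mul_nonneg c2 c3) c3), (mul_nonneg (mul_nonneg c2 c3) c4), (mul_nonneg (mul_nonneg c2 c3) c5), (mul_nonneg (mul_nonneg c2 c4) c4), (mul_nonneg (mul_nonneg c2 c4) c5), (mul_nonneg (mul_nonneg c2 c5) c5), (mul_nonneg (mul_nonneg c3 c3) c3), (mul_nonneg (mul_nonneg c3 c3) c4), (mul_nonneg (mul_nonneg c3 c3) c5), (mul_nonneg (mul_nonneg c3 c4) c4), (mul_nonneg (mul_nonneg c3 c4) c5), (mul_nonneg (mul_nonneg c3 c5) c5), (mul_nonneg (mul_nonneg c4 c4) c4), (mul_nonneg (mul_nonneg c4 c4) c5), (mul_nonneg (mul_nonneg c4 c5) c5), (mul_nonneg (mul_nonneg c5 c5) c5)]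

set_option maxHeartbeats 4000000 in
lemma k2d {σ h e y : ℝ} (hs0 : 0 ≤ σ) (c1 : 0 ≤ 1-σ) (h0 : 0 ≤ h) (c2 : 0 ≤ 0.47*(1-σ)-h)
   (c3 : 0 ≤ 4*e-1-h) (c4 : 0 ≤ 1+h-3*e) (c5 : 0 ≤ 3/8-y) (hy : y*(1+σ) = 1-e-h) :
   (1-y)*(1-σ)*(1-e) < ((1-2*y)*(3*σ-1)*e - (2*σ*(1-2*y) -2*(1-(1-σ)*y)) - (1+σ)*e^2) := by
  have q1 : e*(y*(1+σ)) = e*(1-e-h) := by rw [hy]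
  have q2 : h*(y*(1+σ)) = h*(1-e-h) := by rw [hy]
  have q3 : σ*(y*(1+σ)) = σ*(1-e-h) := by rw [hy]
  have q4 : y*(y*(1+σ)) = y*(1-e-h) := by rw [hy]
  linarith [(mul_nonneg hs0 hs0), (mul_nonneg hs0 c1), (mul_nonneg hs0 h0), (mul_nonneg hs0 c2), (mul_nonneg hs0 c3), (mul_nonneg hs0 c4), (mul_nonneg hs0 c5), (mul_nonneg c1 c1), (mul_nonneg c1 h0), (mul_nonneg c1 c2), (mul_nonneg c1 c3), (mul_nonneg c1 c4), (mul_nonneg c1 c5), (mul_nonneg h0 h0), (mul_nonneg h0 c2), (mul_nonneg h0 c3), (mul_nonneg h0 c4), (mul_nonneg h0 c5), (mul_nonneg c2 c2), (mul_nonneg c2 c3), (mul_nonneg c2 c4), (mul_nonneg c2 c5), (mul_nonneg c3 c3), (mul_nonneg c3 c4), (mul_nonneg c3 c5), (mul_nonneg c4 c4), (mul_nonneg c4 c5), (mul_nonneg c5 c5), (mul_nonneg (mul_nonneg hs0 hs0) hs0), (mul_nonneg (mul_nonneg hs0 hs0) c1), (mul_nonneg (mul_nonneg hs0 hs0) h0),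 (mul_nonneg (mul_nonneg hs0 hs0) c2), (mul_nonneg (mul_nonneg hs0 hs0) c3), (mul_nonneg (mul_nonneg hs0 hs0) c4), (mul_nonneg (mul_nonneg hs0 hs0) c5), (mul_nonneg (mul_nonneg hs0 c1) c1), (mul_nonneg (mul_nonneg hs0 c1) h0), (mul_nonneg (mul_nonneg hs0 c1) c2), (mul_nonneg (mul_nonneg hs0 c1) c3), (mul_nonneg (mul_nonneg hs0 c1) c4), (mul_nonneg (mul_nonneg hs0 c1) c5), (mul_nonneg (mul_nonneg hs0 h0) h0), (mul_nonneg (mul_nonneg hs0 h0) c2), (mul_nonneg (mul_nonneg hs0 h0) c3), (mul_nonneg (mul_nonneg hs0 h0) c4), (mul_nonneg (mul_nonneg hs0 h0) c5), (mul_nonneg (mul_nonneg hs0 c2) c2), (mul_nonneg (mul_nonneg hs0 c2) c3), (mul_nonneg (mul_nonneg hs0 c2) c4), (mul_nonneg (mul_nonneg hs0 c2) c5), (mul_nonneg (mul_nonneg hs0 c3) c3), (mul_nonneg (mul_nonneg hs0 c3) c4), (mul_nonneg (mul_nonneg hs0 c3) c5), (mul_nonneg (mul_nonneg hs0 c4)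 c4), (mul_nonneg (mul_nonneg hs0 c4) c5), (mul_nonneg (mul_nonneg hs0 c5) c5), (mul_nonneg (mul_nonneg c1 c1) c1), (mul_nonneg (mul_nonneg c1 c1) h0), (mul_nonneg (mul_nonneg c1 c1) c2), (mul_nonneg (mul_nonneg c1 c1) c3), (mul_nonneg (mul_nonneg c1 c1) c4), (mul_nonneg (mul_nonneg c1 c1) c5), (mul_nonneg (mul_nonneg c1 h0) h0), (mul_nonneg (mul_nonneg c1 h0) c2), (mul_nonneg (mul_nonneg c1 h0) c3), (mul_nonneg (mul_nonneg c1 h0) c4), (mul_nonneg (mul_nonneg c1 h0) c5), (mul_nonneg (mul_nonneg c1 c2) c2), (mul_nonneg (mul_nonneg c1 c2) c3), (mul_nonneg (mul_nonneg c1 c2) c4), (mul_nonneg (mul_nonneg c1 c2) c5), (mul_nonneg (mul_nonneg c1 c3) c3), (mul_nonneg (mul_nonneg c1 c3) c4), (mul_nonneg (mul_nonneg c1 c3) c5), (mul_nonneg (mul_nonneg c1 c4) c4), (mul_nonneg (mul_nonneg c1 c4) c5), (mul_nonneg (mul_nonneg c1 c5) c5), (mul_nonneg (mul_nonneg h0 h0)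 h0), (mul_nonneg (mul_nonneg h0 h0) c2), (mul_nonneg (mul_nonneg h0 h0) c3), (mul_nonneg (mul_nonneg h0 h0) c4), (mul_nonneg (mul_nonneg h0 h0) c5), (mul_nonneg (mul_nonneg h0 c2) c2), (mul_nonneg (mul_nonneg h0 c2) c3), (mul_nonneg (mul_nonneg h0 c2) c4), (mul_nonneg (mul_nonneg h0 c2) c5), (mul_nonneg (mul_nonneg h0 c3) c3), (mul_nonneg (mul_nonneg h0 c3) c4), (mul_nonneg (mul_nonneg h0 c3) c5), (mul_nonneg (mul_nonneg h0 c4) c4), (mul_nonneg (mul_nonneg h0 c4) c5), (mul_nonneg (mul_nonneg h0 c5) c5), (mul_nonneg (mul_nonneg c2 c2) c2), (mul_nonneg (mul_nonneg c2 c2) c3), (mul_nonneg (mul_nonneg c2 c2) c4), (mul_nonneg (mul_nonneg c2 c2) c5), (mul_nonneg (mul_nonneg c2 c3) c3), (mul_nonneg (mul_nonneg c2 c3) c4), (mul_nonneg (mul_nonneg c2 c3) c5), (mul_nonneg (mul_nonneg c2 c4) c4), (mul_nonneg (mul_nonneg c2 c4) c5), (mul_nonneg (mul_nonneg c2 c5)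 c5), (mul_nonneg (mul_nonneg c3 c3) c3), (mul_nonneg (mul_nonneg c3 c3) c4), (mul_nonneg (mul_nonneg c3 c3) c5), (mul_nonneg (mul_nonneg c3 c4) c4), (mul_nonneg (mul_nonneg c3 c4) c5), (mul_nonneg (mul_nonneg c3 c5) c5), (mul_nonneg (mul_nonneg c4 c4) c4), (mul_nonneg (mul_nonneg c4 c4) c5), (mul_nonneg (mul_nonneg c4 c5) c5), (mul_nonneg (mul_nonneg c5 c5) c5)]

set_option maxHeartbeats 1000000 in
lemma good_k2 {σ y e R γ : ℝ} (hs0 : 0 < σ) (hs1 : σ < 1) (y0 : 0 < y) (y1 : y ≤ 3/8)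
  (R3 : 3 ≤ R) (R4 : R ≤ 4) (e0 : 0 < e) (e1 : e < 1) (Re : 1 < R*e)
  (rb : 2+2-2*y*(1+σ) = 2*(1+R)*e) (rc : 2*((1-y)^2-σ*y^2) = 2*R*e^2)
  (hγ : 2*e*(R-2)*γ = pG 2 σ y e) : Good 2 σ y e R γ := by
  have he4 : 1/4 < e := by nlinarith
  have he38 : e ≤ 1/2 := by nlinarith [mul_pos y0 hs0]
  obtain ⟨h, hh⟩ : ∃ h, h = R*e-1 := ⟨_, rfl⟩
  have h0 : 0 < h := by linarith
  have hy : y*(1+σ) = 1-e-h := by rw [hh]; linarith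
  have hhe : h*(1-e) = (1-σ)*y*(1-y) := by rw [hh]; linear_combination (-rb+ rc)/2
  have hb : h ≤ 0.47*(1-σ) := by
    have : y*(1-y) ≤ 15/64 := by nlinarith
    have : (1-σ)*(y*(1-y)) ≤ (1-σ)*(15/64) := mul_le_mul_of_nonneg_left this (by linarith)
    nlinarith
  have he3 : 3*e ≤ 1+h := by rw [hh]; nlinarith
  have he5 : 1+h ≤ 4*e := by rw [hh]; nlinarith
  have hm0 : 0 < 1+h-2*e := by linarith
  have hγ' : 2*(1+h-2*e)*γ = pG 2 σ y e := by rw [← hγ, hh]; ring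
  have hGe : pG 2 σ y e = (1-2*y)*(3*σ-1)*e - (2*σ*(1-2*y) -2*(1-(1-σ)*y)) - (1+σ)*e^2 := by
    unfold pG pb1 pc1; ring
  have hbe : pb1 2 σ y = (1-2*y)*(3*σ-1) := by unfold pb1; ring
  have A := k2a hs0.le hs1.le h0.le hb he5 he3 (by rw [← hy]; nlinarith)
  have hyy : (1+σ)*(1-2*y) = σ-1+2*e+2*h := by linear_combination -2*hy
  have A' : (1+σ)*(1.5*(1+h-2*e)) ≤ (1+σ)*pG 2 σ y e := by
    rw [hGe]
    refine le_of_eq_of_le (by ring) (A.trans (le_of_eq ?_))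
    rw [← hyy]
    linear_combination 2*(1-σ)*hy
  have A'' := le_of_mul_le_mul_left A' (by linarith)
  have hγ3 : 0.75 ≤ γ := by
    by_contra! hc
    have := mul_lt_mul_of_pos_left hc (by linarith : 0 < 2*(1+h-2*e))
    linarith
  have hγ0 : 0 < γ := by linarith
  have B := k2b hs0.le (sub_nonneg.2 hs1.le) h0.le (sub_nonneg.2 hb) (by linarith : 0 ≤ 4*e-1-h)
    (by linarith) (by linarith : 0 ≤ 3/8-y) hy
  have C := k2c hs0.le (sub_nonneg.2 hs1.le) h0.le (sub_nonneg.2 hb) (by linarith : 0 ≤ 4*e-1-h)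
    (by linarith) (by linarith : 0 ≤ 3/8-y) hy
  rw [← hGe, ← hγ', ← hbe] at B
  rw [← hGe, ← hγ', mul_assoc 2 (1-2*y), ← hbe] at C
  have B' : 0 < 4*γ - ((6+4*σ)*e-pb1 2 σ y+2*σ) := by
    apply pos_of_mul_pos_right _ hm0.le
    linarith
  have C' : 0 < 7*γ - (8*(1+σ)*e-2*pb1 2 σ y+4*σ) := by
    have : 0 < (1+h-2*e)*(2*(7*γ - (8*(1+σ)*e-2*pb1 2 σ y+4*σ))) := by linarith
    have := pos_of_mul_pos_right this hm0.le
    linarith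
  have hQ : pQ 2 σ e ≤ 2*σ*γ := by
    unfold pQ
    have h1 : 0 ≤ (1-σ)/2*(1-e) := mul_nonneg (by linarith) (by linarith)
    have h2 := mul_nonneg h1 (by linarith : 0 ≤ 1-e)
    have h3 := mul_le_mul_of_nonneg_left (by linarith : 1-e ≤ γ) (by linarith : 0 ≤ 2*σ)
    linarith
  have c1 : 2*e*γ < 4*γ^2 - 4*(1+σ)*e*γ + pb1 2 σ y*γ - pQ 2 σ e := by
    have := mul_pos hγ0 B'
    linarith
  have c2 : γ^2 < 2*(4*γ^2 - 4*(1+σ)*e*γ + pb1 2 σ y*γ - pQ 2 σ e) := by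
    have := mul_pos hγ0 C'
    linarith
  have c3 : 2*e*σ ≤ 4*γ-6*(1+σ)*e+pb1 2 σ y := by
    have := mul_le_mul_of_nonneg_left he38 hs0.le
    linarith
  obtain ⟨d1, d2⟩ := good_aux (κ := (1-σ)/2) hs0 hs1 (by linarith) e0 hγ0 c1 c2
    (by linarith [mul_le_mul_of_nonneg_left (by linarith : 2/3 ≤ γ) (by linarith : 0 ≤ 1-σ)]) c3
  have d5 : 6*e*γ < 5*pN 2 σ y e γ := by
    have : 0 < e*γ := by positivity
    unfold pN; linarith
  have d6 : (1-y)*(1-σ)*(1-e) < pG 2 σ y e := by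
    rw [hGe]
    exact k2d hs0.le (sub_nonneg.2 hs1.le) h0.le (sub_nonneg.2 hb) (by linarith : 0 ≤ 4*e-1-h)
      (by linarith) (by linarith : 0 ≤ 3/8-y) hy
  exact ⟨by norm_num, hs0, hs1, y0, by linarith, R3, R4, e0, e1, Re, rb, rc, hγ, hγ0, c2, d1, d2, d5, d6⟩


lemma two_levels {f : ℝ → ℝ} {a b c d : ℝ} (hab : a < b) (hf : ContinuousOn f (Icc a b))
    (h1 : f a < c) (hcd : c < d) (h2 : d < f b) :
    ∃ y3 y4, a < y3 ∧ y3 < y4 ∧ y4 < b ∧ f y3 = c ∧ f y4 = d ∧ ∀ y ∈ Ioo y3 y4, c < f y ∧ f y < d := by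
  set s := {y | y ∈ Icc a b ∧ d ≤ f y}
  have hs : IsClosed s := hf.preimage_isClosed_of_isClosed isClosed_Icc isClosed_Ici
  have hsn : s.Nonempty := ⟨b, ⟨hab.le, le_rfl⟩, h2.le⟩
  have hsb : BddBelow s := ⟨a, fun y hy => hy.1.1⟩
  have h4 := hs.csInf_mem hsn hsb
  set y4 := sInf s with hy4
  have lt4 : ∀ y, a ≤ y → y < y4 → f y < d := fun y hy hlt => by
    by_contra! hc
    exact absurd (csInf_le hsb ⟨⟨hy, hlt.le.trans h4.1.2⟩, hc⟩) (not_le.2 hlt)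
  have a4 : a < y4 := by
    rcases eq_or_lt_of_le h4.1.1 with h | h
    · have := h4.2; rw [← h] at this; linarith
    · exact h
  have f4 : f y4 = d := by
    apply le_antisymm _ h4.2
    have hc : ContinuousWithinAt f (Ico a y4) y4 := (hf y4 h4.1).mono fun y hy => ⟨hy.1, hy.2.le.trans h4.1.2⟩
    have hne : (𝓝[Ico a y4] y4).NeBot := by
      rw [← mem_closure_iff_nhdsWithin_neBot, closure_Ico a4.ne]
      exact ⟨a4.le, le_rfl⟩
    exact le_of_tendsto hc (by filter_upwards [self_mem_nhdsWithin] with y hy using (lt4 y hy.1 hy.2).le)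
  have b4 : y4 < b := by
    rcases eq_or_lt_of_le h4.1.2 with h | h
    · rw [h] at f4; linarith
    · exact h
  have hf' : ContinuousOn f (Icc a y4) := hf.mono (Icc_subset_Icc_right b4.le)
  set s' := {y | y ∈ Icc a y4 ∧ f y ≤ c}
  have hs' : IsClosed s' := hf'.preimage_isClosed_of_isClosed isClosed_Icc isClosed_Iic
  have hsn' : s'.Nonempty := ⟨a, ⟨le_rfl, a4.le⟩, h1.le⟩
  have hsb' : BddAbove s' := ⟨y4, fun y hy => hy.1.2⟩
  have h3 := hs'.csSup_mem hsn' hsb'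
  set y3 := sSup s'
  have gt3 : ∀ y, y3 < y → y ≤ y4 → c < f y := fun y hlt hy => by
    by_contra! hc
    exact absurd (le_csSup hsb' ⟨⟨h3.1.1.trans hlt.le, hy⟩, hc⟩) (not_le.2 hlt)
  have b3 : y3 < y4 := by
    rcases eq_or_lt_of_le h3.1.2 with h | h
    · have := h3.2; rw [h, f4] at this; linarith
    · exact h
  have f3 : f y3 = c := by
    apply le_antisymm h3.2
    have hc : ContinuousWithinAt f (Ioc y3 y4) y3 := (hf' y3 h3.1).mono fun y hy => ⟨h3.1.1.trans hy.1.le, hy.2⟩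
    have hne : (𝓝[Ioc y3 y4] y3).NeBot := by
      rw [← mem_closure_iff_nhdsWithin_neBot, closure_Ioc b3.ne]
      exact ⟨le_rfl, b3.le⟩
    exact ge_of_tendsto hc (by filter_upwards [self_mem_nhdsWithin] with y hy using (gt3 y hy.1 hy.2).le)
  have a3 : a < y3 := by
    rcases eq_or_lt_of_le h3.1.1 with h | h
    · rw [← h] at f3; linarith
    · exact h
  exact ⟨y3, y4, a3, b3, b4, f3, f4, fun y hy => ⟨gt3 y hy.1 hy.2.le, lt4 y (a3.trans hy.1).le hy.2⟩⟩

noncomputable def Rof (p : ℝ) : ℝ := ((p-2) + √(p^2-4*p))/2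

lemma Rof_cont : Continuous Rof := by unfold Rof; fun_prop
lemma Rof3 : Rof (16/3) = 3 := by
  unfold Rof
  rw [show ((16/3:ℝ)^2-4*(16/3)) = (8/3)^2 by norm_num, Real.sqrt_sq (by norm_num)]; norm_num
lemma Rof4 : Rof (25/4) = 4 := by
  unfold Rof
  rw [show ((25/4:ℝ)^2-4*(25/4)) = (15/4)^2 by norm_num, Real.sqrt_sq (by norm_num)]; norm_num
lemma Rof_lt {p q : ℝ} (hp : 4 ≤ p) (h : p < q) : Rof p < Rof q := by
  unfold Rof
  have : √(p^2-4*p) ≤ √(q^2-4*q) := Real.sqrt_le_sqrt (by nlinarith)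
  linarith
lemma Rof_eq {p : ℝ} (hp : 4 ≤ p) : p * Rof p = (1+Rof p)^2 := by
  unfold Rof
  have : √(p^2-4*p)^2 = p^2-4*p := Real.sq_sqrt (by nlinarith)
  nlinarith

set_option maxHeartbeats 1000000 in
lemma select {k σ a b : ℝ} (hk : 1 ≤ k) (hs0 : 0 < σ) (hs1 : σ < 1) (ha : 0 ≤ a) (hab : a < b)
    (hb : b ≤ 1/2)
    (h1 : (k+2-k*a*(1+σ))^2/(2*(k*((1-a)^2-σ*a^2))) < 16/3)
    (h2 : 25/4 < (k+2-k*b*(1+σ))^2/(2*(k*((1-b)^2-σ*b^2))))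
    (H : ∀ y e R γ, a < y → y < b → 3 ≤ R → R ≤ 4 → 0 < e → e < 1 → 1 < R*e →
      k+2-k*y*(1+σ) = 2*(1+R)*e → k*((1-y)^2-σ*y^2) = 2*R*e^2 → 2*e*(R-2)*γ = pG k σ y e →
      Good k σ y e R γ) :
    ∃ (y3 y4 : ℝ) (e R γ : ℝ → ℝ), y3 < y4 ∧ ContinuousOn e (Icc y3 y4) ∧ ContinuousOn R (Icc y3 y4) ∧
      ContinuousOn γ (Icc y3 y4) ∧ R y3 = 3 ∧ R y4 = 4 ∧ (∀ y ∈ Ioo y3 y4, 3 < R y ∧ R y < 4) ∧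
      ∀ y ∈ Icc y3 y4, Good k σ y (e y) (R y) (γ y) := by
  have hc0 : ∀ y ∈ Icc a b, 0 < k*((1-y)^2-σ*y^2) := by
    intro y hy
    apply mul_pos (by linarith)
    nlinarith [hy.1, hy.2, sq_nonneg y, mul_nonneg (sub_nonneg.2 hs1.le) (sq_nonneg (1-y)), mul_nonneg hs0.le (by nlinarith [hy.1, hy.2] : 0 ≤ (1-y)^2-y^2), mul_pos (sub_pos.2 hs1) (by nlinarith [hy.1, hy.2] : 0 < (1-y)^2)]
  have hb0 : ∀ y ∈ Icc a b, 0 < k+2-k*y*(1+σ) := by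
    intro y hy
    have h1 : y*(1+σ) ≤ 1 := by nlinarith [hy.1, hy.2]
    nlinarith
  have hcont : ContinuousOn (fun y => (k+2-k*y*(1+σ))^2/(2*(k*((1-y)^2-σ*y^2)))) (Icc a b) := by
    apply ContinuousOn.div (by fun_prop) (by fun_prop)
    intro y hy
    have := hc0 y hy
    positivity
  obtain ⟨y3, y4, a3, h34, b4, f3, f4, hbt⟩ := two_levels hab hcont h1 (by norm_num) h2
  set f := (fun y => (k+2-k*y*(1+σ))^2/(2*(k*((1-y)^2-σ*y^2)))) with hf
  have f3' : f y3 = 16/3 := f3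
  have f4' : f y4 = 25/4 := f4
  have hsub : Icc y3 y4 ⊆ Icc a b := Icc_subset_Icc a3.le b4.le
  set R : ℝ → ℝ := fun y => Rof (f y) with hR
  set e : ℝ → ℝ := fun y => (k+2-k*y*(1+σ))/(2*(1+R y)) with he
  set γ : ℝ → ℝ := fun y => pG k σ y (e y)/(2*e y*(R y-2)) with hγ
  have R3 : R y3 = 3 := by show Rof (f y3) = 3; rw [f3', Rof3]
  have R4 : R y4 = 4 := by show Rof (f y4) = 4; rw [f4', Rof4]
  have hbt' : ∀ y ∈ Ioo y3 y4, 3 < R y ∧ R y < 4 := by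
    intro y hy
    obtain ⟨g1, g2⟩ := hbt y hy
    refine ⟨?_, ?_⟩
    · rw [← Rof3]; exact Rof_lt (by norm_num) g1
    · rw [← Rof4]; exact Rof_lt (by linarith) g2
  have hfR : ∀ y ∈ Icc y3 y4, 3 ≤ R y ∧ R y ≤ 4 ∧ 4 ≤ f y := by
    intro y hy
    rcases eq_or_lt_of_le hy.1 with h | h
    · rw [← h]; exact ⟨R3.ge, by rw [R3]; norm_num, by rw [f3']; norm_num⟩
    rcases eq_or_lt_of_le hy.2 with h' | h'
    · rw [h']; exact ⟨by rw [R4]; norm_num, R4.le, by rw [f4']; norm_num⟩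
    · exact ⟨(hbt' y ⟨h, h'⟩).1.le, (hbt' y ⟨h, h'⟩).2.le, by linarith [(hbt y ⟨h, h'⟩).1]⟩
  have hRc : ContinuousOn R (Icc y3 y4) := Rof_cont.comp_continuousOn (hcont.mono hsub)
  have hec : ContinuousOn e (Icc y3 y4) := by
    apply ContinuousOn.div (by fun_prop) (by fun_prop)
    intro y hy
    have := (hfR y hy).1
    positivity
  have he0 : ∀ y ∈ Icc y3 y4, 0 < e y := fun y hy => by
    have := (hfR y hy).1
    exact div_pos (hb0 y (hsub hy)) (by positivity)
  have hγc : ContinuousOn γ (Icc y3 y4) := by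
    apply ContinuousOn.div _ (by fun_prop)
    · intro y hy
      have h1 := he0 y hy
      have h2 := (hfR y hy).1
      have : 0 < 2*e y*(R y-2) := mul_pos (by linarith) (by linarith)
      exact this.ne'
    · unfold pG pb1 pc1; fun_prop
  refine ⟨y3, y4, e, R, γ, h34, hec, hRc, hγc, R3, R4, hbt', ?_⟩
  intro y hy
  obtain ⟨r1, r2, r3⟩ := hfR y hy
  have he1 := he0 y hy
  have hc := hc0 y (hsub hy)
  have hb := hb0 y (hsub hy)
  have rb : k+2-k*y*(1+σ) = 2*(1+R y)*e y := by
    have : 2*(1+R y) ≠ 0 := by positivity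
    show _ = 2*(1+R y)*((k+2-k*y*(1+σ))/(2*(1+R y)))
    rw [mul_div_cancel₀ _ this]
  have hp := Rof_eq r3
  change f y * R y = (1+R y)^2 at hp
  have hfy : f y * (2*(k*((1-y)^2-σ*y^2))) = (k+2-k*y*(1+σ))^2 := by
    simp only [hf]; exact div_mul_cancel₀ _ (by positivity)
  have rc : k*((1-y)^2-σ*y^2) = 2*R y*e y^2 := by
    rw [rb] at hfy
    have h5 : (1+R y)^2*(k*((1-y)^2-σ*y^2)) = (1+R y)^2*(2*R y*e y^2) := by
      rw [← hp]
      have : f y * R y * (k * ((1 - y) ^ 2 - σ * y ^ 2)) = R y * (f y * (2*(k*((1-y)^2-σ*y^2))))/2 := by ring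
      rw [this, hfy, hp]; ring
    exact mul_left_cancel₀ (by positivity) h5
  have hy0 : 0 < y := by linarith [hy.1]
  have hy1 : y < 1/2 := by linarith [hy.2]
  have hq : 0 < -2*((1-e y)*(1-R y*e y)) := by
    have : -2*((1-e y)*(1-R y*e y)) = (1-σ)*(k*(y*(1-y))) := by
      linear_combination -rb+rc
    rw [this]
    exact mul_pos (by linarith) (mul_pos (by linarith) (mul_pos hy0 (by linarith)))
  have hee : e y < 1 := by
    by_contra! hc
    have : 0 ≤ (e y - 1)*(R y * e y - 1) := mul_nonneg (by linarith) (by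
      have := mul_le_mul r1 hc zero_le_one (by linarith)
      linarith)
    linarith
  have hRe : 1 < R y * e y := by
    by_contra! hc
    have : 0 ≤ (1 - e y)*(1 - R y * e y) := mul_nonneg (by linarith) (by linarith)
    linarith
  refine H y (e y) (R y) (γ y) (by linarith [hy.1]) (by linarith [hy.2]) r1 r2 he1 hee hRe rb rc ?_
  have : 2*e y*(R y-2) ≠ 0 := (mul_pos (by linarith) (by linarith)).ne'
  simp only [hγ]
  rw [mul_div_cancel₀ _ this]


def Facts (k σ y e γ : ℝ) : Prop := 0 < γ ∧ γ^2 < 2*pN k σ y e γ ∧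
  4*e^2*σ*γ < pW k σ y e γ * pN k σ y e γ ∧ e*(3*(1+σ)*γ+2*((1-σ)/k)) < 3*pN k σ y e γ ∧
  6*e*γ < 5*pN k σ y e γ ∧ (1-y)*(1-σ)*(1-e) < pG k σ y e

lemma facts_one {k y e R : ℝ} (hk : 3 ≤ k) (hy : 1/2-1/k ≤ y) (e0 : 1/4 ≤ e) (e1 : e ≤ 1)
    (R3 : 3 ≤ R) (R4 : R ≤ 4)
    (rb : k+2-k*y*(1+1) = 2*(1+R)*e) (rc : k*((1-y)^2-1*y^2) = 2*R*e^2) :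
    Facts k 1 y e (pG k 1 y e/(2*e*(R-2))) := by
  have hky : k*(1-2*y) ≤ 2 := by
    have : k*(1/2-1/k) ≤ k*y := mul_le_mul_of_nonneg_left hy (by linarith)
    have h2 : k*(1/2-1/k) = k/2-1 := by field_simp
    linarith
  have hRe : R*e = 1 := by
    have h1 : (1-e)*(1-R*e) = 0 := by linear_combination (rb-rc)/2
    rcases mul_eq_zero.1 h1 with h | h
    · have : e = 1 := by linarith
      subst this; nlinarith
    · linarith
  have hk2 : k*(1-2*y) = 2*e := by
    linear_combination rc + 2*e*hRe
  have e2 : e ≤ 1/3 := by nlinarith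
  have hb : pb1 k 1 y = 2*e := by unfold pb1; linear_combination hk2
  have hc : pc1 k 1 y = 2*e-2 := by unfold pc1; linear_combination hk2
  have hG : pG k 1 y e = 2-2*e := by unfold pG; rw [hb, hc]; ring
  have hQ : pQ k 1 e = 2*(1-e) := by unfold pQ; ring
  have hden : 2*e*(R-2) = 2*(1-2*e) := by linear_combination 2*hRe
  have hγ : pG k 1 y e/(2*e*(R-2)) = (1-e)/(1-2*e) := by
    rw [hG, hden, show (2:ℝ)-2*e = 2*(1-e) by ring, mul_div_mul_left _ _ (by norm_num)]
  rw [hγ]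
  have hp : 0 < 1-2*e := by linarith
  have g1 : 3/2 ≤ (1-e)/(1-2*e) := by rw [le_div_iff₀ hp]; linarith
  have g2 : (1-e)/(1-2*e) ≤ 2 := by rw [div_le_iff₀ hp]; linarith
  set γ := (1-e)/(1-2*e)
  have hN : pN k 1 y e γ = 4*γ^2-6*e*γ-2*(1-e) := by unfold pN; rw [hb, hQ]; ring
  have hW : pW k 1 y e γ = 4*γ-10*e := by unfold pW; rw [hb]; ring
  have h1 : e*γ ≤ 1/3*γ := mul_le_mul_of_nonneg_right e2 (by linarith)
  have h2 : 3/2*γ ≤ γ^2 := by nlinarith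
  have h3 : e^2*γ ≤ 1/3*1/3*γ := by nlinarith
  have hNp : 4.5 ≤ 4*γ^2-6*e*γ-2*(1-e) := by nlinarith
  unfold Facts
  rw [hN, hW, hG]
  refine ⟨by linarith, by nlinarith, ?_, ?_, ?_, by linarith⟩
  · have : 2*4.5 ≤ (4*γ-10*e)*(4*γ^2-6*e*γ-2*(1-e)) := mul_le_mul (by linarith) hNp (by norm_num) (by linarith)
    nlinarith
  · have : e*(3*(1+1)*γ+2*((1-1)/k)) = 6*(e*γ) := by ring
    rw [this]; linarith
  · linarith

lemma facts_ev {k : ℝ} (hk : 3 ≤ k) : ∀ᶠ σ in 𝓝 (1:ℝ), ∀ q ∈ Icc (1/2-1/k) (1/2) ×ˢ Icc (1/4:ℝ) 1 ×ˢ Icc (3:ℝ) 4,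
    k+2-k*q.1*(1+σ) = 2*(1+q.2.2)*q.2.1 → k*((1-q.1)^2-σ*q.1^2) = 2*q.2.2*q.2.1^2 →
      Facts k σ q.1 q.2.1 (pG k σ q.1 q.2.1/(2*q.2.1*(q.2.2-2))) := by
  apply IsCompact.eventually_forall_of_forall_eventually (isCompact_Icc.prod (isCompact_Icc.prod isCompact_Icc))
  rintro ⟨y, e, R⟩ ⟨⟨hy, hy'⟩, ⟨e0, e1⟩, R3, R4⟩
  by_cases rb : k+2-k*y*(1+1) = 2*(1+R)*e
  swap
  · have hc : Continuous (fun z : ℝ × ℝ × ℝ × ℝ => k+2-k*z.2.1*(1+z.1) - 2*(1+z.2.2.2)*z.2.2.1) := by fun_prop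
    have := hc.continuousAt.eventually_ne (x := (1, y, e, R)) (sub_ne_zero.2 rb)
    filter_upwards [this] with z hz h
    exact absurd (sub_eq_zero.2 h) hz
  by_cases rc : k*((1-y)^2-1*y^2) = 2*R*e^2
  swap
  · have hc : Continuous (fun z : ℝ × ℝ × ℝ × ℝ => k*((1-z.2.1)^2-z.1*z.2.1^2) - 2*z.2.2.2*z.2.2.1^2) := by fun_prop
    have := hc.continuousAt.eventually_ne (x := (1, y, e, R)) (sub_ne_zero.2 rc)
    filter_upwards [this] with z hz _ h
    exact absurd (sub_eq_zero.2 h) hz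
  obtain ⟨f1, f2, f3, f4, f5, f6⟩ := facts_one hk hy e0 e1 R3 R4 rb rc
  have hk0 : k ≠ 0 := by linarith
  have hG : Continuous (fun z : ℝ × ℝ × ℝ × ℝ => pG k z.1 z.2.1 z.2.2.1) := by
    unfold pG pb1 pc1; fun_prop
  have hγ : ContinuousAt (fun z : ℝ × ℝ × ℝ × ℝ => pG k z.1 z.2.1 z.2.2.1/(2*z.2.2.1*(z.2.2.2-2))) (1,y,e,R) := by
    apply ContinuousAt.div hG.continuousAt (by fun_prop)
    have : 0 < 2*e*(R-2) := mul_pos (by linarith) (by linarith)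
    exact this.ne'
  have hN : ContinuousAt (fun z : ℝ × ℝ × ℝ × ℝ => pN k z.1 z.2.1 z.2.2.1 (pG k z.1 z.2.1 z.2.2.1/(2*z.2.2.1*(z.2.2.2-2)))) (1,y,e,R) := by
    unfold pN pQ pb1; fun_prop
  have hW : ContinuousAt (fun z : ℝ × ℝ × ℝ × ℝ => pW k z.1 z.2.1 z.2.2.1 (pG k z.1 z.2.1 z.2.2.1/(2*z.2.2.1*(z.2.2.2-2)))) (1,y,e,R) := by
    unfold pW pb1; fun_prop
  have e1 := ContinuousAt.eventually_lt continuousAt_const hγ f1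
  have e2 := ContinuousAt.eventually_lt (hγ.pow 2) (continuousAt_const.mul hN) f2
  have e3 := ContinuousAt.eventually_lt (by fun_prop : ContinuousAt (fun z : ℝ × ℝ × ℝ × ℝ => 4*z.2.2.1^2*z.1*(pG k z.1 z.2.1 z.2.2.1/(2*z.2.2.1*(z.2.2.2-2)))) (1,y,e,R)) (hW.mul hN) f3
  have e4 := ContinuousAt.eventually_lt (by fun_prop : ContinuousAt (fun z : ℝ × ℝ × ℝ × ℝ => z.2.2.1*(3*(1+z.1)*(pG k z.1 z.2.1 z.2.2.1/(2*z.2.2.1*(z.2.2.2-2)))+2*((1-z.1)/k))) (1,y,e,R)) (continuousAt_const.mul hN) f4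
  have e5 := ContinuousAt.eventually_lt (by fun_prop : ContinuousAt (fun z : ℝ × ℝ × ℝ × ℝ => 6*z.2.2.1*(pG k z.1 z.2.1 z.2.2.1/(2*z.2.2.1*(z.2.2.2-2)))) (1,y,e,R)) (continuousAt_const.mul hN) f5
  have e6 := ContinuousAt.eventually_lt (by fun_prop : ContinuousAt (fun z : ℝ × ℝ × ℝ × ℝ => (1-z.2.1)*(1-z.1)*(1-z.2.2.1)) (1,y,e,R)) hG.continuousAt f6
  filter_upwards [e1, e2, e3, e4, e5, e6] with z g1 g2 g3 g4 g5 g6 _ _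
  exact ⟨g1, g2, g3, g4, g5, g6⟩

def Sel (k σ : ℝ) : Prop := ∃ (y3 y4 : ℝ) (e R γ : ℝ → ℝ), y3 < y4 ∧ ContinuousOn e (Icc y3 y4) ∧ ContinuousOn R (Icc y3 y4) ∧
      ContinuousOn γ (Icc y3 y4) ∧ R y3 = 3 ∧ R y4 = 4 ∧ (∀ y ∈ Ioo y3 y4, 3 < R y ∧ R y < 4) ∧
      ∀ y ∈ Icc y3 y4, Good k σ y (e y) (R y) (γ y)

lemma sel_big {k : ℝ} (hk : 3 ≤ k) : ∃ s0 < (1:ℝ), ∀ σ, s0 < σ → 0 < σ → σ < 1 → Sel k σ := by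
  have h1 : ∀ᶠ σ in 𝓝 (1:ℝ), (k+2-k*(1/2-1/k)*(1+σ))^2/(2*(k*((1-(1/2-1/k))^2-σ*(1/2-1/k)^2))) < 16/3 := by
    have hv : (k*((1-(1/2-1/k))^2-1*(1/2-1/k)^2)) = 2 := by field_simp; ring
    have hv2 : k+2-k*(1/2-1/k)*(1+1) = 4 := by field_simp; ring
    have hc : ContinuousAt (fun σ => (k+2-k*(1/2-1/k)*(1+σ))^2/(2*(k*((1-(1/2-1/k))^2-σ*(1/2-1/k)^2)))) 1 := by
      apply ContinuousAt.div (by fun_prop) (by fun_prop)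
      rw [hv]; norm_num
    apply hc.eventually_lt continuousAt_const
    rw [hv, hv2]; norm_num
  obtain ⟨ε, hε, h⟩ := Metric.eventually_nhds_iff.1 (h1.and (facts_ev hk))
  refine ⟨1-ε, by linarith, fun σ h0 h2 h3 => ?_⟩
  obtain ⟨g1, g2⟩ := h (y := σ) (by rw [Real.dist_eq, abs_lt]; constructor <;> linarith)
  have hk0 : 0 < k := by linarith
  have hk3 : 1/k ≤ 1/3 := one_div_le_one_div_of_le (by norm_num) hk
  have hkp : 0 < 1/k := by positivity
  refine select (a := 1/2-1/k) (b := 1/2) (by linarith) h2 h3 (by linarith) (by linarith) le_rfl g1 ?_ ?_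
  · have hs : 0 < 1-σ := by linarith
    rw [lt_div_iff₀]
    · nlinarith [sq_nonneg (k*(1-σ)-4), mul_pos hk0 hs]
    · have : (1-1/2:ℝ)^2-σ*(1/2)^2 = (1-σ)/4 := by ring
      rw [this]; positivity
  · intro y e R γ ya yb r3 r4 e0 e1 hRe rb rc hγ
    have e4 : 1/4 ≤ e := by nlinarith
    obtain ⟨f1, f2, f3, f4, f5, f6⟩ := g2 (y, e, R) ⟨⟨ya.le, yb.le⟩, ⟨e4, e1.le⟩, r3, r4⟩ rb rc
    have hd : 0 < 2*e*(R-2) := mul_pos (by linarith) (by linarith)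
    have hγ' : pG k σ y e/(2*e*(R-2)) = γ := by rw [← hγ, mul_div_cancel_left₀ _ hd.ne']
    simp only [hγ'] at f1 f2 f3 f4 f5 f6
    exact ⟨by linarith, h2, h3, by linarith, yb, r3, r4, e0, e1, hRe, rb, rc, hγ, f1, f2, f3, f4, f5, f6⟩

lemma sel_one {σ : ℝ} (h0 : 0 < σ) (h1 : σ < 1) : Sel 1 σ := by
  refine select (a := 0) (b := 1/4) le_rfl h0 h1 le_rfl (by norm_num) (by norm_num) (by norm_num) ?_ ?_
  · rw [lt_div_iff₀] <;> nlinarith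
  · intro y e R γ ya yb r3 r4 e0 e1 hRe rb rc hγ
    exact good_k1 h0 h1 ya yb.le r3 r4 e0 e1 hRe rb rc hγ

lemma sel_two {σ : ℝ} (h0 : 0 < σ) (h1 : σ < 1) : Sel 2 σ := by
  refine select (a := 0) (b := 3/8) (by norm_num) h0 h1 le_rfl (by norm_num) (by norm_num) (by norm_num) ?_ ?_
  · rw [lt_div_iff₀] <;> nlinarith
  · intro y e R γ ya yb r3 r4 e0 e1 hRe rb rc hγ
    exact good_k2 h0 h1 ya yb.le r3 r4 e0 e1 hRe rb rc hγ

theorem params_exist (k : ℕ) (hk : 1 ≤ k) : ∃ s0 < (1:ℝ), 0 < s0 ∧ ∀ σ : ℝ, 0 < σ → σ < 1 →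
    (s0 < σ ∨ k = 1 ∨ k = 2) → Sel k σ := by
  rcases (by omega : k = 1 ∨ k = 2 ∨ 3 ≤ k) with rfl | rfl | h
  · exact ⟨1/2, by norm_num, by norm_num, fun σ h0 h1 _ => by simpa using sel_one h0 h1⟩
  · exact ⟨1/2, by norm_num, by norm_num, fun σ h0 h1 _ => by simpa using sel_two h0 h1⟩
  · obtain ⟨s0, hs, H⟩ := sel_big (k := k) (by exact_mod_cast h)
    refine ⟨max s0 (1/2), by simp [hs]; norm_num, by simp, fun σ h0 h1 h2 => ?_⟩
    rcases h2 with h2 | h2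
    · exact H σ ((le_max_left _ _).trans_lt h2) h0 h1
    · omega


noncomputable section
def cA (k σ x : ℝ) : ℝ := 2 + (1+σ)*x + (1-σ)/k*x^2
def cB (k σ y x : ℝ) : ℝ :=
  (k+2-k*y*(1+σ)) + (1-2*y)*(σ*k-(1-σ))*x - 2*(σ-(1-σ)/k)*x^2
def cC (k σ y x : ℝ) : ℝ :=
  k*((1-y)^2-σ*y^2) + (σ*k*(1-2*y)-2*(1-(1-σ)*y))*x - (2*σ-(1-σ)/k)*x^2
def QQ (k σ y x g : ℝ) : ℝ := -cA k σ x*g^2 + cB k σ y x*g - cC k σ y x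
def PP (σ x : ℝ) : ℝ := x*(1+x)*(1+σ*x)
/-- squared relative velocity -/
def th (σ x : ℝ) : ℝ := σ*(1+x)/(1+σ*x)
def SS (k σ y x g : ℝ) : ℝ := 1 - (1-σ)/k*(x*(1-g)+k*y)/(1+σ*x)
end

/-- derivative identity for `S`; `g'` is the derivative of `g`. -/
lemma alg_S (k σ y x g g' : ℝ) (hk : k ≠ 0) (h1 : 1+σ*x ≠ 0) (hg : g ≠ 0) (hσ : 1 - σ ≠ 0)
    (h : 2*PP σ x*g*g' = QQ k σ y x g) :
    2*th σ x*(-(1-σ)/k*(((1-g)-x*g')*(1+σ*x)-(x*(1-g)+k*y)*σ)/(1+σ*x)^2)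
      = σ*(1-σ)/(1+σ*x)^2*(SS k σ y x g
        - ((SS k σ y x g)^2-th σ x)/((1-σ)/(1+σ*x)*g)) := by
  rw [← sub_eq_zero] at h ⊢
  have key : 2*th σ x*(-(1-σ)/k*(((1-g)-x*g')*(1+σ*x)-(x*(1-g)+k*y)*σ)/(1+σ*x)^2)
      - σ*(1-σ)/(1+σ*x)^2*(SS k σ y x g
        - ((SS k σ y x g)^2-th σ x)/((1-σ)/(1+σ*x)*g))
      = σ*(1-σ)/(k*(1+σ*x)^3*g)*(2*PP σ x*g*g' - QQ k σ y x g) := by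
    unfold th SS PP QQ cA cB cC
    field_simp
    ring
  rw [key, h, mul_zero]

lemma alg_C (k σ y x : ℝ) (hk : k ≠ 0)  (hσ : 1 - σ ≠ 0) :
  cC k σ y x = k/(1-σ)*((1+σ*x-(1-σ)/k*(x+k*y))^2-σ*(1+x)*(1+σ*x)) := by
  unfold cC; field_simp; ring

lemma QQ_one (k σ y x : ℝ) (hk : k ≠ 0) : QQ k σ y x 1 = (1-σ)*k*y*(1-y) := by
  unfold QQ cA cB cC; field_simp; ring


def IsSol (k σ y : ℝ) (g : ℝ → ℝ) (s : Set ℝ) : Prop :=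
  ContDiffOn ℝ (⊤:ℕ∞) g s ∧ ∀ x ∈ s, 0 < g x ∧ ∃ g', HasDerivAt g g' x ∧ 2*PP σ x*g x*g' = QQ k σ y x (g x)

lemma IsSol.mono {k σ y : ℝ} {g : ℝ → ℝ} {s t : Set ℝ} (h : IsSol k σ y g s) (hst : t ⊆ s) : IsSol k σ y g t :=
  ⟨h.1.mono hst, fun x hx => h.2 x (hst hx)⟩

lemma PP_neg {σ x : ℝ} (h0 : 0 < σ) (h1 : σ < 1) (hx : -1 < x) (hx' : x < 0) : PP σ x < 0 := by
  unfold PP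
  have : 0 < 1+σ*x := by nlinarith
  nlinarith [mul_pos (by linarith : 0 < 1 + x) this, mul_pos (by linarith : 0 < -x) (mul_pos (by linarith : 0 < 1 + x) this)]

lemma PP_pos {σ x : ℝ} (h0 : 0 < σ) (hx : 0 < x) : 0 < PP σ x := by
  unfold PP; positivity

lemma origin_sol {k σ y3 y4 : ℝ} (hk : 1 ≤ k) (h0 : 0 < σ) (h1 : σ < 1) (hy3 : 0 < y3) (hy : y3 ≤ y4) (hy4 : y4 < 1/2) :
    ∃ r, 0 < r ∧ r < 1 ∧ ∃ G : ℝ → ℝ → ℝ, (∀ x ∈ Ioo (-1-r) (-1+r), ContinuousOn (fun p => G p x) (Icc y3 y4)) ∧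
      ∀ y ∈ Icc y3 y4, IsSol k σ y (G y) (Ioo (-1-r) (-1+r)) ∧ G y (-1) = 1-k*y/(k+1) := by
  have hk0 : 0 < k := by linarith
  set κ := (1-σ)/k with hκ
  obtain ⟨r, hr, ζ, hζc, hζ⟩ := sing_gen (E := ℝ) 0
    (Eh := fun z => -κ*(1-k*z.2/(k+1))^2 + (-2*(σ-κ))*(1-k*z.2/(k+1)) + (2*σ-κ))
    (Mh := fun z => ((1-2*z.2)*(σ*k-(1-σ))+4*(σ-κ) - 2*(σ-κ)*z.1) - 2*((1+σ)-2*κ+κ*z.1)*(1-k*z.2/(k+1)) - 2*(1-2*σ+σ*z.1)*(1-k*z.2/(k+1)))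
    (Ah := fun z => 2 + (1+σ)*(z.1-1) + κ*(z.1-1)^2 + 2*((z.1-1)*(1+σ*(z.1-1))))
    (Kh := fun z => (1-2*σ+σ*z.1)*(1-k*z.2/(k+1)))
    (q := fun z => (z.1-1)*(1+σ*(z.1-1)))
    (b := fun z => 1-k*z.2/(k+1))
    (E0 := fun y => -((1+σ)-2*κ)*(1-k*y/(k+1))^2+((1-2*y)*(σ*k-(1-σ))+4*(σ-κ))*(1-k*y/(k+1)) - ((σ*k*(1-2*y)-2*(1-(1-σ)*y)) + 2*(2*σ-κ)))
    (M0 := fun y => (k+3)*(1-σ)*(1-k*y/(k+1)))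
    (d0 := fun y => -(1-σ)*(1-k*y/(k+1)))
    (by fun_prop) (by fun_prop) (by fun_prop) (by fun_prop) (by fun_prop) (by fun_prop) (by fun_prop) (by fun_prop) (by fun_prop)
    y3 y4 hy id continuousOn_id (by
      intro y hy
      have : 0 < 1-k*y/(k+1) := by
        rw [sub_pos, div_lt_one (by linarith)]; nlinarith [hy.1, hy.2]
      simp only [id]
      have h2 : 0 < (1-σ)*(1-k*y/(k+1)) := mul_pos (by linarith) this
      intro h; linarith) (by
      intro y hy
      have : 0 < 1-k*y/(k+1) := by
        rw [sub_pos, div_lt_one (by linarith)]; nlinarith [hy.1, hy.2]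
      simp only [id]
      have hs : 1 - σ ≠ 0 := by linarith
      have h3 : -((k+3)*(1-σ)*(1-k*y/(k+1))/(2*(-(1-σ)*(1-k*y/(k+1))))) = (k+3)/2 := by
        generalize 1-k*y/(k+1) = b at *
        field_simp
      rw [h3]; linarith) (by
      intro x e; ring)
  set r' := min r (1-σ) with hr'
  have r'0 : 0 < r' := lt_min hr (by linarith)
  have r'r : r' ≤ r := min_le_left _ _
  have r's : r' ≤ 1-σ := min_le_right _ _
  have hsub : ∀ x ∈ Ioo (-1-r') (-1+r'), x+1 ∈ Ioo (-r) r := fun x hx => ⟨by linarith [hx.1], by linarith [hx.2]⟩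
  refine ⟨r', r'0, by linarith, fun y x => (1-k*y/(k+1)) + (x+1)*ζ y (x+1), ?_, ?_⟩
  · intro x hx
    have := hζc (x+1) (hsub x hx)
    fun_prop
  intro y hy
  obtain ⟨a1, a2, a3, -⟩ := hζ y hy
  refine ⟨⟨?_, ?_⟩, by simp⟩
  · have h2 : ContDiffOn ℝ (⊤:ℕ∞) (fun x => ζ y (x+1)) (Ioo (-1-r') (-1+r')) :=
      a1.comp (by fun_prop : ContDiffOn ℝ (⊤:ℕ∞) (fun x : ℝ => x+1) (Ioo (-1-r') (-1+r'))) hsub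
    exact contDiffOn_const.add ((contDiffOn_id.add contDiffOn_const).mul h2)
  · intro x hx
    have hb : 0 < 1-k*y/(k+1) := by
      rw [sub_pos, div_lt_one (by linarith)]; nlinarith [hy.1, hy.2]
    have p1 := a2 (x+1) (hsub x hx)
    obtain ⟨ζ', d1, d2⟩ := a3 (x+1) (hsub x hx)
    simp only [id, zero_add, pow_one, add_sub_cancel_right] at p1 d2
    have hq : 0 < -x*(1+σ*x) := by
      apply mul_pos (by linarith [hx.2])
      nlinarith [hx.1]
    constructor
    · have : 0 < ((1-σ)*(1-k*y/(k+1))*(-x*(1+σ*x)))*((1-k*y/(k+1)) + (x+1)*ζ y (x+1)) := by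
        linarith [p1]
      refine pos_of_mul_pos_right this ?_
      exact (mul_pos (mul_pos (by linarith) hb) hq).le
    · have d3 : HasDerivAt (fun x => ζ y (x+1)) ζ' x := by
        simpa using d1.comp_add_const x 1
      refine ⟨_, (((hasDerivAt_id x).add_const 1).mul d3).const_add _, ?_⟩
      simp only [id, one_mul]
      unfold PP QQ cA cB cC
      rw [← hκ]
      have hkκ : k*κ = 1-σ := by rw [hκ]; field_simp
      set Z := ζ y (x+1)
      have hb2 : (k+1)*(1-k*y/(k+1)) = k+1-k*y := by field_simp
      have e1 : 2*(x*(1+x)*(1+σ*x))*(1-k*y/(k+1)+(x+1)*Z)*(Z+(x+1)*ζ') =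
        (x+1)*(2 * (x * (1 + σ * x) * (1 - k * y / (k + 1) + (x + 1) * Z)) * ((x + 1) * ζ')) + 
         2*(x*(1+x)*(1+σ*x))*(1-k*y/(k+1)+(x+1)*Z)*Z := by ring
      rw [e1, d2]
      have hκ2 : κ = (1-σ)/k := hκ
      rw [hκ2]
      field_simp
      ring


lemma cC_lb {k σ y x : ℝ} (hk : 1 ≤ k) (h0 : 0 < σ) (h1 : σ < 1) (hy3 : 0 < y) (hy4 : y < 1/2)
    (hx : -1 ≤ x) (hx' : x ≤ 0) : k*(1-σ)/4 ≤ cC k σ y x := by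
  have hk0 : 0 < k := by linarith
  have hs : 0 < 1-σ := by linarith
  have hκ : 0 ≤ (1-σ)/k*x^2 := by positivity
  have a0 : k*(1-σ)/4 ≤ k*((1-y)^2-σ*y^2) := by
    have : (1-σ)/4 ≤ (1-y)^2-σ*y^2 := by nlinarith [mul_pos hs hy3, mul_pos h0 (by linarith : 0 < 1-2*y), mul_pos hs (by linarith : 0 < 1/2-y)]
    nlinarith
  have a1 : k*(1-σ)/4 ≤ (1-σ)*(k*(1-y)^2+2*(1-y)) := by
    have : k/4 ≤ k*(1-y)^2+2*(1-y) := by nlinarith [mul_pos hk0 (by nlinarith : 0 < (1-y)^2-1/4)]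
    nlinarith
  have e : cC k σ y x = (1+x)*(k*((1-y)^2-σ*y^2)) + (-x)*((1-σ)*(k*(1-y)^2+2*(1-y))) + 2*σ*((-x)*(1+x)) + (1-σ)/k*x^2 := by
    unfold cC; ring
  rw [e]
  have b0 := mul_le_mul_of_nonneg_left a0 (by linarith : 0 ≤ 1+x)
  have b1 := mul_le_mul_of_nonneg_left a1 (by linarith : 0 ≤ -x)
  have b2 : 0 ≤ 2*σ*((-x)*(1+x)) := mul_nonneg (by linarith) (mul_nonneg (by linarith) (by linarith))
  linarith

lemma QQ_delta {k σ y x δ : ℝ} (hk : 1 ≤ k) (h0 : 0 < σ) (h1 : σ < 1) (hy3 : 0 < y) (hy4 : y < 1/2)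
    (hx : -1 ≤ x) (hx' : x ≤ 0) (hδ : 0 < δ) (hδ' : δ ≤ (1-σ)/32) : QQ k σ y x δ < 0 := by
  have hk0 : 0 < k := by linarith
  have hs : 0 < 1-σ := by linarith
  have hC := cC_lb hk h0 h1 hy3 hy4 hx hx'
  have hκ0 : 0 < (1-σ)/k := by positivity
  have hκ1 : (1-σ)/k ≤ 1 := by rw [div_le_one hk0]; linarith
  have hA : 0 ≤ cA k σ x := by
    unfold cA
    have : 0 ≤ (1-σ)/k*x^2 := by positivity
    nlinarith
  have hB : cB k σ y x ≤ 7*k := by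
    unfold cB
    have c1 : 0 < k*y*(1+σ) := by positivity
    have c2 : (1-2*y)*(σ*k-(1-σ))*x ≤ 1 := by
      have : -(σ*k*((1-2*y)*-x)) + (1-σ)*((1-2*y)*-x) ≤ 1 := by
        have q1 : 0 ≤ (1-2*y)*-x := mul_nonneg (by linarith) (by linarith)
        have q2 : (1-2*y)*-x ≤ 1 := by nlinarith
        have q3 : 0 ≤ σ*k*((1-2*y)*-x) := by positivity
        nlinarith
      linarith
    have c3 : -2*(σ-(1-σ)/k)*x^2 ≤ 2 := by
      have : x^2 ≤ 1 := by nlinarith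
      nlinarith [sq_nonneg x, mul_nonneg h0.le (sq_nonneg x), mul_le_mul hκ1 this (sq_nonneg x) zero_le_one]
    linarith
  unfold QQ
  have e1 : cB k σ y x*δ ≤ 7*k*((1-σ)/32) := by
    calc cB k σ y x*δ ≤ 7*k*δ := mul_le_mul_of_nonneg_right hB hδ.le
      _ ≤ _ := mul_le_mul_of_nonneg_left hδ' (by linarith)
  have e2 : 0 ≤ cA k σ x*δ^2 := by positivity
  have : 0 < k*(1-σ) := by positivity
  linarith

lemma QQ_one_pos {k σ y x : ℝ} (hk : 1 ≤ k) (h1 : σ < 1) (hy3 : 0 < y) (hy4 : y < 1/2) : 0 < QQ k σ y x 1 := by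
  rw [QQ_one _ _ _ _ (by linarith)]
  exact mul_pos (mul_pos (mul_pos (by linarith) (by linarith)) hy3) (by linarith)

lemma strip {k σ y a b : ℝ} {g g' : ℝ → ℝ} (hk : 1 ≤ k) (h0 : 0 < σ) (h1 : σ < 1) (hy3 : 0 < y) (hy4 : y < 1/2)
    (ha : -1 ≤ a) (hb : b ≤ 0) (hd : ∀ x ∈ Ico a b, HasDerivWithinAt g (g' x) (Ici a) x)
    (hg : ∀ x ∈ Ioo a b, (g x = 1 ∨ g x = (1-σ)/32) → g' x = QQ k σ y x (g x)/(2*PP σ x*g x))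
    (i1 : g a < 1) (i2 : (1-σ)/32 < g a) : ∀ x ∈ Ico a b, (1-σ)/32 < g x ∧ g x < 1 := by
  have u := barrier (d := fun x => 1 - g x) (d' := fun x => -g' x) (t0 := a) (b := b)
    (fun t ht => (hd t ht).const_sub 1) (by linarith) (fun t ht _ h => by
      have h2 : g t = 1 := by linarith
      rw [hg t ht (Or.inl h2), h2, neg_pos]
      have := PP_neg h0 h1 (by linarith [ht.1] : -1 < t) (by linarith [ht.2])
      exact div_neg_of_pos_of_neg (QQ_one_pos hk h1 hy3 hy4) (by linarith))
  have v := barrier (d := fun x => g x - (1-σ)/32) (d' := fun x => g' x) (t0 := a) (b := b)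
    (fun t ht => (hd t ht).sub_const _) (by linarith) (fun t ht _ h => by
      have h2 : g t = (1-σ)/32 := by linarith
      rw [hg t ht (Or.inr h2), h2]
      have := PP_neg h0 h1 (by linarith [ht.1] : -1 < t) (by linarith [ht.2])
      exact div_pos_of_neg_of_neg (QQ_delta hk h0 h1 hy3 hy4 (by linarith [ht.1]) (by linarith [ht.2]) (by linarith) le_rfl)
        (mul_neg_of_neg_of_pos (by linarith) (by linarith)))
  intro x hx
  have := u x hx; have := v x hx
  constructor <;> linarith

lemma IsSol.deriv_eq {k σ y : ℝ} {g : ℝ → ℝ} {s : Set ℝ} (h : IsSol k σ y g s) {x : ℝ} (hx : x ∈ s) (hP : PP σ x ≠ 0) :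
    HasDerivAt g (QQ k σ y x (g x)/(2*PP σ x*g x)) x := by
  obtain ⟨h1, g', h2, h3⟩ := h.2 x hx
  have : QQ k σ y x (g x)/(2*PP σ x*g x) = g' := by
    rw [← h3, mul_div_cancel_left₀]
    exact mul_ne_zero (mul_ne_zero two_ne_zero hP) h1.ne'
  rw [this]; exact h2

lemma field_smooth {k σ : ℝ} {t : ℝ × ℝ × ℝ} (hP : PP σ t.1 ≠ 0) (hg : t.2.2 ≠ 0) :
    ContDiffAt ℝ (⊤:ℕ∞) (fun z : ℝ × ℝ × ℝ => QQ k σ z.2.1 z.1 z.2.2/(2*PP σ z.1*z.2.2)) t := by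
  apply ContDiffAt.div
  · apply ContDiff.contDiffAt; unfold QQ cA cB cC; fun_prop
  · apply ContDiff.contDiffAt; unfold PP; fun_prop
  · exact mul_ne_zero (mul_ne_zero two_ne_zero hP) hg

lemma field_smooth' {k σ y : ℝ} {t : ℝ × ℝ} (hP : PP σ t.1 ≠ 0) (hg : t.2 ≠ 0) :
    ContDiffAt ℝ (⊤:ℕ∞) (fun z : ℝ × ℝ => QQ k σ y z.1 z.2/(2*PP σ z.1*z.2)) t := by
  apply ContDiffAt.div
  · apply ContDiff.contDiffAt; unfold QQ cA cB cC; fun_prop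
  · apply ContDiff.contDiffAt; unfold PP; fun_prop
  · exact mul_ne_zero (mul_ne_zero two_ne_zero hP) hg

theorem left_G {k σ y3 y4 : ℝ} (hk : 1 ≤ k) (h0 : 0 < σ) (h1 : σ < 1) (hy3 : 0 < y3) (hy : y3 ≤ y4) (hy4 : y4 < 1/2) :
    ∃ r, 0 < r ∧ ∃ G : ℝ → ℝ → ℝ, (∀ x ∈ Ioo (-1) 0, ContinuousOn (fun p => G p x) (Icc y3 y4)) ∧
      ∀ y ∈ Icc y3 y4, IsSol k σ y (G y) (Ioo (-1-r) 0) ∧ G y (-1) = 1-k*y/(k+1) ∧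
        ∀ x ∈ Ico (-1) 0, (1-σ)/32 < G y x ∧ G y x < 1 := by
  obtain ⟨r, hr, hr1, G, hGc, hG⟩ := origin_sol hk h0 h1 hy3 hy hy4
  have hbd : ∀ y ∈ Icc y3 y4, 0 < y ∧ y < 1/2 := fun y hy => ⟨by linarith [hy.1], by linarith [hy.2]⟩
  -- bounds near the origin
  have hst : ∀ y ∈ Icc y3 y4, ∀ x ∈ Ico (-1) (-1+r), (1-σ)/32 < G y x ∧ G y x < 1 := by
    intro y hy
    obtain ⟨hs, h2⟩ := hG y hy
    have hd : ∀ x ∈ Ico (-1) (-1+r), HasDerivAt (G y) (deriv (G y) x) x := fun x hx => by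
      obtain ⟨_, g', h3, _⟩ := hs.2 x ⟨by linarith [hx.1], hx.2⟩
      exact h3.differentiableAt.hasDerivAt
    have hkk : 0 < k*y/(k+1) := by have := (hbd y hy).1; positivity
    have hkk2 : k*y/(k+1) < 1/2 := by
      rw [div_lt_iff₀ (by linarith)]; nlinarith [(hbd y hy).2]
    refine strip hk h0 h1 (hbd y hy).1 (hbd y hy).2 le_rfl (by linarith) (fun x hx => (hd x hx).hasDerivWithinAt) ?_ (by rw [h2]; linarith) (by rw [h2]; linarith)
    intro x hx _
    have := hs.deriv_eq (x := x) ⟨by linarith [hx.1], hx.2⟩ (PP_neg h0 h1 hx.1 (by linarith [hx.2])).ne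
    exact this.deriv
  set x0 := -1+r/2 with hx0
  set F : ℝ × ℝ × ℝ → ℝ := fun z => QQ k σ z.2.1 z.1 z.2.2/(2*PP σ z.1*z.2.2) with hF
  have hδ1 : (1-σ)/32 ≤ 1 := by linarith
  have hδ0 : 0 < (1-σ)/32 := by linarith
  obtain ⟨Y, Y0, Yd, Yc⟩ := ode_solve F (Ico x0 0) x0 y3 y4 ((1-σ)/32) 1 hy hδ1 ⟨le_rfl, by linarith⟩
    (fun s hs => ⟨hs.1, fun t ht => ⟨ht.1, ht.2.trans_lt hs.2⟩⟩)
    (fun s hs => ⟨s/2, ⟨by linarith [hs.1, hs.2], by linarith [hs.2]⟩, by linarith [hs.2]⟩)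
    (fun t ht p hp y hy => (field_smooth (PP_neg h0 h1 (by linarith [ht.1]) ht.2).ne (by linarith [hy.1] : (0:ℝ) < y).ne').of_le (by exact_mod_cast le_top))
    (fun p => G p x0) (hGc x0 ⟨by linarith, by linarith⟩)
  have hYb : ∀ y ∈ Icc y3 y4, ∀ x ∈ Ico x0 0, (1-σ)/32 < Y y x ∧ Y y x < 1 := by
    intro y hy
    have hi := hst y hy x0 ⟨by linarith, by linarith⟩
    refine strip hk h0 h1 (hbd y hy).1 (hbd y hy).2 (by linarith) le_rfl (fun x hx => Yd y hy x hx) ?_ (by rw [Y0 y hy]; exact hi.2) (by rw [Y0 y hy]; exact hi.1)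
    rintro x hx h
    have : cl ((1-σ)/32) 1 (Y y x) = Y y x := by
      apply cl_eq
      rcases h with h | h <;> rw [h] <;> constructor <;> linarith
    rw [this]
  refine ⟨r, hr, fun y x => if x ≤ x0 then G y x else Y y x, ?_, ?_⟩
  · intro x hx
    by_cases h : x ≤ x0
    · simp only [h, if_true]; exact hGc x ⟨by linarith [hx.1], by linarith⟩
    · simp only [h, if_false]; exact Yc x ⟨by linarith, hx.2⟩
  intro y hy
  obtain ⟨hs, h2⟩ := hG y hy
  obtain ⟨gl, gr, gd⟩ := ode_glue (F := fun z : ℝ × ℝ => QQ k σ y z.1 z.2/(2*PP σ z.1*z.2)) (a := -1) (t0 := x0) (c := -1+r)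
    (J := Ico x0 0) (y1 := G y) (y2 := Y y) (by linarith) (by linarith)
    (fun s hs _ => ⟨s/2, ⟨by linarith [hs.1, hs.2], by linarith [hs.2]⟩, by linarith [hs.2]⟩)
    (Y0 y hy).symm ⟨le_rfl, by linarith⟩
    (fun t ht => hs.deriv_eq ⟨by linarith [ht.1], ht.2⟩ (PP_neg h0 h1 ht.1 (by linarith [ht.2])).ne)
    (fun t ht => by
      have h3 := Yd y hy t ht
      rw [cl_eq ⟨(hYb y hy t ht).1.le, (hYb y hy t ht).2.le⟩] at h3
      exact h3)
  set g := fun t => if t ≤ x0 then G y t else Y y t with hg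
  have hbnd : ∀ x ∈ Ico (-1) 0, (1-σ)/32 < g x ∧ g x < 1 := by
    intro x hx
    by_cases h : x ≤ x0
    · rw [gl x h]; exact hst y hy x ⟨hx.1, by linarith⟩
    · push Not at h
      rw [gr x h.le]; exact hYb y hy x ⟨h.le, hx.2⟩
  have hd : ∀ x ∈ Ioo (-1) 0, HasDerivAt g (QQ k σ y x (g x)/(2*PP σ x*g x)) x := fun x hx => by
    refine gd x hx.1 ?_
    rcases le_or_gt x x0 with h | h
    · exact Or.inl h
    · exact Or.inr ⟨h.le, hx.2⟩
  have hsm := ode_smooth (F := fun z : ℝ × ℝ => QQ k σ y z.1 z.2/(2*PP σ z.1*z.2)) isOpen_Ioo hd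
    (fun x hx => field_smooth' (PP_neg h0 h1 hx.1 hx.2).ne (by linarith [(hbnd x ⟨hx.1.le, hx.2⟩).1] : (0:ℝ) < g x).ne')
  have hloc : ∀ x, x < x0 → g =ᶠ[𝓝 x] G y := fun x hx => by
    filter_upwards [Iio_mem_nhds hx] with t ht
    exact gl t (le_of_lt ht)
  change IsSol k σ y g (Ioo (-1-r) 0) ∧ g (-1) = _ ∧ _
  refine ⟨⟨?_, ?_⟩, ?_, hbnd⟩
  · intro x hx
    rcases lt_or_ge x x0 with h | h
    · exact (((hs.1.contDiffAt (Ioo_mem_nhds hx.1 (by linarith))).congr_of_eventuallyEq (hloc x h))).contDiffWithinAt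
    · exact (hsm.contDiffAt (Ioo_mem_nhds (by linarith) hx.2)).contDiffWithinAt
  · intro x hx
    rcases lt_or_ge x x0 with h | h
    · obtain ⟨q1, g', q2, q3⟩ := hs.2 x ⟨hx.1, by linarith⟩
      have := (hloc x h).eq_of_nhds
      rw [this]
      exact ⟨q1, g', q2.congr_of_eventuallyEq (hloc x h), q3⟩
    · have hx1 : x ∈ Ioo (-1) 0 := ⟨by linarith, hx.2⟩
      have hp : 0 < g x := by linarith [(hbnd x ⟨hx1.1.le, hx.2⟩).1]
      refine ⟨hp, _, hd x hx1, ?_⟩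
      rw [mul_div_cancel₀]
      exact mul_ne_zero (mul_ne_zero two_ne_zero (PP_neg h0 h1 hx1.1 hx1.2).ne) hp.ne'
  · show g (-1) = _
    rw [gl _ (by linarith), h2]


noncomputable def r3c (k σ y e γ h : ℝ) : ℝ :=
  h*(6*γ+pW k σ y e γ) - 3*(1+σ)*γ^2 + 2*γ*(σ*(1+e)-(1-σ)/k*(1-e))
noncomputable def r4c (k σ e γ h : ℝ) : ℝ :=
  -6*h^2+8*(1+σ)*γ*h-((1-σ)/k+2*σ)*(γ^2+2*e*h)-2*(σ-(1-σ)/k)*h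
noncomputable def r5c (k σ γ h : ℝ) : ℝ := -5*(1+σ)*h^2+(2*((1-σ)/k)+6*σ)*γ*h
noncomputable def r6c (k σ h : ℝ) : ℝ := -((1-σ)/k+4*σ)*h^2

lemma E_b {k σ y e R γ h x : ℝ} (G : Good k σ y e R γ) (hh : 2*e*(R-3)*h = pN k σ y e γ) :
    QQ k σ y x (e-γ*x+h*x^2) - 2*PP σ x*(e-γ*x+h*x^2)*(-γ+2*h*x) =
      x^3*(r3c k σ y e γ h + x*(r4c k σ e γ h + r5c k σ γ h*x + r6c k σ h*x^2)) := by
  have rb := G.rb; have rc := G.rc; have hγ := G.hγ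
  unfold pG pb1 pc1 at hγ
  unfold pN pb1 pQ at hh
  unfold QQ PP cA cB cC r3c r4c r5c r6c pW pb1
  linear_combination (e-γ*x+h*x^2)*rb - rc - x*hγ + x^2*hh

theorem sonic_local {k σ p1 p2 : ℝ} (hp : p1 ≤ p2) {e R γ : ℝ → ℝ} (he : ContinuousOn e (Icc p1 p2))
    (hR : ContinuousOn R (Icc p1 p2)) (hγ : ContinuousOn γ (Icc p1 p2))
    (hb : ∀ y ∈ Icc p1 p2, 3 < R y ∧ R y < 4) (hG : ∀ y ∈ Icc p1 p2, Good k σ y (e y) (R y) (γ y)) :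
    ∃ r, 0 < r ∧ r < 1 ∧ ∃ F : ℝ → ℝ → ℝ, (∀ x ∈ Ioo (-r) r, ContinuousOn (fun p => F p x) (Icc p1 p2)) ∧
      ∀ y ∈ Icc p1 p2, IsSol k σ y (F y) (Ioo (-r) r) ∧ ∃ (h : ℝ) (ζ : ℝ → ℝ), 2*e y*(R y-3)*h = pN k σ y (e y) (γ y) ∧
        ContinuousOn ζ (Ioo (-r) r) ∧ 2*e y*(4-R y)*ζ 0 = r3c k σ y (e y) (γ y) h ∧
        ∀ x, F y x = e y - γ y*x + h*x^2 + x^3*ζ x := by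
  set h : ℝ → ℝ := fun y => pN k σ y (e y) (γ y)/(2*e y*(R y-3)) with hh
  have hhe : ∀ y ∈ Icc p1 p2, 2*e y*(R y-3)*h y = pN k σ y (e y) (γ y) := fun y hy => by
    have h1 := (hG y hy).e0; have h2 := (hb y hy).1
    have : 2*e y*(R y-3) ≠ 0 := (mul_pos (by linarith) (by linarith)).ne'
    simp only [hh]; rw [mul_div_cancel₀ _ this]
  have hhc : ContinuousOn h (Icc p1 p2) := by
    apply ContinuousOn.div
    · unfold pN pb1 pQ; fun_prop
    · fun_prop
    · intro y hy
      have h1 := (hG y hy).e0; have h2 := (hb y hy).1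
      exact (mul_pos (by linarith) (by linarith)).ne'
  obtain ⟨r, hr, ζ, hζc, hζ⟩ := sing_gen (E := ℝ × ℝ × ℝ × ℝ) 2
    (Eh := fun z => r4c k σ z.2.2.1 z.2.2.2.1 z.2.2.2.2 + r5c k σ z.2.2.2.1 z.2.2.2.2*z.1 + r6c k σ z.2.2.2.2*z.1^2)
    (Mh := fun z => (pb1 k σ z.2.1 - 2*(σ-(1-σ)/k)*z.1) - 2*((-2*z.2.2.2.1+(1+σ)*z.2.2.1)+(2*z.2.2.2.2-(1+σ)*z.2.2.2.1+(1-σ)/k*z.2.2.1)*z.1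
      +((1+σ)*z.2.2.2.2-(1-σ)/k*z.2.2.2.1)*z.1^2+(1-σ)/k*z.2.2.2.2*z.1^3) - 2*((1+z.1)*(1+σ*z.1))*(-z.2.2.2.1+2*z.2.2.2.2*z.1)
      - 6*((-z.2.2.2.1+(1+σ)*z.2.2.1)+(z.2.2.2.2-(1+σ)*z.2.2.2.1+σ*z.2.2.1)*z.1+((1+σ)*z.2.2.2.2-σ*z.2.2.2.1)*z.1^2+σ*z.2.2.2.2*z.1^3))
    (Ah := fun z => cA k σ z.1 + 6*((1+z.1)*(1+σ*z.1)))
    (Kh := fun z => (-z.2.2.2.1+(1+σ)*z.2.2.1)+(z.2.2.2.2-(1+σ)*z.2.2.2.1+σ*z.2.2.1)*z.1+((1+σ)*z.2.2.2.2-σ*z.2.2.2.1)*z.1^2+σ*z.2.2.2.2*z.1^3)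
    (q := fun z => (1+z.1)*(1+σ*z.1))
    (b := fun z => z.2.2.1 - z.2.2.2.1*z.1 + z.2.2.2.2*z.1^2)
    (E0 := fun w => r3c k σ w.1 w.2.1 w.2.2.1 w.2.2.2)
    (M0 := fun w => (k+2-k*w.1*(1+σ)) - 10*w.2.1)
    (d0 := fun w => w.2.1)
    (by unfold r4c r5c r6c; fun_prop) (by unfold pb1; fun_prop) (by unfold cA; fun_prop) (by fun_prop) (by fun_prop) (by fun_prop)
    (by unfold r3c pW pb1; fun_prop) (by fun_prop) (by fun_prop)
    p1 p2 hp (fun y => (y, e y, γ y, h y)) (by fun_prop)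
    (fun y hy => (hG y hy).e0.ne')
    (fun y hy => by
      have h1 := (hG y hy).e0
      simp only
      rw [(hG y hy).rb, show 2*(1+R y)*e y - 10*e y = (2*e y)*(R y-4) by ring, mul_div_cancel_left₀ _ (by linarith)]
      linarith [(hb y hy).2])
    (fun x w => by ring)
  set r' := min r (1/2) with hr'
  have r'0 : 0 < r' := lt_min hr (by norm_num)
  have r'r : r' ≤ r := min_le_left _ _
  have r's : r' ≤ 1/2 := min_le_right _ _
  have hsub : Ioo (-r') r' ⊆ Ioo (-r) r := fun x hx => ⟨by linarith [hx.1], by linarith [hx.2]⟩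
  refine ⟨r', r'0, by linarith, fun y x => e y - γ y*x + h y*x^2 + x^3*ζ y x, ?_, ?_⟩
  · intro x hx
    have := hζc x (hsub hx)
    fun_prop
  intro y hy
  obtain ⟨a1, a2, a3, a4⟩ := hζ y hy
  refine ⟨⟨?_, ?_⟩, h y, ζ y, hhe y hy, (a1.continuousOn).mono hsub, ?_, fun x => rfl⟩
  · have h2 := a1.mono hsub
    exact (ContDiff.contDiffOn (by fun_prop)).add ((ContDiff.contDiffOn (by fun_prop : ContDiff ℝ (⊤:ℕ∞) (fun x : ℝ => x^3))).mul h2)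
  · intro x hx
    have hGy := hG y hy
    have q1 := a2 x (hsub hx)
    obtain ⟨ζ', d1, d2⟩ := a3 x (hsub hx)
    simp only at q1 d2
    have hq : 0 < (1+x)*(1+σ*x) := by
      apply mul_pos (by linarith [hx.1])
      nlinarith [hx.1, hGy.hs0, hGy.hs1]
    have hE := E_b (x := x) hGy (hhe y hy)
    constructor
    · have : 0 < (e y*((1+x)*(1+σ*x)))*(e y - γ y*x + h y*x^2 + x^3*ζ y x) := by
        convert q1 using 1; ring
      exact pos_of_mul_pos_right this (mul_pos hGy.e0 hq).le
    · refine ⟨_, ((((hasDerivAt_id x).const_mul (γ y)).const_sub (e y)).add (((hasDerivAt_id x).pow 2).const_mul (h y))).add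
        (((hasDerivAt_id x).pow 3).mul d1), ?_⟩
      simp only [id]
      norm_num
      set Z := ζ y x
      norm_num at d2
      unfold QQ PP at hE ⊢
      unfold cA cB pb1 at *
      generalize e y = E at *
      generalize γ y = c at *
      generalize h y = H at *
      clear q1 hζ hζc a2 a3 a4 
      linear_combination x^3*d2 - hE
  · have h2 : ζ y 0 * ((k+2-k*y*(1+σ)) - 10*e y) = -r3c k σ y (e y) (γ y) (h y) := a4
    rw [(hG y hy).rb] at h2
    linear_combination -h2


lemma tdiv {f g : ℝ → ℝ} {l : Filter ℝ} {a b : ℝ} (hf : Tendsto f l (𝓝 a)) (hg : Tendsto g l (𝓝 b)) (hb : b ≠ 0) :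
    Tendsto (fun x => f x/g x) l (𝓝 (a/b)) := hf.div hg hb

lemma lvl {k σ y x : ℝ} {g b : ℝ → ℝ} {b' : ℝ} (n : ℕ) (hx : x ≠ 0) (hp : (1+x)*(1+σ*x) ≠ 0) (hg : g x ≠ 0)
    (hb : HasDerivAt b b' x) (hd : HasDerivAt g (QQ k σ y x (g x)/(2*PP σ x*g x)) x) :
    HasDerivAt (fun x => (g x - b x)/x^n)
      (((QQ k σ y x (b x) - 2*PP σ x*b x*b')/x^n/(2*((1+x)*(1+σ*x))*g x)
        + ((cB k σ y x - cA k σ x*(b x+g x) - 2*x*((1+x)*(1+σ*x))*b' - 2*n*((1+x)*(1+σ*x))*g x)/(2*((1+x)*(1+σ*x))*g x))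
          *((g x - b x)/x^n))/x) x := by
  have h1 := (hd.sub hb).div (hasDerivAt_pow n x) (pow_ne_zero n hx)
  refine h1.congr_deriv ?_
  have e1 : PP σ x = x*((1+x)*(1+σ*x)) := by unfold PP; ring
  have e2 : QQ k σ y x (g x) = QQ k σ y x (b x) + (g x - b x)*(cB k σ y x - cA k σ x*(b x+g x)) := by
    unfold QQ; ring
  simp only [Pi.sub_apply]
  rw [e1, e2]
  generalize (1+x)*(1+σ*x) = p at *
  generalize QQ k σ y x (b x) = Q at *
  generalize cB k σ y x = B at *
  generalize cA k σ x = A at *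
  rcases n with _ | n
  · simp; field_simp; ring
  · simp only [Nat.add_sub_cancel]
    push_cast
    rw [pow_succ]
    have hxn : x^n ≠ 0 := pow_ne_zero n hx
    generalize x^n = X at *
    field_simp
    ring

lemma sqrt_lvl {ζ : ℝ → ℝ} {A a x : ℝ} (hx : x < 0) (h : HasDerivAt ζ ((A + a*ζ x)/x) x) :
    HasDerivAt (fun x => √(-x)*ζ x) ((√(-x)*A + (a+1/2)*(√(-x)*ζ x))/x) x := by
  have h1 : HasDerivAt (fun x : ℝ => √(-x)) (-1/(2*√(-x))) x := (hasDerivAt_neg x).sqrt (by linarith)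
  refine (h1.mul h).congr_deriv ?_
  have hs : 0 < √(-x) := Real.sqrt_pos.2 (by linarith)
  have h2 : x = -(√(-x))^2 := by rw [Real.sq_sqrt (by linarith)]; ring
  set s := √(-x)
  have : x ≠ 0 := hx.ne
  field_simp
  rw [h2]; ring

structure LeftSol (k σ y : ℝ) (g : ℝ → ℝ) : Prop where
  d : ∀ x ∈ Ioo (-1) 0, HasDerivAt g (QQ k σ y x (g x)/(2*PP σ x*g x)) x
  lo : ∀ x ∈ Ioo (-1) 0, (1-σ)/32 < g x
  hi : ∀ x ∈ Ioo (-1) 0, g x < 1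

section chain
variable {k σ y e R γ : ℝ} {g : ℝ → ℝ}

lemma pp_pos (G : Good k σ y e R γ) {x : ℝ} (hx : x ∈ Ioo (-1) 0) : 0 < (1+x)*(1+σ*x) := by
  apply mul_pos (by linarith [hx.1])
  nlinarith [hx.1, G.hs0, G.hs1]

lemma chain0 (G : Good k σ y e R γ) (hg : LeftSol k σ y g) : Tendsto g (𝓝[<] 0) (𝓝 e) := by
  have hs1 := G.hs1; have hs0 := G.hs0; have hRe := G.Re
  have hmem : ∀ᶠ x in 𝓝[<] (0:ℝ), x ∈ Ioo (-(1/2:ℝ)) 0 := Ioo_mem_nhdsLT (by norm_num)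
  have hT : Tendsto (fun x : ℝ => x) (𝓝[<] 0) (𝓝 0) := tendsto_id.mono_left nhdsWithin_le_nhds
  set T0 : ℝ × ℝ → ℝ := fun z => -((1+σ)+(1-σ)/k*z.1)*z.2^2 + (pb1 k σ y - 2*(σ-(1-σ)/k)*z.1)*z.2 - (pc1 k σ y - (2*σ-(1-σ)/k)*z.1) with hT0
  obtain ⟨C, hC⟩ : ∃ C : ℝ, ∀ x ∈ Icc (-1:ℝ) 0, ∀ g ∈ Icc (0:ℝ) 1, |T0 (x, g)| ≤ C := by
    have hc : Continuous (fun z => |T0 z|) := by unfold T0; fun_prop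
    obtain ⟨C, hC⟩ := ((isCompact_Icc (a := (-1:ℝ)) (b := 0)).prod (isCompact_Icc (a := (0:ℝ)) (b := 1))).image hc |>.bddAbove
    exact ⟨C, fun x hx g hg => hC ⟨(x, g), ⟨hx, hg⟩, rfl⟩⟩
  have hC0 : 0 ≤ C := (abs_nonneg _).trans (hC 0 (by simp) 0 (by simp))
  have main := conv_sing0 (D := g) (A := fun x => x*(T0 (x, g x)/(2*((1+x)*(1+σ*x))*g x)) - (R*e-g x)/((1+x)*(1+σ*x)*g x)*e)
    (a := fun x => (R*e-g x)/((1+x)*(1+σ*x)*g x)) (r := 1) (L := e) (a0 := R*e-1) (by norm_num) (by linarith) ?_ ?_ ?_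
  · exact main
  · intro x hx
    refine (hg.d x hx).congr_deriv ?_
    have h1 := hg.lo x hx
    have hg0 : g x ≠ 0 := (by linarith : 0 < g x).ne'
    have hp := (pp_pos G hx).ne'
    have hx0 : x ≠ 0 := hx.2.ne
    have e1 : PP σ x = x*((1+x)*(1+σ*x)) := by unfold PP; ring
    have e2 : QQ k σ y x (g x) = 2*(g x-e)*(R*e-g x) + x*T0 (x, g x) := by
      simp only [hT0]; unfold QQ cA cB cC pb1 pc1
      linear_combination g x*G.rb - G.rc
    rw [e1, e2]
    generalize (1+x)*(1+σ*x) = p at *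
    generalize T0 (x, g x) = t at *
    field_simp; ring
  · simp only [sub_add_cancel]
    have hz : Tendsto (fun x => x*(T0 (x, g x)/(2*((1+x)*(1+σ*x))*g x))) (𝓝[<] 0) (𝓝 0) := by
      have hb : ∀ᶠ x in 𝓝[<] (0:ℝ), |x*(T0 (x, g x)/(2*((1+x)*(1+σ*x))*g x))| ≤ |x| * (C/(2*(1/4)*((1-σ)/32))) := by
        filter_upwards [hmem] with x hx
        have hx1 : x ∈ Ioo (-1) 0 := ⟨by linarith [hx.1], hx.2⟩
        have h1 := hg.lo x hx1; have h2 := hg.hi x hx1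
        rw [abs_mul, abs_div]
        apply mul_le_mul_of_nonneg_left _ (abs_nonneg x)
        have hp : 1/4 ≤ (1+x)*(1+σ*x) := by
          have a1 : 1/2 ≤ 1+x := by linarith [hx.1]
          have a2 : 1/2 ≤ 1+σ*x := by nlinarith [hx.1, hx.2]
          nlinarith
        have hd : 2*(1/4)*((1-σ)/32) ≤ 2*((1+x)*(1+σ*x))*g x := by
          apply mul_le_mul (by linarith) h1.le (by linarith) (by linarith)
        rw [abs_of_pos (a := 2*((1+x)*(1+σ*x))*g x) (by linarith)]
        apply div_le_div₀ hC0 (hC x ⟨by linarith [hx.1], hx.2.le⟩ _ ⟨by linarith, h2.le⟩) (by linarith) hd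
      have h0 : Tendsto (fun x : ℝ => |x| * (C/(2*(1/4)*((1-σ)/32)))) (𝓝[<] 0) (𝓝 0) := by
        have := hT.abs.mul_const (C/(2*(1/4)*((1-σ)/32)))
        simpa using this
      exact squeeze_zero_norm' hb h0
    exact hz
  · filter_upwards [hmem] with x hx
    have hx1 : x ∈ Ioo (-1) 0 := ⟨by linarith [hx.1], hx.2⟩
    have h1 := hg.lo x hx1; have h2 := hg.hi x hx1
    have hp := pp_pos G hx1
    have hp1 : (1+x)*(1+σ*x) ≤ 1 := by
      have a2 : 1+σ*x ≤ 1 := by nlinarith [hx.1, hx.2]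
      have : 0 < 1+x := by linarith [hx.1]
      nlinarith [hx.2]
    have hpg : (1+x)*(1+σ*x)*g x ≤ 1 := by
      have : 0 < g x := by linarith
      nlinarith
    rw [lt_div_iff₀ (mul_pos hp (by linarith))]
    nlinarith

/-- basic limits used later -/
lemma lims (G : Good k σ y e R γ) (hg : Tendsto g (𝓝[<] 0) (𝓝 e)) (b : ℝ → ℝ) (hb : Continuous b) (hb0 : b 0 = e) (b' : ℝ → ℝ) (hb' : Continuous b') (n : ℕ) :
    Tendsto (fun x => 2*((1+x)*(1+σ*x))*g x) (𝓝[<] 0) (𝓝 (2*e)) ∧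
    Tendsto (fun x => (cB k σ y x - cA k σ x*(b x+g x) - 2*x*((1+x)*(1+σ*x))*b' x - 2*n*((1+x)*(1+σ*x))*g x)/(2*((1+x)*(1+σ*x))*g x)) (𝓝[<] 0) (𝓝 (R-1-n)) := by
  have he := G.e0
  have a1 : Tendsto (fun x => 2*((1+x)*(1+σ*x))*g x) (𝓝[<] 0) (𝓝 (2*e)) := by
    have : Continuous (fun x : ℝ => 2*((1+x)*(1+σ*x))) := by fun_prop
    have := ((this.tendsto 0).mono_left nhdsWithin_le_nhds).mul hg
    simpa using this
  refine ⟨a1, ?_⟩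
  have c1 : Continuous (fun x => cB k σ y x) := by unfold cB; fun_prop
  have c2 : Continuous (fun x => cA k σ x) := by unfold cA; fun_prop
  have c3 : Continuous (fun x => 2*x*((1+x)*(1+σ*x))*b' x) := by fun_prop
  have c4 : Continuous (fun x : ℝ => 2*n*((1+x)*(1+σ*x))) := by fun_prop
  have tt : ∀ f : ℝ → ℝ, Continuous f → Tendsto f (𝓝[<] 0) (𝓝 (f 0)) := fun f hf => (hf.tendsto 0).mono_left nhdsWithin_le_nhds
  have := tdiv ((((tt _ c1).sub ((tt _ c2).mul ((tt _ hb).add hg))).sub (tt _ c3)).sub ((tt _ c4).mul hg)) a1 (by linarith : 2*e ≠ 0)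
  convert this using 2
  rw [hb0]
  unfold cA cB
  have := G.rb
  simp only [mul_zero, add_zero, sub_zero, ne_eq, OfNat.ofNat_ne_zero, not_false_eq_true, zero_pow]
  rw [this]
  field_simp
  ring

lemma QQ_e (G : Good k σ y e R γ) (x : ℝ) : QQ k σ y x e = x*(pG k σ y e + x*pQ k σ e) := by
  have rb := G.rb; have rc := G.rc
  unfold QQ cA cB cC pG pb1 pc1 pQ
  linear_combination e*rb - rc

lemma QQ_b1 (G : Good k σ y e R γ) (x : ℝ) : QQ k σ y x (e-γ*x) - 2*PP σ x*(e-γ*x)*(-γ) =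
    x^2*(-pN k σ y e γ + x*(r3c k σ y e γ 0 + x*r4c k σ e γ 0)) := by
  have rb := G.rb; have rc := G.rc; have hγ := G.hγ
  unfold pG pb1 pc1 at hγ
  unfold QQ PP cA cB cC r3c r4c pW pN pQ pb1
  linear_combination (e-γ*x)*rb - rc - x*hγ

lemma tends_cont {f : ℝ → ℝ} (hf : Continuous f) : Tendsto f (𝓝[<] 0) (𝓝 (f 0)) :=
  (hf.tendsto 0).mono_left nhdsWithin_le_nhds

lemma chain1 (G : Good k σ y e R γ) (hg : LeftSol k σ y g) : Tendsto (fun x => (g x - e)/x^1) (𝓝[<] 0) (𝓝 (-γ)) := by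
  have he := G.e0; have hR := G.R3
  obtain ⟨l1, l2⟩ := lims G (chain0 G hg) (fun _ => e) continuous_const rfl (fun _ => 0) continuous_const 1
  have hA : Tendsto (fun x => (pG k σ y e + x*pQ k σ e)/(2*((1+x)*(1+σ*x))*g x)) (𝓝[<] 0) (𝓝 (pG k σ y e/(2*e))) := by
    have := tdiv (tends_cont (by fun_prop : Continuous (fun x => pG k σ y e + x*pQ k σ e))) l1 (by linarith)
    simpa using this
  have main := conv_sing (r := 1) (D := fun x => (g x - e)/x^1) (by norm_num) (by push_cast; linarith) ?_ hA l2
  · convert main using 2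
    have : R-1-(1:ℕ) ≠ 0 := by push_cast; linarith
    rw [← G.hγ]; field_simp; push_cast; ring
  · intro x hx
    have h1 := hg.lo x hx; have := G.hs1
    have hx0 : x ≠ 0 := hx.2.ne
    refine (lvl 1 hx0 (pp_pos G hx).ne' (by linarith) (hasDerivAt_const x e) (hg.d x hx)).congr_deriv ?_
    rw [QQ_e G]
    have : (x*(pG k σ y e + x*pQ k σ e) - 2*PP σ x*e*0)/x^1 = pG k σ y e + x*pQ k σ e := by field_simp; ring
    rw [this]

lemma deriv_b1 (x : ℝ) : HasDerivAt (fun x => e-γ*x) (-γ) x := by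
  have := ((hasDerivAt_id x).const_mul γ).const_sub e
  simpa using this

lemma lvl2 (G : Good k σ y e R γ) (hg : LeftSol k σ y g) {x : ℝ} (hx : x ∈ Ioo (-1) 0) :
    HasDerivAt (fun x => (g x - (e-γ*x))/x^2)
      (((-pN k σ y e γ + x*(r3c k σ y e γ 0 + x*r4c k σ e γ 0))/(2*((1+x)*(1+σ*x))*g x)
        + ((cB k σ y x - cA k σ x*((e-γ*x)+g x) - 2*x*((1+x)*(1+σ*x))*(-γ) - 2*(2:ℕ)*((1+x)*(1+σ*x))*g x)/(2*((1+x)*(1+σ*x))*g x))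
          *((g x - (e-γ*x))/x^2))/x) x := by
  have h1 := hg.lo x hx; have := G.hs1
  have hx0 : x ≠ 0 := hx.2.ne
  refine (lvl 2 hx0 (pp_pos G hx).ne' (by linarith) (deriv_b1 x) (hg.d x hx)).congr_deriv ?_
  rw [QQ_b1 G, mul_div_cancel_left₀ _ (pow_ne_zero 2 hx0)]

lemma sqrt_tend : Tendsto (fun x : ℝ => √(-x)) (𝓝[<] 0) (𝓝 0) := by
  have := tends_cont (by fun_prop : Continuous (fun x : ℝ => √(-x)))
  simpa using this

lemma chain2a (G : Good k σ y e R γ) (hg : LeftSol k σ y g) :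
    Tendsto (fun x => √(-x)*((g x - (e-γ*x))/x^2)) (𝓝[<] 0) (𝓝 0) := by
  have he := G.e0; have hR := G.R3
  obtain ⟨l1, l2⟩ := lims G (chain0 G hg) (fun x => e-γ*x) (by fun_prop) (by simp) (fun _ => -γ) continuous_const 2
  have hA : Tendsto (fun x => √(-x)*((-pN k σ y e γ + x*(r3c k σ y e γ 0 + x*r4c k σ e γ 0))/(2*((1+x)*(1+σ*x))*g x))) (𝓝[<] 0) (𝓝 0) := by
    have := sqrt_tend.mul (tdiv (tends_cont (by fun_prop : Continuous (fun x => -pN k σ y e γ + x*(r3c k σ y e γ 0 + x*r4c k σ e γ 0)))) l1 (by linarith))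
    simpa using this
  have main := conv_sing (r := 1) (by norm_num) (by push_cast; linarith) (fun x hx => sqrt_lvl hx.2 (lvl2 G hg hx)) hA (l2.add_const (1/2))
  simpa using main

lemma chain2b (G : Good k σ y e R γ) (hg : LeftSol k σ y g) (hR : 3 < R) {h : ℝ} (hh : 2*e*(R-3)*h = pN k σ y e γ) :
    Tendsto (fun x => (g x - (e-γ*x))/x^2) (𝓝[<] 0) (𝓝 h) := by
  have he := G.e0
  obtain ⟨l1, l2⟩ := lims G (chain0 G hg) (fun x => e-γ*x) (by fun_prop) (by simp) (fun _ => -γ) continuous_const 2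
  have hA : Tendsto (fun x => ((-pN k σ y e γ + x*(r3c k σ y e γ 0 + x*r4c k σ e γ 0))/(2*((1+x)*(1+σ*x))*g x))) (𝓝[<] 0) (𝓝 (-pN k σ y e γ/(2*e))) := by
    have := (tdiv (tends_cont (by fun_prop : Continuous (fun x => -pN k σ y e γ + x*(r3c k σ y e γ 0 + x*r4c k σ e γ 0)))) l1 (by linarith))
    simpa using this
  have main := conv_sing (r := 1) (by norm_num) (by push_cast; linarith) (fun x hx => (lvl2 G hg hx)) hA l2
  convert main using 2
  have : R-1-(2:ℕ) ≠ 0 := by push_cast; linarith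
  rw [← hh]; field_simp; push_cast; ring

lemma lvl3 (G : Good k σ y e R γ) (hg : LeftSol k σ y g) {h : ℝ} (hh : 2*e*(R-3)*h = pN k σ y e γ) {x : ℝ} (hx : x ∈ Ioo (-1) 0) :
    HasDerivAt (fun x => (g x - (e-γ*x+h*x^2))/x^3)
      (((r3c k σ y e γ h + x*(r4c k σ e γ h + r5c k σ γ h*x + r6c k σ h*x^2))/(2*((1+x)*(1+σ*x))*g x)
        + ((cB k σ y x - cA k σ x*((e-γ*x+h*x^2)+g x) - 2*x*((1+x)*(1+σ*x))*(-γ+2*h*x) - 2*(3:ℕ)*((1+x)*(1+σ*x))*g x)/(2*((1+x)*(1+σ*x))*g x))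
          *((g x - (e-γ*x+h*x^2))/x^3))/x) x := by
  have h1 := hg.lo x hx; have := G.hs1
  have hx0 : x ≠ 0 := hx.2.ne
  have hb : HasDerivAt (fun x => e-γ*x+h*x^2) (-γ+2*h*x) x := by
    refine ((deriv_b1 x).add (((hasDerivAt_id x).pow 2).const_mul h)).congr_deriv ?_
    simp; ring
  refine (lvl 3 hx0 (pp_pos G hx).ne' (by linarith) hb (hg.d x hx)).congr_deriv ?_
  rw [E_b G hh, mul_div_cancel_left₀ _ (pow_ne_zero 3 hx0)]

lemma chain3a (G : Good k σ y e R γ) (hg : LeftSol k σ y g) (hR : 4 ≤ R) {h : ℝ} (hh : 2*e*(R-3)*h = pN k σ y e γ) :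
    Tendsto (fun x => √(-x)*((g x - (e-γ*x+h*x^2))/x^3)) (𝓝[<] 0) (𝓝 0) := by
  have he := G.e0
  obtain ⟨l1, l2⟩ := lims G (chain0 G hg) (fun x => e-γ*x+h*x^2) (by fun_prop) (by simp) (fun x => -γ+2*h*x) (by fun_prop) 3
  have hA : Tendsto (fun x => √(-x)*((r3c k σ y e γ h + x*(r4c k σ e γ h + r5c k σ γ h*x + r6c k σ h*x^2))/(2*((1+x)*(1+σ*x))*g x))) (𝓝[<] 0) (𝓝 0) := by
    have := sqrt_tend.mul (tdiv (tends_cont (by fun_prop : Continuous (fun x => r3c k σ y e γ h + x*(r4c k σ e γ h + r5c k σ γ h*x + r6c k σ h*x^2)))) l1 (by linarith))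
    simpa using this
  have main := conv_sing (r := 1) (by norm_num) (by push_cast; linarith) (fun x hx => sqrt_lvl hx.2 (lvl3 G hg hh hx)) hA (l2.add_const (1/2))
  simpa using main
end chain


noncomputable def m1c (k σ y e γ x : ℝ) : ℝ :=
  pb1 k σ y - 2*(σ-(1-σ)/k)*x - (2*(1+σ)*e-4*γ) - (2*((1-σ)/k)*e-2*(1+σ)*γ)*x + 2*((1-σ)/k)*γ*x^2
   + 2*((1+x)*(1+σ*x))*γ - (4*(1+σ)*e-4*γ) - (4*σ*e-4*(1+σ)*γ)*x + 4*σ*γ*x^2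

/-- contact condition near `R = 3` -/
noncomputable def Phi3 (k σ s y e γ ν : ℝ) : ℝ :=
  pN k σ y e γ*(ν+s) + s*((r3c k σ y e γ 0 + (-s^2)*r4c k σ e γ 0)*(ν+s)^2 + m1c k σ y e γ (-s^2)*(ν+s)
    + (cA k σ (-s^2) + 4*((1-s^2)*(1-σ*s^2)))*s^2) - (1-s^2)*(1-σ*s^2)*e

lemma n3_alg {k σ y e R γ g p T A B m1 N ν s z : ℝ} (hs : 0 < s) (hτ : 0 < ν + s) (hp : 0 < p) (he : 0 < e)
    (hge : e < g) (hz : z*(ν+s) = 1)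
    (hΦ : N*(ν+s) + s*(T*(ν+s)^2+m1*(ν+s)+(A+4*p)*s^2) - p*e < 0)
    (hB : B - A*((e+γ*s^2)+g) - 2*(-s^2)*p*(-γ) - 2*(2:ℕ)*p*g = N*ν + (-s^2)*m1 - (A+4*p)*s^4*z) :
    0 < -(((-N + (-s^2)*T)/(2*p*g) + ((B - A*((e+γ*s^2)+g) - 2*(-s^2)*p*(-γ) - 2*(2:ℕ)*p*g)/(2*p*g))*z)/(-s^2))*(ν+s)
      + z*(1/(2*s)) := by
  rw [hB]
  have hg : 0 < g := by linarith
  have hτ' := hτ.ne'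
  have hz' : z = 1/(ν+s) := by field_simp; exact hz
  set τ := ν + s with hτd
  have hν : ν = τ - s := by rw [hτd]; ring
  have e1 : -(((-N + (-s^2)*T)/(2*p*g) + ((N*ν + (-s^2)*m1 - (A+4*p)*s^4*z)/(2*p*g))*z)/(-s^2))*τ + z*(1/(2*s))
     = (p*g - (N*τ + s*(T*τ^2+m1*τ+(A+4*p)*s^2)))/(2*p*g*s*τ) := by
    rw [hz', hν]
    field_simp
    ring
  rw [e1]
  apply div_pos _ (by positivity)
  have : p*e < p*g := mul_lt_mul_of_pos_left hge hp
  linarith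

set_option maxHeartbeats 800000 in
lemma n3_point {k σ y e R γ r h : ℝ} {g : ℝ → ℝ} (G : Good k σ y e R γ) (hR : 3 < R) (hg : LeftSol k σ y g)
    (hh : 2*e*(R-3)*h = pN k σ y e γ) (hr : 0 < r) (hr1 : r < 1) 
    (hΦ : ∀ s, 0 < s → s < √r → Phi3 k σ s y e γ (2*e*(R-3)/pN k σ y e γ) < 0)
    (h0 : ((g (-r) - (e-γ*(-r)))/(-r)^2)*(2*e*(R-3)/pN k σ y e γ+√r) < 1) {ζ : ℝ → ℝ} (hζ : ContinuousAt ζ 0) :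
    ∀ᶠ x in 𝓝[<] 0, g x < e-γ*x+h*x^2+x^3*ζ x := by
  have he := G.e0; have hs1 := G.hs1; have hs0 := G.hs0; have hγ := G.F1
  have hN : 0 < pN k σ y e γ := by nlinarith [G.F2, sq_nonneg γ]
  set ν := 2*e*(R-3)/pN k σ y e γ with hνd
  have hν : 0 < ν := by apply div_pos _ hN; apply mul_pos <;> linarith
  have hNν : pN k σ y e γ*ν = 2*e*(R-3) := by rw [hνd]; field_simp
  have hhν : h*ν = 1 := by rw [hνd, ← hh]; rw [← hh] at hN; field_simp [hN.ne']; apply div_self; nlinarith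
  have hh0 : 0 < h := by by_contra hc; nlinarith
  have key : ∀ x ∈ Ico (-r) 0, 0 < 1 - ((g x - (e-γ*x))/x^2)*(ν+√(-x)) := by
    have hmem : ∀ x ∈ Ico (-r) 0, x ∈ Ioo (-1) 0 := fun x hx => ⟨by linarith [hx.1], hx.2⟩
    have hd : ∀ x ∈ Ico (-r) 0, HasDerivAt (fun x => 1 - ((g x - (e-γ*x))/x^2)*(ν+√(-x))) _ x := fun x hx => 
      ((lvl2 G hg (hmem x hx)).mul (((hasDerivAt_neg x).sqrt (by have := hx.2; linarith)).const_add ν)).const_sub 1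
    refine barrier (fun x hx => (hd x hx).hasDerivWithinAt) ?_ ?_
    · simp only [neg_neg]; linarith
    · intro x hx _ hc
      have hx1 := hmem x ⟨hx.1.le, hx.2⟩
      have hp := pp_pos G hx1
      set s := √(-x) with hs
      have hs0 : 0 < s := Real.sqrt_pos.2 (by linarith [hx.2])
      have hxs : x = -s^2 := by rw [hs, Real.sq_sqrt (by linarith [hx.2])]; ring
      have hsr : s < √r := Real.sqrt_lt_sqrt (by linarith [hx.2]) (by linarith [hx.1])
      have hΦ' := hΦ s hs0 hsr
      set z := (g x - (e-γ*x))/x^2 with hz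
      have hgz : g x = e - γ*x + x^2*z := by rw [hz]; field_simp [hx.2.ne]; ring
      have hz1 : z*(ν+s) = 1 := by linarith
      have hzp : 0 < z := by by_contra hc; nlinarith
      have hge : e < g x := by rw [hgz, hxs]; have := mul_pos hγ (pow_pos hs0 2); have := mul_pos (pow_pos hs0 4) hzp; nlinarith
      unfold Phi3 at hΦ'
      have := n3_alg (k := k) (σ := σ) (y := y) (R := R) (γ := γ) (B := cB k σ y x) (A := cA k σ x) (m1 := m1c k σ y e γ x) (N := pN k σ y e γ) (T := r3c k σ y e γ 0 + x*r4c k σ e γ 0) (p := (1+x)*(1+σ*x)) hs0 (by linarith) hp he hge hz1 (by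
        rw [hxs]; convert hΦ' using 1; ring) (by
        rw [hNν, hgz, hxs]
        have rb := G.rb
        unfold cB cA m1c pb1
        push_cast
        linear_combination rb)
      convert this using 1
      simp only [hxs]
      push_cast
      ring
  have hc : 0 < 1/(ν*(ν+1)) := by positivity
  have ht : Tendsto (fun x => √(-x)*ζ x) (𝓝[<] 0) (𝓝 0) := by
    have := sqrt_tend.mul (hζ.tendsto.mono_left (nhdsWithin_le_nhds (s := Iio 0)))
    simpa using this
  filter_upwards [ht.eventually (gt_mem_nhds hc), Ioo_mem_nhdsLT (show -r < 0 by linarith)] with x hx hxr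
  have h1 := key x ⟨hxr.1.le, hxr.2⟩
  set s := √(-x) with hs
  have hs0 : 0 < s := Real.sqrt_pos.2 (by linarith [hxr.2])
  have hxs : x = -s^2 := by rw [hs, Real.sq_sqrt (by linarith [hxr.2])]; ring
  have hs2 : s < 1 := by rw [hs, Real.sqrt_lt' (by norm_num)]; linarith [hxr.1]
  set z := (g x - (e-γ*x))/x^2 with hz
  have hgz : g x = e - γ*x + x^2*z := by rw [hz]; field_simp [hxr.2.ne]; ring
  rw [lt_div_iff₀ (by positivity)] at hx
  have hx0 : 0 < x^2 := by have := hxr.2.ne; positivity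
  have e1 : g x - (e-γ*x+h*x^2+x^3*ζ x) = x^2*(z - h + s^2*ζ x) := by rw [hgz, hxs]; ring
  have e2 : z - h + s^2*ζ x < 0 := by
    have a1 : (z - h + s^2*ζ x)*(ν+s)*ν < 0 := by
      have b1 : (z - h + s^2*ζ x)*(ν+s)*ν = z*(ν+s)*ν - (h*ν)*(ν+s) + s*((s*ζ x)*(ν*(ν+s))) := by ring
      rw [b1, hhν]
      have b2 : (s*ζ x)*(ν*(ν+s)) < 1 := by
        rcases le_or_gt (s*ζ x) 0 with hl | hl
        · have := mul_pos hν (by linarith : 0 < ν + s); nlinarith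
        · have : ν*(ν+s) < ν*(ν+1) := by nlinarith
          nlinarith
      have b3 : z*(ν+s)*ν < 1*ν := mul_lt_mul_of_pos_right (by linarith) hν
      have b4 := mul_lt_mul_of_pos_left b2 hs0
      linarith
    by_contra hcon
    have := mul_nonneg (mul_nonneg (not_lt.1 hcon) (by linarith : 0 ≤ ν+s)) hν.le
    linarith
  have := mul_neg_of_pos_of_neg hx0 e2
  linarith

noncomputable def m3c (k σ y e γ h x : ℝ) : ℝ :=
  (pb1 k σ y - 2*(σ-(1-σ)/k)*x) - 2*((-2*γ+(1+σ)*e)+(2*h-(1+σ)*γ+(1-σ)/k*e)*x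
      +((1+σ)*h-(1-σ)/k*γ)*x^2+(1-σ)/k*h*x^3) - 2*((1+x)*(1+σ*x))*(-γ+2*h*x)
      - 6*((-γ+(1+σ)*e)+(h-(1+σ)*γ+σ*e)*x+((1+σ)*h-σ*γ)*x^2+σ*h*x^3)

/-- contact expression near `R = 4` (`q = x M`) -/
noncomputable def Phi4 (k σ x q y e γ h : ℝ) : ℝ :=
  r3c k σ y e γ h + x*(r4c k σ e γ h + r5c k σ γ h*x + r6c k σ h*x^2) + q*m3c k σ y e γ h x
    - q^2*x*(cA k σ x + 6*((1+x)*(1+σ*x)))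

lemma r3c_pos {k σ y e R γ h : ℝ} (G : Good k σ y e R γ) (hR : 3 < R) (hh : 2*e*(R-3)*h = pN k σ y e γ) :
    0 < r3c k σ y e γ h := by
  have he := G.e0; have hs1 := G.hs1; have hs0 := G.hs0; have hγ := G.F1; have hR4 := G.R4
  have hN : 0 < pN k σ y e γ := by nlinarith [G.F2, sq_nonneg γ]
  have hW : 0 < pW k σ y e γ := by
    by_contra hc
    have h1 := G.F3
    have : 0 < 4*e^2*σ*γ := by positivity
    nlinarith
  have hh0 : 0 < h := by
    by_contra hc
    have : 0 < 2*e*(R-3) := by apply mul_pos <;> linarith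
    nlinarith
  have h2 : pN k σ y e γ ≤ 2*e*h := by
    rw [← hh]; have := mul_pos he hh0; nlinarith
  have F4 := G.F4
  have h3 : e*(3*(1+σ)*γ+2*((1-σ)/k)) < e*(6*h) := by linarith
  have h4 := lt_of_mul_lt_mul_left h3 he.le
  have h5 := mul_lt_mul_of_pos_left h4 hγ
  have h6 := mul_pos hh0 hW
  have hκ : 0 < (1-σ)/k := div_pos (by linarith) (by linarith [G.hk])
  unfold r3c
  have h7 : 0 < γ*(σ*(1+e)) := by positivity
  have h8 : 0 < γ*((1-σ)/k*e) := by positivity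
  linarith

lemma n4_alg {k σ y e R γ g p E0 A B b b' m3 r3 x M z h Mq : ℝ} (hx : x < 0) (hp : 0 < p) (hg : 0 < g) (hz : z = M)
    (hΦ : 2*e*(4-R)*M < Mq)
    (hMq : Mq = r3 + x*E0 + (x*M)*m3 - (x*M)^2*x*(A+6*p))
    (hB : B - A*(b+g) - 2*x*p*b' - 2*(3:ℕ)*p*g = 2*e*(R-4) + x*m3 - (A+6*p)*x^3*z) :
    0 < -(((r3 + x*E0)/(2*p*g) + ((B - A*(b+g) - 2*x*p*b' - 2*(3:ℕ)*p*g)/(2*p*g))*z)/x) := by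
  rw [hB, hz]
  have e1 : -(((r3 + x*E0)/(2*p*g) + ((2*e*(R-4) + x*m3 - (A+6*p)*x^3*M)/(2*p*g))*M)/x)
     = (Mq - 2*e*(4-R)*M)/(2*p*g*(-x)) := by
    rw [hMq]
    field_simp
    ring
  rw [e1]
  apply div_pos (by linarith)
  have : 0 < -x := by linarith
  positivity

set_option maxHeartbeats 800000 in
lemma n4_point {k σ y e R γ r h M : ℝ} {g : ℝ → ℝ} (G : Good k σ y e R γ) (hR : 3 < R) (hR4 : R < 4) (hg : LeftSol k σ y g)
    (hh : 2*e*(R-3)*h = pN k σ y e γ) (hr : 0 < r) (hr1 : r < 1) 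
    (hΦ : ∀ x, -r < x → x < 0 → 2*e*(4-R)*M < Phi4 k σ x (x*M) y e γ h)
    (hM : 2*e*(4-R)*M < r3c k σ y e γ h)
    (h0 : ((g (-r) - (e-γ*(-r)+h*(-r)^2))/(-r)^3) < M) {ζ : ℝ → ℝ} (hζ : ContinuousAt ζ 0) (hζ0 : 2*e*(4-R)*ζ 0 = r3c k σ y e γ h) :
    ∀ᶠ x in 𝓝[<] 0, e-γ*x+h*x^2+x^3*ζ x < g x := by
  have he := G.e0; have hs1 := G.hs1; have hs0 := G.hs0; have hγ := G.F1
  have key : ∀ x ∈ Ico (-r) 0, 0 < M - ((g x - (e-γ*x+h*x^2))/x^3) := by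
    have hmem : ∀ x ∈ Ico (-r) 0, x ∈ Ioo (-1) 0 := fun x hx => ⟨by linarith [hx.1], hx.2⟩
    have hd : ∀ x ∈ Ico (-r) 0, HasDerivAt (fun x => M - ((g x - (e-γ*x+h*x^2))/x^3)) _ x := fun x hx => 
      (lvl3 G hg hh (hmem x hx)).const_sub M
    refine barrier (fun x hx => (hd x hx).hasDerivWithinAt) (by linarith) ?_
    intro x hx _ hc
    have hx1 := hmem x ⟨hx.1.le, hx.2⟩
    have hp := pp_pos G hx1
    have hΦ' := hΦ x hx.1 hx.2
    have hlo := hg.lo x hx1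
    set z := (g x - (e-γ*x+h*x^2))/x^3 with hz
    have hgz : g x = e - γ*x + h*x^2 + x^3*z := by rw [hz]; field_simp [hx.2.ne]; ring
    exact n4_alg (k := k) (σ := σ) (y := y) (γ := γ) (h := h) (M := M) (m3 := m3c k σ y e γ h x) hx.2 hp (by linarith) (by linarith) hΦ' (by unfold Phi4; ring) (by
      rw [hgz]
      have rb := G.rb
      unfold cB cA m3c pb1
      push_cast
      linear_combination rb)
  have hζM : M < ζ 0 := by
    have : 0 < 2*e*(4-R) := by apply mul_pos <;> linarith
    rw [← hζ0] at hM
    exact lt_of_mul_lt_mul_left hM this.le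
  filter_upwards [(hζ.tendsto.mono_left (nhdsWithin_le_nhds (s := Iio 0))).eventually (lt_mem_nhds hζM), Ioo_mem_nhdsLT (show -r < 0 by linarith)] with x hx hxr
  have h1 := key x ⟨hxr.1.le, hxr.2⟩
  set z := (g x - (e-γ*x+h*x^2))/x^3 with hz
  have hgz : g x = e - γ*x + h*x^2 + x^3*z := by rw [hz]; field_simp [hxr.2.ne]; ring
  rw [hgz]
  have hx0 : x^3 < 0 := by have := hxr.2; exact Odd.pow_neg (by decide) this
  have := mul_lt_mul_of_neg_left (by linarith : z < ζ x) hx0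
  linarith


lemma pN_tend {k σ : ℝ} {l : Filter ℝ} {a b c : ℝ} {f1 f2 f3 : ℝ → ℝ} (h1 : Tendsto f1 l (𝓝 a)) (h2 : Tendsto f2 l (𝓝 b)) (h3 : Tendsto f3 l (𝓝 c)) :
    Tendsto (fun y => pN k σ (f1 y) (f2 y) (f3 y)) l (𝓝 (pN k σ a b c)) := by
  have hc : Continuous (fun w : ℝ × ℝ × ℝ => pN k σ w.1 w.2.1 w.2.2) := by unfold pN pb1 pQ; fun_prop
  have h4 : Tendsto (fun w : ℝ × ℝ × ℝ => pN k σ w.1 w.2.1 w.2.2) (𝓝 (a,b,c)) (𝓝 (pN k σ a b c)) := hc.tendsto (a,b,c)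
  have h5 : Tendsto (fun y => (f1 y, f2 y, f3 y)) l (𝓝 (a,b,c)) := h1.prodMk_nhds (h2.prodMk_nhds h3)
  have h6 := h4.comp h5
  simp only [Function.comp_def] at h6
  exact h6

section near
variable {k σ y3 y4 : ℝ} {e R γ : ℝ → ℝ} {Gf : ℝ → ℝ → ℝ}

set_option maxHeartbeats 800000 in
lemma near3 (h34 : y3 < y4) (he : ContinuousOn e (Icc y3 y4)) (hR : ContinuousOn R (Icc y3 y4)) (hγ : ContinuousOn γ (Icc y3 y4))
    (hR3 : R y3 = 3) (hb : ∀ y ∈ Ioo y3 y4, 3 < R y ∧ R y < 4) (hG : ∀ y ∈ Icc y3 y4, Good k σ y (e y) (R y) (γ y))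
    (hGc : ∀ x ∈ Ioo (-1) 0, ContinuousOn (fun p => Gf p x) (Icc y3 y4))
    (hGl : ∀ y ∈ Icc y3 y4, LeftSol k σ y (Gf y)) :
    ∀ᶠ y in 𝓝[>] y3, ∀ (h : ℝ) (ζ : ℝ → ℝ), 2*e y*(R y-3)*h = pN k σ y (e y) (γ y) → ContinuousAt ζ 0 →
      ∀ᶠ x in 𝓝[<] 0, Gf y x < e y-γ y*x+h*x^2+x^3*ζ x := by
  have hm3 : y3 ∈ Icc y3 y4 := ⟨le_rfl, h34.le⟩
  have hle : 𝓝[>] y3 ≤ 𝓝[Icc y3 y4] y3 := by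
    rw [← nhdsWithin_Ioc_eq_nhdsGT h34]
    exact nhdsWithin_mono _ Ioc_subset_Icc_self
  have hid : Tendsto (fun y : ℝ => y) (𝓝[>] y3) (𝓝 y3) := tendsto_id.mono_left nhdsWithin_le_nhds
  have te := (he y3 hm3).tendsto.mono_left hle
  have tR := (hR y3 hm3).tendsto.mono_left hle
  have tγ := (hγ y3 hm3).tendsto.mono_left hle
  have g3 := hG y3 hm3
  have hN : 0 < pN k σ y3 (e y3) (γ y3) := by nlinarith [g3.F2, sq_nonneg (γ y3)]
  have tN : Tendsto (fun y => pN k σ y (e y) (γ y)) (𝓝[>] y3) (𝓝 (pN k σ y3 (e y3) (γ y3))) := by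
    exact pN_tend hid te tγ
  have tν : Tendsto (fun y => 2*e y*(R y-3)/pN k σ y (e y) (γ y)) (𝓝[>] y3) (𝓝 0) := by
    have := tdiv ((te.const_mul 2).mul (tR.sub_const 3)) tN hN.ne'
    rw [hR3] at this; simpa using this
  have hΦc : Continuous (fun w : ℝ × ℝ × ℝ × ℝ × ℝ => Phi3 k σ w.1 w.2.1 w.2.2.1 w.2.2.2.1 w.2.2.2.2) := by
    unfold Phi3 pN r3c r4c m1c cA pW pb1 pQ; fun_prop
  have hΦ0 : Phi3 k σ 0 y3 (e y3) (γ y3) 0 < 0 := by unfold Phi3; simp; exact g3.e0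
  have hev := (hΦc.tendsto (0, y3, e y3, γ y3, 0)).eventually (gt_mem_nhds hΦ0)
  rw [nhds_prod_eq, Filter.eventually_prod_iff] at hev
  obtain ⟨pa, ha, pb, hpb, hab⟩ := hev
  obtain ⟨δ, hδ, hδa⟩ := Metric.eventually_nhds_iff.1 ha
  -- choice of r
  have hch := chain2a g3 (hGl y3 hm3)
  have hδ2 : -(min (δ^2) 1) < 0 := by have : 0 < min (δ^2) 1 := lt_min (by positivity) one_pos; linarith
  obtain ⟨x, hx1, hx2⟩ := ((hch.eventually (gt_mem_nhds (show (0:ℝ) < 1 by norm_num))).and (Ioo_mem_nhdsLT hδ2)).exists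
  obtain ⟨r, rfl⟩ : ∃ r, x = -r := ⟨-x, by ring⟩
  have hr : 0 < r := by linarith [hx2.2]
  have hr1 : r < 1 := by linarith [hx2.1, min_le_right (δ^2) 1]
  have hrδ : √r < δ := by rw [Real.sqrt_lt' hδ]; linarith [hx2.1, min_le_left (δ^2) 1]
  have tG := (hGc (-r) ⟨by linarith, by linarith⟩ y3 hm3).tendsto.mono_left hle
  have tI : Tendsto (fun y => ((Gf y (-r) - (e y-γ y*(-r)))/(-r)^2)*(2*e y*(R y-3)/pN k σ y (e y) (γ y)+√r)) (𝓝[>] y3)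
      (𝓝 (((Gf y3 (-r) - (e y3-γ y3*(-r)))/(-r)^2)*(0+√r))) :=
    ((tG.sub (te.sub (tγ.mul_const _))).div_const _).mul (tν.add_const _)
  have hI : ((Gf y3 (-r) - (e y3-γ y3*(-r)))/(-r)^2)*(0+√r) < 1 := by
    simp only [neg_neg] at hx1; rw [zero_add, mul_comm]; exact hx1
  filter_upwards [tI.eventually (gt_mem_nhds hI), (hid.prodMk_nhds (te.prodMk_nhds (tγ.prodMk_nhds tν))).eventually hpb, Ioo_mem_nhdsGT h34] with y h1 h2 hy h ζ hh hζ
  refine n3_point (hG y ⟨hy.1.le, hy.2.le⟩) (hb y hy).1 (hGl y ⟨hy.1.le, hy.2.le⟩) hh hr hr1 ?_ h1 hζ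
  intro s hs hsr
  have := hab (hδa (show dist s 0 < δ by rw [Real.dist_eq, sub_zero, abs_of_pos hs]; linarith)) h2
  exact this

set_option maxHeartbeats 800000 in
lemma near4 (h34 : y3 < y4) (he : ContinuousOn e (Icc y3 y4)) (hR : ContinuousOn R (Icc y3 y4)) (hγ : ContinuousOn γ (Icc y3 y4))
    (hR4 : R y4 = 4) (hb : ∀ y ∈ Ioo y3 y4, 3 < R y ∧ R y < 4) (hG : ∀ y ∈ Icc y3 y4, Good k σ y (e y) (R y) (γ y))
    (hGc : ∀ x ∈ Ioo (-1) 0, ContinuousOn (fun p => Gf p x) (Icc y3 y4))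
    (hGl : ∀ y ∈ Icc y3 y4, LeftSol k σ y (Gf y)) :
    ∀ᶠ y in 𝓝[<] y4, ∀ (h : ℝ) (ζ : ℝ → ℝ), 2*e y*(R y-3)*h = pN k σ y (e y) (γ y) → ContinuousAt ζ 0 →
      2*e y*(4-R y)*ζ 0 = r3c k σ y (e y) (γ y) h → 
      ∀ᶠ x in 𝓝[<] 0, e y-γ y*x+h*x^2+x^3*ζ x < Gf y x := by
  have hm4 : y4 ∈ Icc y3 y4 := ⟨h34.le, le_rfl⟩
  have hle : 𝓝[<] y4 ≤ 𝓝[Icc y3 y4] y4 := by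
    rw [← nhdsWithin_Ico_eq_nhdsLT h34]
    exact nhdsWithin_mono _ Ico_subset_Icc_self
  have hid : Tendsto (fun y : ℝ => y) (𝓝[<] y4) (𝓝 y4) := tendsto_id.mono_left nhdsWithin_le_nhds
  have te := (he y4 hm4).tendsto.mono_left hle
  have tR := (hR y4 hm4).tendsto.mono_left hle
  have tγ := (hγ y4 hm4).tendsto.mono_left hle
  have g4 := hG y4 hm4
  have he0 := g4.e0
  set h4 := pN k σ y4 (e y4) (γ y4)/(2*e y4) with hh4d
  have hh4 : 2*e y4*(R y4-3)*h4 = pN k σ y4 (e y4) (γ y4) := by rw [hR4, hh4d]; field_simp; ring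
  have tN : Tendsto (fun y => pN k σ y (e y) (γ y)) (𝓝[<] y4) (𝓝 (pN k σ y4 (e y4) (γ y4))) := by
    exact pN_tend hid te tγ
  have th : Tendsto (fun y => pN k σ y (e y) (γ y)/(2*e y*(R y-3))) (𝓝[<] y4) (𝓝 h4) := by
    have := tdiv tN ((te.const_mul 2).mul (tR.sub_const 3)) (by rw [hR4]; norm_num; exact he0.ne')
    rw [hR4] at this
    convert this using 2
    rw [hh4d]; norm_num
  have hr3 := r3c_pos g4 (by rw [hR4]; norm_num) hh4
  set c := r3c k σ y4 (e y4) (γ y4) h4 with hc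
  have hΦc : Continuous (fun w : (ℝ × ℝ) × ℝ × ℝ × ℝ × ℝ => Phi4 k σ w.1.1 w.1.2 w.2.1 w.2.2.1 w.2.2.2.1 w.2.2.2.2) := by
    unfold Phi4 r3c r4c r5c r6c m3c cA pW pb1; fun_prop
  have hΦ0 : c/2 < Phi4 k σ 0 0 y4 (e y4) (γ y4) h4 := by unfold Phi4; simp; linarith
  have hev := (hΦc.tendsto ((0,0), y4, e y4, γ y4, h4)).eventually (lt_mem_nhds hΦ0)
  rw [nhds_prod_eq, Filter.eventually_prod_iff] at hev
  obtain ⟨pa, ha, pb, hpb, hab⟩ := hev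
  obtain ⟨δ, hδ, hδa⟩ := Metric.eventually_nhds_iff.1 ha
  have hch := chain3a g4 (hGl y4 hm4) (by rw [hR4]) hh4
  have hδ2 : -(min (min (δ^2) δ) 1) < 0 := by
    have : 0 < min (min (δ^2) δ) 1 := lt_min (lt_min (by positivity) hδ) one_pos
    linarith
  obtain ⟨x, hx1, hx2⟩ := ((hch.eventually (gt_mem_nhds (show (0:ℝ) < 1 by norm_num))).and (Ioo_mem_nhdsLT hδ2)).exists
  obtain ⟨r, rfl⟩ : ∃ r, x = -r := ⟨-x, by ring⟩
  have hr : 0 < r := by linarith [hx2.2]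
  have hr1 : r < 1 := by linarith [hx2.1, min_le_right (min (δ^2) δ) 1]
  have hm := (min_le_left (min (δ^2) δ) 1)
  have hrδ : √r < δ := by rw [Real.sqrt_lt' hδ]; linarith [hx2.1, min_le_left (δ^2) δ]
  have hrδ2 : r < δ := by linarith [hx2.1, min_le_right (δ^2) δ]
  have hsr : 0 < √r := Real.sqrt_pos.2 hr
  have hsr2 : √r*√r = r := Real.mul_self_sqrt hr.le
  simp only [neg_neg] at hx1
  have tG := (hGc (-r) ⟨by linarith, by linarith⟩ y4 hm4).tendsto.mono_left hle
  have tI : Tendsto (fun y => ((Gf y (-r) - (e y-γ y*(-r)+pN k σ y (e y) (γ y)/(2*e y*(R y-3))*(-r)^2))/(-r)^3)) (𝓝[<] y4)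
      (𝓝 (((Gf y4 (-r) - (e y4-γ y4*(-r)+h4*(-r)^2))/(-r)^3))) :=
    ((tG.sub ((te.sub (tγ.mul_const _)).add (th.mul_const _))).div_const _)
  have hI : ((Gf y4 (-r) - (e y4-γ y4*(-r)+h4*(-r)^2))/(-r)^3) < 1/√r := by
    rw [lt_div_iff₀ hsr, mul_comm]; exact hx1
  have tM : Tendsto (fun y => 2*e y*(4-R y)*(1/√r)) (𝓝[<] y4) (𝓝 (2*e y4*(4-R y4)*(1/√r))) :=
    ((te.const_mul 2).mul (tR.const_sub 4)).mul_const _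
  have hM : 2*e y4*(4-R y4)*(1/√r) < c/2 := by rw [hR4]; norm_num; linarith
  filter_upwards [tI.eventually (gt_mem_nhds hI), (hid.prodMk_nhds (te.prodMk_nhds (tγ.prodMk_nhds th))).eventually hpb, Ioo_mem_nhdsLT h34,
     tM.eventually (gt_mem_nhds hM)] with y h1 h2 hy h3 h ζ hh hζ hζ0
  have gy := hG y ⟨hy.1.le, hy.2.le⟩
  have hey := gy.e0
  have hRy := (hb y hy).1
  have hheq : h = pN k σ y (e y) (γ y)/(2*e y*(R y-3)) := by
    have : R y - 3 ≠ 0 := by linarith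
    rw [← hh]; field_simp
  have hall : ∀ x q, |x| < δ → |q| < δ → c/2 < Phi4 k σ x q y (e y) (γ y) h := by
    intro x q hx hq
    rw [hheq]
    exact hab (hδa (show dist (x,q) (0,0) < δ by rw [Prod.dist_eq, Real.dist_eq, Real.dist_eq, sub_zero, sub_zero]; exact max_lt hx hq)) h2
  refine n4_point gy hRy (hb y hy).2 (hGl y ⟨hy.1.le, hy.2.le⟩) hh hr hr1 (M := 1/√r) ?_ ?_ ?_ hζ hζ0
  · intro x hx hx'
    refine h3.trans (hall x _ (by rw [abs_of_neg hx']; linarith) ?_)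
    rw [abs_mul, abs_of_neg hx', abs_of_pos (by positivity), mul_one_div, div_lt_iff₀ hsr]
    have := mul_lt_mul_of_pos_right hrδ hsr
    linarith
  · have := hall 0 0 (by simpa using hδ) (by simpa using hδ)
    unfold Phi4 at this
    simp only [zero_mul, add_zero, ne_eq, OfNat.ofNat_ne_zero, not_false_eq_true, zero_pow, sub_zero] at this
    linarith
  · rw [hheq]; exact h1
end near


lemma IsSol.congr {k σ y : ℝ} {g f : ℝ → ℝ} {s : Set ℝ} (hs : IsOpen s) (h : IsSol k σ y g s) (hfg : ∀ x ∈ s, f x = g x) : IsSol k σ y f s := by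
  refine ⟨h.1.congr hfg, fun x hx => ?_⟩
  obtain ⟨h1, g', h2, h3⟩ := h.2 x hx
  rw [hfg x hx]
  exact ⟨h1, g', h2.congr_of_eventuallyEq (Filter.eventuallyEq_of_mem (hs.mem_nhds hx) hfg), h3⟩

lemma IsSol.union {k σ y : ℝ} {g : ℝ → ℝ} {s t : Set ℝ} (hs : IsOpen s) (ht : IsOpen t) (h1 : IsSol k σ y g s) (h2 : IsSol k σ y g t) :
    IsSol k σ y g (s ∪ t) := by
  refine ⟨h1.1.union_of_isOpen h2.1 hs ht, fun x hx => ?_⟩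
  rcases hx with hx | hx
  · exact h1.2 x hx
  · exact h2.2 x hx

lemma sol_uniq {k σ y a b : ℝ} {g f : ℝ → ℝ} (hP : ∀ x ∈ Ioo a b, PP σ x ≠ 0) (hg : IsSol k σ y g (Ioo a b)) (hf : IsSol k σ y f (Ioo a b))
    {t0 : ℝ} (ht : t0 ∈ Ioo a b) (h0 : g t0 = f t0) : ∀ x ∈ Ioo a b, g x = f x :=
  ode_uniq (F := fun z : ℝ × ℝ => QQ k σ y z.1 z.2/(2*PP σ z.1*z.2)) (fun t ht => hg.deriv_eq ht (hP t ht)) (fun t ht => hf.deriv_eq ht (hP t ht))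
    (fun t ht => (field_smooth' (hP t ht) (hg.2 t ht).1.ne').of_le (by exact_mod_cast le_top)) ht h0

/-- constant sign of the difference -/
lemma sol_sign {k σ y r x1 : ℝ} {g f : ℝ → ℝ} (h0 : 0 < σ) (h1 : σ < 1) (hr : r < 1) (hg : IsSol k σ y g (Ioo (-r) 0)) (hf : IsSol k σ y f (Ioo (-r) 0))
    (hx1 : x1 ∈ Ioo (-r) 0) (hev : ∀ᶠ x in 𝓝[<] 0, g x < f x) : g x1 < f x1 := by
  by_contra hc
  push Not at hc
  obtain ⟨x2, h2, h2'⟩ := (hev.and (Ioo_mem_nhdsLT hx1.2)).exists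
  have hsub : Icc x1 x2 ⊆ Ioo (-r) 0 := fun x hx => ⟨by linarith [hx.1, hx1.1], by linarith [hx.2, h2'.2]⟩
  have hcont : ContinuousOn (fun x => f x - g x) (Icc x1 x2) := (hf.1.continuousOn.sub hg.1.continuousOn).mono hsub
  obtain ⟨x3, hx3, he⟩ := intermediate_value_Icc h2'.1.le hcont (show (0:ℝ) ∈ Icc (f x1 - g x1) (f x2 - g x2) from ⟨by linarith, by linarith⟩)
  have := sol_uniq (fun x hx => (PP_neg h0 h1 (by linarith [hx.1]) hx.2).ne) hg hf (hsub hx3) (by simp only at he; linarith) x2 (hsub ⟨h2'.1.le, le_rfl⟩)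
  linarith

structure Shot (k σ y e R γ h r ε : ℝ) (g ζ : ℝ → ℝ) : Prop where
  good : Good k σ y e R γ
  R3 : 3 < R
  R4 : R < 4
  hr : 0 < r
  hr1 : r < 1
  hε : 0 < ε
  hh : 2*e*(R-3)*h = pN k σ y e γ
  sol : IsSol k σ y g (Ioo (-1-ε) r)
  g1 : g (-1) = 1-k*y/(k+1)
  bd : ∀ x ∈ Ico (-1) 0, (1-σ)/32 < g x ∧ g x < 1
  ζc : ContinuousAt ζ 0
  ζ0 : 2*e*(4-R)*ζ 0 = r3c k σ y e γ h
  exp : ∀ x ∈ Ioo (-r) r, g x = e-γ*x+h*x^2+x^3*ζ x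

set_option maxHeartbeats 800000 in
theorem shoot {k σ : ℝ} (hS : Sel k σ) : ∃ y e R γ h r ε g ζ, Shot k σ y e R γ h r ε g ζ := by
  obtain ⟨y3, y4, e, R, γ, h34, he, hR, hγ, hR3, hR4, hb, hG⟩ := hS
  have G3 := hG y3 ⟨le_rfl, h34.le⟩
  have G4 := hG y4 ⟨h34.le, le_rfl⟩
  have hs0 := G3.hs0; have hs1 := G3.hs1
  obtain ⟨ε, hε, Gf, hGc, hGs⟩ := left_G G3.hk hs0 hs1 G3.y0 h34.le G4.y1
  have hGl : ∀ y ∈ Icc y3 y4, LeftSol k σ y (Gf y) := fun y hy => by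
    obtain ⟨a1, a2, a3⟩ := hGs y hy
    exact ⟨fun x hx => a1.deriv_eq ⟨by linarith [hx.1], hx.2⟩ (PP_neg hs0 hs1 hx.1 hx.2).ne,
      fun x hx => (a3 x ⟨hx.1.le, hx.2⟩).1, fun x hx => (a3 x ⟨hx.1.le, hx.2⟩).2⟩
  have n3 := near3 h34 he hR hγ hR3 hb hG hGc hGl
  have n4 := near4 h34 he hR hγ hR4 hb hG hGc hGl
  obtain ⟨ya, hna, hya⟩ := (n3.and (Ioo_mem_nhdsGT (show y3 < (y3+y4)/2 by linarith))).exists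
  obtain ⟨yb, hnb, hyb⟩ := (n4.and (Ioo_mem_nhdsLT (show (y3+y4)/2 < y4 by linarith))).exists
  have hab : ya ≤ yb := by linarith [hya.2, hyb.1]
  have hsub : Icc ya yb ⊆ Ioo y3 y4 := fun y hy => ⟨by linarith [hya.1, hy.1], by linarith [hyb.2, hy.2]⟩
  have hsub' : Icc ya yb ⊆ Icc y3 y4 := hsub.trans Ioo_subset_Icc_self
  obtain ⟨r, hr, hr1, F, hFc, hF⟩ := sonic_local hab (he.mono hsub') (hR.mono hsub') (hγ.mono hsub') (fun y hy => hb y (hsub hy)) (fun y hy => hG y (hsub' hy))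
  have hx1 : -(r/2) ∈ Ioo (-r) 0 := ⟨by linarith, by linarith⟩
  have hma : ya ∈ Icc ya yb := ⟨le_rfl, hab⟩
  have hmb : yb ∈ Icc ya yb := ⟨hab, le_rfl⟩
  have hFs : ∀ y ∈ Icc ya yb, IsSol k σ y (F y) (Ioo (-r) 0) := fun y hy => (hF y hy).1.mono (Ioo_subset_Ioo le_rfl hr.le)
  have hGs' : ∀ y ∈ Icc ya yb, IsSol k σ y (Gf y) (Ioo (-r) 0) := fun y hy => (hGs y (hsub' hy)).1.mono (Ioo_subset_Ioo (by linarith) le_rfl)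
  have ha : Gf ya (-(r/2)) < F ya (-(r/2)) := by
    obtain ⟨h, ζ, b1, b2, b3, b4⟩ := (hF ya hma).2
    apply sol_sign hs0 hs1 hr1 (hGs' ya hma) (hFs ya hma) hx1
    filter_upwards [hna h ζ b1 (b2.continuousAt (Ioo_mem_nhds (by linarith) hr))] with x hx
    rw [b4 x]; exact hx
  have hb' : F yb (-(r/2)) < Gf yb (-(r/2)) := by
    obtain ⟨h, ζ, b1, b2, b3, b4⟩ := (hF yb hmb).2
    apply sol_sign hs0 hs1 hr1 (hFs yb hmb) (hGs' yb hmb) hx1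
    filter_upwards [hnb h ζ b1 (b2.continuousAt (Ioo_mem_nhds (by linarith) hr)) b3] with x hx
    rw [b4 x]; exact hx
  have hcont : ContinuousOn (fun p => Gf p (-(r/2)) - F p (-(r/2))) (Icc ya yb) :=
    ((hGc _ ⟨by linarith, by linarith⟩).mono hsub').sub (hFc _ ⟨by linarith, by linarith⟩)
  obtain ⟨y, hy, hye⟩ := intermediate_value_Icc hab hcont (show (0:ℝ) ∈ Icc _ _ from ⟨(sub_neg.2 ha).le, (sub_pos.2 hb').le⟩)
  have heq := sol_uniq (fun x hx => (PP_neg hs0 hs1 (by linarith [hx.1]) hx.2).ne) (hGs' y hy) (hFs y hy) hx1 (by simp only at hye; linarith)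
  obtain ⟨c1, h, ζ, b1, b2, b3, b4⟩ := hF y hy
  obtain ⟨a1, a2, a3⟩ := hGs y (hsub' hy)
  set g : ℝ → ℝ := fun x => if x < 0 then Gf y x else F y x with hg
  have gl : ∀ x, x < 0 → g x = Gf y x := fun x hx => by simp only [hg]; rw [if_pos hx]
  have gr : ∀ x ∈ Ioo (-r) r, g x = F y x := fun x hx => by
    by_cases hx0 : x < 0
    · rw [gl x hx0]; exact heq x ⟨hx.1, hx0⟩
    · simp only [hg]; rw [if_neg hx0]
  refine ⟨y, e y, R y, γ y, h, r, ε, g, ζ, hG y (hsub' hy), (hb y (hsub hy)).1, (hb y (hsub hy)).2, hr, hr1, hε, b1, ?_, ?_, ?_, 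
    b2.continuousAt (Ioo_mem_nhds (by linarith) hr), b3, fun x hx => by rw [gr x hx, b4 x]⟩
  · have hsu : Ioo (-1-ε) r ⊆ Ioo (-1-ε) 0 ∪ Ioo (-r) r := fun x hx => by
      rcases lt_or_ge x 0 with h0 | h0
      · exact Or.inl ⟨hx.1, h0⟩
      · exact Or.inr ⟨by linarith, hx.2⟩
    exact ((a1.congr isOpen_Ioo (fun x hx => gl x hx.2)).union isOpen_Ioo isOpen_Ioo (c1.congr isOpen_Ioo gr)).mono hsu
  · rw [gl _ (by norm_num)]; exact a2
  · intro x hx; rw [gl x hx.2]; exact a3 x hx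


/-- facts on `P₂` -/
lemma P2_facts {k σ y e R γ h : ℝ} (G : Good k σ y e R γ) (hR : 3 < R) (hh : 2*e*(R-3)*h = pN k σ y e γ) :
    0 < h ∧ γ^2 < 4*e*h ∧ 0 < pW k σ y e γ ∧ 3*γ < 5*h ∧ 2*e*σ*γ < pW k σ y e γ*h := by
  have he := G.e0; have hs1 := G.hs1; have hs0 := G.hs0; have hγ := G.F1; have hR4 := G.R4
  have hN : 0 < pN k σ y e γ := by nlinarith [G.F2, sq_nonneg γ]
  have hW : 0 < pW k σ y e γ := by
    by_contra hc
    have h1 := G.F3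
    have : 0 < 4*e^2*σ*γ := by positivity
    nlinarith
  have hh0 : 0 < h := by
    by_contra hc
    have : 0 < 2*e*(R-3) := by apply mul_pos <;> linarith
    nlinarith
  have h2 : pN k σ y e γ ≤ 2*e*h := by
    rw [← hh]; have := mul_pos he hh0; nlinarith
  refine ⟨hh0, by linarith [G.F2], hW, ?_, ?_⟩
  · have h3 : (2*e)*(3*γ) < (2*e)*(5*h) := by linarith [G.F5]
    exact lt_of_mul_lt_mul_left h3 (by linarith)
  · have h3 : (2*e)*(2*e*σ*γ) < (2*e)*(pW k σ y e γ*h) := by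
      have := mul_le_mul_of_nonneg_left h2 hW.le
      linarith [G.F3]
    exact lt_of_mul_lt_mul_left h3 (by linarith)

lemma cubic_pos {a b c d X : ℝ} (hX : 0 < X) (ha : 0 < a) (hc : c < 0) (hd : d < 0) (hend : 0 < a + X*(b+c*X+d*X^2)) :
    ∀ x ∈ Icc 0 X, 0 < a + x*(b+c*x+d*x^2) := by
  intro x hx
  have e1 : X*(a + x*(b+c*x+d*x^2)) = (X-x)*a + x*(a + X*(b+c*X+d*X^2)) - c*(x*(X-x)*X) - d*(x*(X-x)*X*(X+x)) := by ring
  have h1 : 0 ≤ x*(X-x)*X := mul_nonneg (mul_nonneg hx.1 (by linarith [hx.2])) hX.le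
  have h2 : 0 ≤ x*(X-x)*X*(X+x) := mul_nonneg h1 (by linarith [hx.1])
  have h3 : 0 < (X-x)*a + x*(a + X*(b+c*X+d*X^2)) := by
    rcases eq_or_lt_of_le hx.1 with h0 | h0
    · rw [← h0]; simp; positivity
    · have := mul_pos h0 hend
      have := mul_nonneg (by linarith [hx.2] : 0 ≤ X - x) ha.le
      linarith
  have h4 := mul_nonneg (neg_nonneg.2 hc.le) h1
  have h5 := mul_nonneg (neg_nonneg.2 hd.le) h2
  have : 0 < X*(a + x*(b+c*x+d*x^2)) := by rw [e1]; linarith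
  exact pos_of_mul_pos_right this hX.le

lemma q_pos {k σ y e R γ h : ℝ} (G : Good k σ y e R γ) (hR : 3 < R) (hh : 2*e*(R-3)*h = pN k σ y e γ) :
    ∃ X', γ/h < X' ∧ ∀ x ∈ Icc 0 X', 0 < r3c k σ y e γ h + x*(r4c k σ e γ h + r5c k σ γ h*x + r6c k σ h*x^2) := by
  obtain ⟨hh0, f2, hW, f5, f3⟩ := P2_facts G hR hh
  have he := G.e0; have hs1 := G.hs1; have hs0 := G.hs0; have hγ := G.F1; have hk := G.hk
  have hκ : 0 < (1-σ)/k := div_pos (by linarith) (by linarith [G.hk])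
  have hκ1 : (1-σ)/k ≤ 1-σ := div_le_self (by linarith) hk
  have hX : 0 < γ/h := by positivity
  have hr5 : r5c k σ γ h < 0 := by
    unfold r5c
    have h1 : (2*((1-σ)/k)+6*σ)*γ ≤ (2*(1-σ)+6*σ)*γ := mul_le_mul_of_nonneg_right (by linarith) hγ.le
    have h2 : (2*(1-σ)+6*σ)*(3*γ) < (2*(1-σ)+6*σ)*(5*h) := mul_lt_mul_of_pos_left f5 (by linarith)
    have h3 : 0 < (1-σ)*h := mul_pos (by linarith) hh0
    have h4 : (2*((1-σ)/k)+6*σ)*γ < 5*(1+σ)*h := by linarith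
    have := mul_lt_mul_of_pos_right h4 hh0
    linarith
  have hr6 : r6c k σ h < 0 := by
    unfold r6c
    have : 0 < ((1-σ)/k+4*σ)*h^2 := by positivity
    linarith
  have hend : 0 < r3c k σ y e γ h + (γ/h)*(r4c k σ e γ h + r5c k σ γ h*(γ/h) + r6c k σ h*(γ/h)^2) := by
    have hE := E_b (x := γ/h) G hh
    have hXh : h*(γ/h) = γ := by field_simp
    have hb : e-γ*(γ/h)+h*(γ/h)^2 = e := by linear_combination (γ/h)*hXh
    have hb' : -γ+2*h*(γ/h) = γ := by linear_combination 2*hXh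
    rw [hb, hb', QQ_e G] at hE
    generalize r3c k σ y e γ h + (γ/h)*(r4c k σ e γ h + r5c k σ γ h*(γ/h) + r6c k σ h*(γ/h)^2) = q at *
    set X := γ/h with hXd
    have hE2 : X^2*(γ*(pW k σ y e γ - 2*e*σ*X)) = X^3*q := by
      rw [← hE, ← G.hγ]
      unfold PP pW
      have h1 : pN k σ y e γ = 4*γ^2 - 4*(1+σ)*e*γ + pb1 k σ y*γ - pQ k σ e := rfl
      linear_combination -X^2*h1 + 2*e*(R-3)*X*hXh - X^2*hh
    have hpos : 0 < pW k σ y e γ - 2*e*σ*X := by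
      have : 2*e*σ*X*h < pW k σ y e γ*h := by
        calc 2*e*σ*X*h = 2*e*σ*γ := by linear_combination 2*e*σ*hXh
          _ < _ := f3
      have := lt_of_mul_lt_mul_right this hh0.le
      linarith
    have : 0 < X^3*q := by rw [← hE2]; positivity
    exact pos_of_mul_pos_right this (by positivity)
  have hall := cubic_pos hX (r3c_pos G hR hh) hr5 hr6 hend
  have hc : ContinuousAt (fun x => r3c k σ y e γ h + x*(r4c k σ e γ h + r5c k σ γ h*x + r6c k σ h*x^2)) (γ/h) := by fun_prop
  obtain ⟨δ, hδ, hδ'⟩ := Metric.eventually_nhds_iff.1 (hc.eventually (lt_mem_nhds hend))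
  refine ⟨γ/h+δ/2, by linarith, fun x hx => ?_⟩
  rcases le_or_gt x (γ/h) with hl | hl
  · exact hall x ⟨hx.1, hl⟩
  · exact hδ' (by rw [Real.dist_eq, abs_of_pos (by linarith)]; linarith [hx.2])

lemma e_pos {k σ y e R γ : ℝ} (G : Good k σ y e R γ) : ∃ X', k*(1-y)/(1-e) < X' ∧ ∀ x ∈ Ioc 0 X', 0 < QQ k σ y x e := by
  have he := G.e0; have hs1 := G.hs1; have hs0 := G.hs0; have hγ := G.F1; have hk := G.hk; have he1 := G.e1
  have hG : 0 < pG k σ y e := by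
    rw [← G.hγ]; have := G.R3; have : 0 < R - 2 := by linarith
    positivity
  set X := k*(1-y)/(1-e) with hX
  have hX1 : X*(1-e) = k*(1-y) := by rw [hX]; field_simp [show 1-e ≠ 0 by linarith]
  have hX0 : 0 < X := div_pos (mul_pos (by linarith) (by linarith [G.y1])) (by linarith)
  have hend : 0 < pG k σ y e + X*pQ k σ e := by
    have h1 : X*pQ k σ e = k*(1-y)*(2*σ) - (1-y)*(1-σ)*(1-e) := by
      unfold pQ
      have : k*((1-σ)/k) = 1-σ := by field_simp
      linear_combination (2*σ-(1-σ)/k*(1-e))*hX1 - (1-y)*(1-e)*this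
    have h2 : 0 < k*(1-y)*(2*σ) := mul_pos (mul_pos (by linarith) (by linarith [G.y1])) (by linarith)
    rw [h1]; linarith [G.F6]
  have hc : ContinuousAt (fun x => pG k σ y e + x*pQ k σ e) X := by fun_prop
  obtain ⟨δ, hδ, hδ'⟩ := Metric.eventually_nhds_iff.1 (hc.eventually (lt_mem_nhds hend))
  refine ⟨X+δ/2, by linarith, fun x hx => ?_⟩
  rw [QQ_e G]
  apply mul_pos hx.1
  rcases le_or_gt x X with hl | hl
  · by_contra hcon
    have : X*(pG k σ y e + x*pQ k σ e) = (X-x)*pG k σ y e + x*(pG k σ y e + X*pQ k σ e) := by ring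
    have h2 := mul_nonneg (by linarith : 0 ≤ X-x) hG.le
    have h3 := mul_pos hx.1 hend
    have h4 := mul_nonneg hX0.le (neg_nonneg.2 (not_lt.1 hcon))
    linarith
  · exact hδ' (by rw [Real.dist_eq, abs_of_pos (by linarith)]; linarith [hx.2])

lemma QQ_big {k σ y X : ℝ} (hk : 1 ≤ k) (hs0 : 0 < σ) (hs1 : σ < 1) : ∃ M, ∀ g, M ≤ g → ∀ x ∈ Icc 0 X, QQ k σ y x g < 0 := by
  have hcc : ContinuousOn (fun x => |cB k σ y x| + |cC k σ y x|) (Icc 0 X) := by unfold cB cC; fun_prop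
  obtain ⟨C, hC⟩ := (isCompact_Icc.image_of_continuousOn hcc).bddAbove
  refine ⟨max 1 (C+1), fun g hg x hx => ?_⟩
  have h1 := hC ⟨x, hx, rfl⟩
  simp only at h1
  have g1 : 1 ≤ g := (le_max_left _ _).trans hg
  have g2 : C+1 ≤ g := (le_max_right _ _).trans hg
  have hA : 1 ≤ cA k σ x := by
    unfold cA
    have : 0 ≤ (1-σ)/k*x^2 := mul_nonneg (div_nonneg (by linarith) (by linarith)) (sq_nonneg x)
    have := mul_nonneg (by linarith : 0 ≤ 1+σ) hx.1
    linarith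
  unfold QQ
  have h2 : cB k σ y x*g ≤ |cB k σ y x| * g := mul_le_mul_of_nonneg_right (le_abs_self _) (by linarith)
  have h3 : -cC k σ y x ≤ |cC k σ y x| * g := by
    have := neg_le_abs (cC k σ y x)
    have := mul_le_mul_of_nonneg_left g1 (abs_nonneg (cC k σ y x))
    linarith
  have h4 : g*g ≤ cA k σ x*g^2 := by
    have := mul_le_mul_of_nonneg_right hA (sq_nonneg g); linarith [sq g]
  have h5 := mul_le_mul_of_nonneg_right h1 (by linarith : 0 ≤ g)
  have h6 := mul_le_mul_of_nonneg_right g2 (by linarith : 0 ≤ g)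
  linarith

set_option maxHeartbeats 1000000 in
theorem right_G {k σ y e R γ h r ε : ℝ} {g0 ζ : ℝ → ℝ} (S : Shot k σ y e R γ h r ε g0 ζ) :
    ∃ (g : ℝ → ℝ) (xe : ℝ), k*(1-y)/(1-e) < xe ∧ IsSol k σ y g (Ioo (-1-ε) xe) ∧ ∀ x ≤ 0, g x = g0 x := by
  have G := S.good
  have hs0 := G.hs0; have hs1 := G.hs1; have he := G.e0; have hγ := G.F1; have hr := S.hr; have he1 := G.e1
  obtain ⟨hh0, f2, hW, f5, f3⟩ := P2_facts G S.R3 S.hh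
  obtain ⟨Xb, hXb, hq⟩ := q_pos G S.R3 S.hh
  obtain ⟨Xe, hXe, hQe⟩ := e_pos G
  have hX : 0 < γ/h := by positivity
  set xe := max Xb Xe with hxe
  obtain ⟨M, hM⟩ := QQ_big (k := k) (σ := σ) (y := y) (X := xe) G.hk hs0 hs1
  -- start
  have hζ0 : 0 < ζ 0 := by
    have h1 := r3c_pos G S.R3 S.hh
    rw [← S.ζ0] at h1
    have : 0 ≤ 2*e*(4-R) := mul_nonneg (by linarith) (by linarith [S.R4])
    exact pos_of_mul_pos_right h1 this
  have hev : ∀ᶠ x in 𝓝[>] (0:ℝ), 0 < ζ x := (S.ζc.eventually (lt_mem_nhds hζ0)).filter_mono nhdsWithin_le_nhds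
  obtain ⟨x0, hx0ζ, hx0⟩ := (hev.and (Ioo_mem_nhdsGT (lt_min hr hX))).exists
  have hx0r : x0 < r := hx0.2.trans_le (min_le_left _ _)
  have hx0X : x0 < γ/h := hx0.2.trans_le (min_le_right _ _)
  have hx00 := hx0.1
  have hg0 : e-γ*x0+h*x0^2 < g0 x0 := by
    rw [S.exp x0 ⟨by linarith, hx0r⟩]
    have : 0 < x0^3*ζ x0 := by positivity
    linarith
  have hxexb : Xb ≤ xe := le_max_left _ _
  have hx0xe : x0 < xe := by linarith
  -- the bounds
  obtain ⟨δ, hδ0, hδe, hδb⟩ : ∃ δ, 0 < δ ∧ δ < e ∧ ∀ x, δ < e-γ*x+h*x^2 := by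
    refine ⟨(4*e*h-γ^2)/(8*h), div_pos (by linarith) (by linarith), ?_, fun x => ?_⟩
    · rw [div_lt_iff₀ (by linarith)]; have := sq_nonneg γ; have := mul_pos he hh0; linarith
    · rw [div_lt_iff₀ (by linarith)]
      have := sq_nonneg (2*h*x-γ); linarith
  obtain ⟨Gm, hGM, hG1, hGg, hGb⟩ : ∃ Gm, M ≤ Gm ∧ 1 ≤ Gm ∧ g0 x0 < Gm ∧ ∀ x ∈ Icc 0 Xb, e-γ*x+h*x^2 ≤ Gm := by
    refine ⟨max (max M (g0 x0 + 1)) (e+1+h*Xb^2), (le_max_left _ _).trans (le_max_left _ _), ?_, ?_, ?_⟩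
    · refine le_trans ?_ (le_max_right _ _); have : 0 ≤ h*Xb^2 := by positivity
      linarith
    · refine lt_of_lt_of_le ?_ ((le_max_right M (g0 x0+1)).trans (le_max_left _ _)); linarith
    · intro x hx; refine le_trans ?_ (le_max_right _ _)
      have h1 := mul_nonneg hγ.le hx.1
      have h2 : x^2 ≤ Xb^2 := pow_le_pow_left₀ hx.1 hx.2 2
      have := mul_le_mul_of_nonneg_left h2 hh0.le
      linarith
  set F : ℝ × ℝ × ℝ → ℝ := fun z => QQ k σ y z.1 z.2.2/(2*PP σ z.1*z.2.2) with hF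
  obtain ⟨Yf, Y0, Yd, -⟩ := ode_solve F (Ico x0 xe) x0 0 0 δ Gm le_rfl (by linarith) ⟨le_rfl, hx0xe⟩
    (fun s hs => ⟨hs.1, fun t ht => ⟨ht.1, ht.2.trans_lt hs.2⟩⟩)
    (fun s hs => ⟨(s+xe)/2, ⟨by linarith [hs.1, hs.2], by linarith [hs.2]⟩, by linarith [hs.2]⟩)
    (fun t ht p hp yy hy => by
      have h1 : ContDiffAt ℝ (⊤:ℕ∞) (fun z : ℝ × ℝ => QQ k σ y z.1 z.2/(2*PP σ z.1*z.2)) (t, yy) :=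
        field_smooth' (PP_pos hs0 (by linarith [ht.1])).ne' (by linarith [hy.1] : (0:ℝ) < yy).ne'
      have h2 : ContDiffAt ℝ (⊤:ℕ∞) (fun z : ℝ × ℝ × ℝ => (z.1, z.2.2)) (t, p, yy) := by fun_prop
      exact (ContDiffAt.comp (t, p, yy) (g := fun z : ℝ × ℝ => QQ k σ y z.1 z.2/(2*PP σ z.1*z.2)) h1 h2).of_le (by exact_mod_cast le_top))
    (fun _ => g0 x0) continuousOn_const
  set Y := Yf 0 with hY
  have Y0' : Y x0 = g0 x0 := Y0 0 (by simp)
  have Yd' : ∀ x ∈ Ico x0 xe, HasDerivWithinAt Y (QQ k σ y x (cl δ Gm (Y x))/(2*PP σ x*cl δ Gm (Y x))) (Ici x0) x := Yd 0 (by simp)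
  -- upper bound
  have up : ∀ x ∈ Ico x0 xe, 0 < Gm - Y x := by
    refine barrier (fun x hx => (Yd' x hx).const_sub Gm) (by rw [Y0']; linarith) ?_
    intro x hx _ hc
    have hYx : Y x = Gm := by linarith
    rw [hYx, cl_eq ⟨by linarith, le_rfl⟩]
    have hP := PP_pos hs0 (by linarith [hx.1] : 0 < x)
    have := hM Gm hGM x ⟨by linarith [hx.1], hx.2.le⟩
    have := div_neg_of_neg_of_pos this (by positivity : 0 < 2*PP σ x*Gm)
    linarith
  -- first lower barrier
  have low1 : ∀ x ∈ Ico x0 Xb, 0 < Y x - (e-γ*x+h*x^2) := by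
    have hb : ∀ x, HasDerivAt (fun x => e-γ*x+h*x^2) (-γ+2*h*x) x := fun x => by
      refine ((deriv_b1 x).add (((hasDerivAt_id x).pow 2).const_mul h)).congr_deriv ?_
      simp; ring
    refine barrier (fun x hx => (Yd' x ⟨hx.1, by linarith [hx.2]⟩).sub (hb x).hasDerivWithinAt) (by rw [Y0']; linarith) ?_
    intro x hx _ hc
    have hx' : x ∈ Icc 0 Xb := ⟨by linarith [hx.1], hx.2.le⟩
    have hYx : Y x = e-γ*x+h*x^2 := by linarith
    rw [hYx, cl_eq ⟨(hδb x).le, hGb x hx'⟩]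
    have hP := PP_pos hs0 (by linarith [hx.1] : 0 < x)
    have hE := E_b (x := x) G S.hh
    have h1 := mul_pos (pow_pos (by linarith [hx.1] : 0 < x) 3) (hq x hx')
    rw [← hE] at h1
    have hbp := hδ0.trans (hδb x)
    have hden : 0 < 2*PP σ x*(e-γ*x+h*x^2) := by positivity
    rw [sub_pos, lt_div_iff₀ hden]
    linarith
  have low2 : ∀ x ∈ Ico (γ/h) Xe, 0 < Y x - e := by
    intro x hx
    have hlt : γ/h < Xe := hx.1.trans_lt hx.2
    have hXexe : Xe ≤ xe := le_max_right _ _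
    refine barrier (d := fun x => Y x - e) (t0 := γ/h) (b := Xe) (fun x hx => ((Yd' x ⟨by linarith [hx.1], by linarith [hx.2]⟩).mono (Ici_subset_Ici.2 hx0X.le)).sub_const e) ?_ ?_ x hx
    · have := low1 (γ/h) ⟨hx0X.le, hXb⟩
      have hb : e-γ*(γ/h)+h*(γ/h)^2 = e := by field_simp; ring
      rw [hb] at this; exact this
    · intro x hx _ hc
      have hYx : Y x = e := by linarith
      rw [hYx, cl_eq ⟨hδe.le, by linarith⟩]
      have hP := PP_pos hs0 (by linarith [hx.1] : 0 < x)
      exact div_pos (hQe x ⟨by linarith [hx.1], hx.2.le⟩) (by positivity)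
  have hbd : ∀ x ∈ Ico x0 xe, Y x ∈ Icc δ Gm := by
    intro x hx
    refine ⟨?_, by linarith [up x hx]⟩
    rcases lt_or_ge x Xb with hl | hl
    · linarith [low1 x ⟨hx.1, hl⟩, hδb x]
    · have : x < Xe := by
        rcases lt_max_iff.1 hx.2 with h1 | h1
        · linarith
        · exact h1
      linarith [low2 x ⟨by linarith, this⟩]
  have Yd2 : ∀ x ∈ Ico x0 xe, HasDerivWithinAt Y (QQ k σ y x (Y x)/(2*PP σ x*Y x)) (Ici x0) x := fun x hx => by
    have := Yd' x hx
    rwa [cl_eq (hbd x hx)] at this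
  obtain ⟨gl, gr, gd⟩ := ode_glue (F := fun z : ℝ × ℝ => QQ k σ y z.1 z.2/(2*PP σ z.1*z.2)) (a := 0) (c := r) hx00 hx0r
    (J := Ico x0 xe) (fun s hs _ => ⟨(s+xe)/2, ⟨by linarith [hs.1, hs.2], by linarith [hs.2]⟩, by linarith [hs.2]⟩)
    (y1 := g0) (y2 := Y) Y0'.symm ⟨le_rfl, hx0xe⟩
    (fun t ht => S.sol.deriv_eq ⟨by linarith [ht.1, S.hε], ht.2⟩ (PP_pos hs0 ht.1).ne') Yd2
  set g : ℝ → ℝ := fun t => if t ≤ x0 then g0 t else Y t with hg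
  have hgp : ∀ x, 0 < x → x < xe → 0 < g x := fun x h1 h2 => by
    rcases le_or_gt x x0 with hl | hl
    · rw [gl x hl]; exact (S.sol.2 x ⟨by linarith [S.hε], by linarith⟩).1
    · rw [gr x hl.le]; linarith [(hbd x ⟨hl.le, h2⟩).1]
  have hgd : ∀ x ∈ Ioo 0 xe, HasDerivAt g (QQ k σ y x (g x)/(2*PP σ x*g x)) x := fun x hx => by
    refine gd x hx.1 ?_
    rcases le_or_gt x x0 with hl | hl
    · exact Or.inl hl
    · exact Or.inr ⟨hl.le, hx.2⟩
  refine ⟨g, xe, hXe.trans_le (le_max_right _ _), ?_, fun x hx => gl x (by linarith)⟩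
  have s1 : IsSol k σ y g (Ioo (-1-ε) x0) := (S.sol.mono (Ioo_subset_Ioo le_rfl hx0r.le)).congr isOpen_Ioo (fun x hx => gl x hx.2.le)
  have s2 : IsSol k σ y g (Ioo 0 xe) := by
    refine ⟨ode_smooth isOpen_Ioo (F := fun z : ℝ × ℝ => QQ k σ y z.1 z.2/(2*PP σ z.1*z.2)) hgd (fun t ht => field_smooth' (PP_pos hs0 ht.1).ne' (hgp t ht.1 ht.2).ne'), fun x hx => ⟨hgp x hx.1 hx.2, _, hgd x hx, ?_⟩⟩
    have h1 := (PP_pos hs0 hx.1).ne'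
    have h2 := (hgp x hx.1 hx.2).ne'
    field_simp
  refine (s1.union isOpen_Ioo isOpen_Ioo s2).mono fun x hx => ?_
  rcases lt_or_ge x x0 with hl | hl
  · exact Or.inl ⟨hx.1, hl⟩
  · exact Or.inr ⟨by linarith, hx.2⟩


lemma th_deriv {σ x : ℝ} (h : 1+σ*x ≠ 0) : HasDerivAt (th σ) (σ*(1-σ)/(1+σ*x)^2) x := by
  have h1 : HasDerivAt (fun x => σ*(1+x)) σ x := by simpa using ((hasDerivAt_id x).const_add 1).const_mul σ
  have h2 : HasDerivAt (fun x => 1+σ*x) σ x := by simpa using ((hasDerivAt_id x).const_mul σ).const_add 1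
  refine (h1.div h2 h).congr_deriv ?_
  field_simp; ring

lemma SS_deriv {k σ y x g' : ℝ} {g : ℝ → ℝ} (h : 1+σ*x ≠ 0) (hg : HasDerivAt g g' x) :
    HasDerivAt (fun x => SS k σ y x (g x)) (-(1-σ)/k*(((1-g x)-x*g')*(1+σ*x)-(x*(1-g x)+k*y)*σ)/(1+σ*x)^2) x := by
  have h2 : HasDerivAt (fun x => 1+σ*x) σ x := by simpa using ((hasDerivAt_id x).const_mul σ).const_add 1
  have h3 := ((((hasDerivAt_id x).mul (hg.const_sub 1)).add_const (k*y)).const_mul ((1-σ)/k))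
  refine ((h3.div h2 h).const_sub 1).congr_deriv ?_
  simp; field_simp; ring

lemma one_sub_th {σ x : ℝ} (h : 1+σ*x ≠ 0) : 1 - th σ x = (1-σ)/(1+σ*x) := by
  unfold th; field_simp; ring

lemma U_deriv {k σ y x g' : ℝ} {g : ℝ → ℝ} (hk : k ≠ 0) (hσ : 1-σ ≠ 0) (h : 1+σ*x ≠ 0) (hx : th σ x ≠ 0) (hg0 : g x ≠ 0) (hg : HasDerivAt g g' x)
    (ho : 2*PP σ x*g x*g' = QQ k σ y x (g x)) :
    HasDerivAt (fun x => (SS k σ y x (g x))^2 - th σ x)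
      ((σ*(1-σ)/(1+σ*x)^2/th σ x*(1-SS k σ y x (g x)/((1-σ)/(1+σ*x)*g x)))*((SS k σ y x (g x))^2 - th σ x)) x := by
  refine (((SS_deriv h hg).pow 2).sub (th_deriv h)).congr_deriv ?_
  have ha := alg_S k σ y x (g x) g' hk h hg0 hσ ho
  generalize -(1-σ)/k*(((1-g x)-x*g')*(1+σ*x)-(x*(1-g x)+k*y)*σ)/(1+σ*x)^2 = S' at *
  generalize SS k σ y x (g x) = S at *
  have hD : (1-σ)/(1+σ*x)*g x ≠ 0 := mul_ne_zero (div_ne_zero hσ h) hg0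
  generalize (1-σ)/(1+σ*x)*g x = D at *
  generalize σ*(1-σ)/(1+σ*x)^2 = t' at *
  generalize th σ x = t at *
  have : t*(2*S*S' - t') = t'*(1-S/D)*(S^2-t) := by
    have : (S^2-t)/D = S*(S/D) - t/D := by field_simp
    rw [this] at ha
    linear_combination S*ha + t'*(S*t/D) - t'*t*S/D
  field_simp at this ⊢
  simp
  linear_combination this

lemma ze_deriv {k σ y x g' : ℝ} {g : ℝ → ℝ} (hk : k ≠ 0) (hσ : 1-σ ≠ 0) (h : 1+σ*x ≠ 0) (hg0 : g x ≠ 0) (hg : HasDerivAt g g' x)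
    (hS : SS k σ y x (g x) ≠ 0)
    (ho : 2*PP σ x*g x*g' = QQ k σ y x (g x)) :
    HasDerivAt (fun x => th σ x/(SS k σ y x (g x))^2)
      (σ*(1-σ)/(1+σ*x)^2*((SS k σ y x (g x))^2 - th σ x)/(((1-σ)/(1+σ*x)*g x)*(SS k σ y x (g x))^3)) x := by
  refine ((th_deriv h).div ((SS_deriv (k := k) (y := y) h hg).pow 2) (pow_ne_zero 2 hS)).congr_deriv ?_
  have ha := alg_S k σ y x (g x) g' hk h hg0 hσ ho
  have hD : (1-σ)/(1+σ*x)*g x ≠ 0 := mul_ne_zero (div_ne_zero hσ h) hg0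
  simp only [Pi.pow_apply]
  generalize -(1-σ)/k*(((1-g x)-x*g')*(1+σ*x)-(x*(1-g x)+k*y)*σ)/(1+σ*x)^2 = S' at *
  generalize SS k σ y x (g x) = S at *
  generalize (1-σ)/(1+σ*x)*g x = D at *
  generalize σ*(1-σ)/(1+σ*x)^2 = t' at *
  generalize th σ x = t at *
  have e1 : (t'*S^2 - t*((2:ℕ)*S^(2-1)*S'))/(S^2)^2 = (t'*S - 2*t*S')/S^3 := by
    push_cast; field_simp
  rw [e1, ha]
  field_simp
  ring

structure XP (k σ y e ε xe : ℝ) (g : ℝ → ℝ) : Prop where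
  hk : 1 ≤ k
  hs0 : 0 < σ
  hs1 : σ < 1
  y0 : 0 < y
  y1 : y < 1/2
  e0 : 0 < e
  e1 : e < 1
  hε : 0 < ε
  hxe : k*(1-y)/(1-e) < xe
  sol : IsSol k σ y g (Ioo (-1-ε) xe)
  hx : ∀ x ∈ Ioo (-1-ε) xe, 0 < 1+σ*x
  hS : ∀ x ∈ Ioo (-1-ε) xe, 0 < SS k σ y x (g x)
  hU : ∀ x ∈ Ioo (-1-ε) xe, th σ x < (SS k σ y x (g x))^2

set_option maxHeartbeats 1000000 in
theorem xprofile {k σ : ℝ} (hS : Sel k σ) : ∃ y e ε xe g, XP k σ y e ε xe g := by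
  obtain ⟨y, e, R, γ, h, r, ε0, g0, ζ, S⟩ := shoot hS
  obtain ⟨g, xe, hxe, sol, hg0⟩ := right_G S
  have G := S.good
  have hs0 := G.hs0; have hs1 := G.hs1; have he := G.e0; have he1 := G.e1; have hk := G.hk; have y0 := G.y0; have y1 := G.y1
  have hε0 := S.hε
  have hxe0 : 0 < xe := lt_trans (div_pos (mul_pos (by linarith) (by linarith)) (by linarith)) hxe
  have h1p : ∀ x, -1 ≤ x → 0 < 1+σ*x := fun x hx => by
    have := mul_le_mul_of_nonneg_left hx hs0.le; linarith
  have hκ : 0 < (1-σ)/k := div_pos (by linarith) (by linarith)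
  -- x ∈ [-1,0]
  have hg1 : ∀ x ∈ Icc (-1) 0, g x < 1 := by
    intro x hx
    rw [hg0 x hx.2]
    rcases eq_or_lt_of_le hx.2 with h0 | h0
    · rw [h0, S.exp 0 ⟨by linarith [S.hr], S.hr⟩]; simpa using he1
    · exact (S.bd x ⟨hx.1, h0⟩).2
  have hlow : ∀ x ∈ Icc (-1) 0, 1-y*(1-th σ x) ≤ SS k σ y x (g x) := by
    intro x hx
    rw [one_sub_th (h1p x hx.1).ne']
    unfold SS
    have h1 : x*(1-g x) ≤ 0 := mul_nonpos_of_nonpos_of_nonneg hx.2 (by linarith [hg1 x hx])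
    have h2 : (1-σ)/k*(x*(1-g x)+k*y)/(1+σ*x) ≤ y*((1-σ)/(1+σ*x)) := by
      rw [← mul_div_assoc]
      apply div_le_div_of_nonneg_right _ (h1p x hx.1).le
      have : (1-σ)/k*(x*(1-g x)+k*y) ≤ (1-σ)/k*(k*y) := mul_le_mul_of_nonneg_left (by linarith) hκ.le
      refine this.trans (le_of_eq ?_)
      field_simp
    linarith
  have hth0 : ∀ x, -1 ≤ x → 0 ≤ th σ x := fun x hx => div_nonneg (mul_nonneg hs0.le (by linarith)) (h1p x hx).le
  have hth1 : ∀ x, -1 ≤ x → th σ x < 1 := fun x hx => by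
    have := one_sub_th (h1p x hx).ne'
    have h2 : 0 < (1-σ)/(1+σ*x) := div_pos (by linarith) (h1p x hx)
    linarith
  have hSneg : ∀ x ∈ Icc (-1) 0, 0 < SS k σ y x (g x) ∧ th σ x < (SS k σ y x (g x))^2 := by
    intro x hx
    have h1 := hlow x hx; have h2 := hth0 x hx.1; have h3 := hth1 x hx.1
    have h4 : 0 < 1-y*(1-th σ x) := by nlinarith
    refine ⟨by linarith, ?_⟩
    have h5 : (1-y*(1-th σ x))^2 ≤ (SS k σ y x (g x))^2 := pow_le_pow_left₀ h4.le h1 2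
    have h6 : (1-(1-th σ x)/2)^2 < (1-y*(1-th σ x))^2 := pow_lt_pow_left₀ (by nlinarith) (by linarith) (by norm_num)
    nlinarith [sq_nonneg (1-th σ x)]
  have hgc : ∀ x ∈ Ioo (-1-ε0) xe, ContinuousAt g x := fun x hx => by
    obtain ⟨_, g', h1, _⟩ := sol.2 x hx; exact h1.continuousAt
  have hSc : ∀ x ∈ Ioo (-1-ε0) xe, 1+σ*x ≠ 0 → ContinuousAt (fun x => SS k σ y x (g x)) x := fun x hx h => by
    obtain ⟨_, g', h1, _⟩ := sol.2 x hx; exact (SS_deriv h h1).continuousAt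
  -- x > 0
  have hUpos : ∀ x ∈ Ico 0 xe, 0 < (SS k σ y x (g x))^2 - th σ x := by
    intro x hx
    set b := (x+xe)/2 with hb
    have hxb : x < b := by rw [hb]; linarith [hx.2]
    have hbe : b < xe := by rw [hb]; linarith [hx.2]
    set a : ℝ → ℝ := fun x => σ*(1-σ)/(1+σ*x)^2/th σ x*(1-SS k σ y x (g x)/((1-σ)/(1+σ*x)*g x)) with ha
    have hthp : ∀ x, 0 ≤ x → 0 < th σ x := fun x hx => div_pos (mul_pos hs0 (by linarith)) (h1p x (by linarith))
    have hmem : ∀ x ∈ Icc 0 b, x ∈ Ioo (-1-ε0) xe := fun x hx => ⟨by linarith [hx.1], by linarith [hx.2]⟩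
    have hac : ContinuousOn a (Icc 0 b) := fun t ht => by
      have h1 := (h1p t (by linarith [ht.1])).ne'
      have h2 := (th_deriv h1).continuousAt
      have h3 := hSc t (hmem t ht) h1
      have h4 := hgc t (hmem t ht)
      have h5 := (hthp t ht.1).ne'
      have h6 := (sol.2 t (hmem t ht)).1.ne'
      have h7 : ContinuousAt (fun x => 1+σ*x) t := by fun_prop
      apply ContinuousAt.continuousWithinAt
      refine ((continuousAt_const.div (h7.pow 2) (pow_ne_zero 2 h1)).div h2 h5).mul (continuousAt_const.sub (h3.div ((continuousAt_const.div h7 h1).mul h4) ?_))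
      exact mul_ne_zero (div_ne_zero (by linarith) h1) h6
    obtain ⟨C, hC⟩ := (isCompact_Icc.image_of_continuousOn hac.neg).bddAbove
    have hC' : ∀ x ∈ Icc 0 b, 0 < a x + (C+1) := fun x hx => by
      have := hC ⟨x, hx, rfl⟩
      simp only [Pi.neg_apply] at this
      linarith
    set U0 := (SS k σ y 0 (g 0))^2 - th σ 0 with hU0
    have hU0p : 0 < U0 := by have := (hSneg 0 ⟨by norm_num, le_rfl⟩).2; rw [hU0]; linarith
    have hexp : ∀ x, HasDerivAt (fun x => U0/2*Real.exp (-(C+1)*x)) (U0/2*(Real.exp (-(C+1)*x)*(-(C+1)))) x := fun x => by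
      have := (((hasDerivAt_id x).const_mul (-(C+1))).exp).const_mul (U0/2)
      simpa using this
    have key : ∀ x ∈ Ico 0 b, 0 < ((SS k σ y x (g x))^2 - th σ x) - U0/2*Real.exp (-(C+1)*x) := by
      refine barrier (d' := fun x => a x*((SS k σ y x (g x))^2 - th σ x) - (U0/2*(Real.exp (-(C+1)*x)*(-(C+1))))) (fun t ht => ?_) ?_ ?_
      · obtain ⟨h1, g', h2, h3⟩ := sol.2 t (hmem t ⟨ht.1, ht.2.le⟩)
        exact ((U_deriv (by linarith) (by linarith) (h1p t (by linarith [ht.1])).ne' (hthp t ht.1).ne' h1.ne' h2 h3).sub (hexp t)).hasDerivWithinAt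
      · simp only [mul_zero, Real.exp_zero, mul_one]; rw [← hU0]; linarith
      · intro t ht _ hc
        have h1 := hC' t ⟨ht.1.le, ht.2.le⟩
        have h2 : 0 < U0/2*Real.exp (-(C+1)*t) := by positivity
        have h3 : (SS k σ y t (g t))^2 - th σ t = U0/2*Real.exp (-(C+1)*t) := by linarith
        rw [h3]
        have := mul_pos h1 h2
        linarith
    have := key x ⟨hx.1, hxb⟩
    have h2 : 0 < U0/2*Real.exp (-(C+1)*x) := by positivity
    linarith
  have hSpos : ∀ x ∈ Ico 0 xe, 0 < SS k σ y x (g x) := by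
    intro x hx
    by_contra hcon
    have hc : ContinuousOn (fun x => SS k σ y x (g x)) (Icc 0 x) := fun t ht =>
      (hSc t ⟨by linarith [ht.1], by linarith [ht.2, hx.2]⟩ (h1p t (by linarith [ht.1])).ne').continuousWithinAt
    obtain ⟨t, ht, hte⟩ := intermediate_value_Icc' hx.1 hc (show (0:ℝ) ∈ Icc _ _ from ⟨not_lt.1 hcon, (hSneg 0 ⟨by norm_num, le_rfl⟩).1.le⟩)
    have h1 := hUpos t ⟨ht.1, by linarith [ht.2, hx.2]⟩
    simp only at hte
    rw [hte] at h1
    have := hth0 t (by linarith [ht.1])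
    norm_num at h1
    linarith
  -- a little to the left of -1
  have hm1 : (-1:ℝ) ∈ Ioo (-1-ε0) xe := ⟨by linarith, by linarith⟩
  have h11 := h1p (-1) le_rfl
  have c1 := hSc (-1) hm1 h11.ne'
  have c2 := (th_deriv h11.ne').continuousAt
  have c3 : ContinuousAt (fun x => 1+σ*x) (-1) := by fun_prop
  have hn1 := hSneg (-1) ⟨le_rfl, by norm_num⟩
  have ev := (c3.eventually (lt_mem_nhds h11)).and ((c1.eventually (lt_mem_nhds hn1.1)).and (c2.eventually_lt (c1.pow 2) hn1.2))
  obtain ⟨δ, hδ, hδ'⟩ := Metric.eventually_nhds_iff.1 ev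
  have hall : ∀ x ∈ Ioo (-1-min ε0 δ) xe, 0 < 1+σ*x ∧ 0 < SS k σ y x (g x) ∧ th σ x < (SS k σ y x (g x))^2 := by
    intro x hx
    rcases lt_or_ge x (-1) with h1 | h1
    · have := hx.1
      exact hδ' (by rw [Real.dist_eq, abs_of_neg (by linarith)]; linarith [min_le_right ε0 δ])
    · rcases le_or_gt x 0 with h2 | h2
      · exact ⟨h1p x h1, hSneg x ⟨h1, h2⟩⟩
      · exact ⟨h1p x h1, hSpos x ⟨h2.le, hx.2⟩, by linarith [hUpos x ⟨h2.le, hx.2⟩]⟩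
  exact ⟨y, e, min ε0 δ, xe, g, hk, hs0, hs1, y0, y1, he, he1, lt_min hε0 hδ, hxe, 
    sol.mono (Ioo_subset_Ioo (by linarith [min_le_left ε0 δ]) le_rfl), fun x hx => (hall x hx).1, fun x hx => (hall x hx).2.1, fun x hx => (hall x hx).2.2⟩


lemma smooth_inverse {f f' : ℝ → ℝ} {a b p q : ℝ} (hf : ContDiffOn ℝ (⊤:ℕ∞) f (Ioo a b))
    (hd : ∀ x ∈ Ioo a b, HasDerivAt f (f' x) x) (hp : ∀ x ∈ Ioo a b, 0 < f' x) (hap : a < p) (hpq : p < q) (hqb : q < b) :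
    ∃ Ξ : ℝ → ℝ, ContDiffOn ℝ (⊤:ℕ∞) Ξ (Ioo (f p) (f q)) ∧ (∀ z ∈ Ioo (f p) (f q), Ξ z ∈ Ioo p q ∧ f (Ξ z) = z ∧
      HasDerivAt Ξ (f' (Ξ z))⁻¹ z) ∧ (∀ x ∈ Ioo p q, Ξ (f x) = x) ∧ StrictMonoOn f (Icc p q) := by
  have hsub : Icc p q ⊆ Ioo a b := fun x hx => ⟨hap.trans_le hx.1, hx.2.trans_lt hqb⟩
  have hmono : StrictMonoOn f (Icc p q) := strictMonoOn_of_deriv_pos (convex_Icc p q)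
    (fun x hx => (hd x (hsub hx)).continuousAt.continuousWithinAt) (fun x hx => by
      rw [interior_Icc] at hx
      rw [(hd x (hsub (Ioo_subset_Icc_self hx))).deriv]; exact hp x (hsub (Ioo_subset_Icc_self hx)))
  have hex : ∀ z, ∃ x, z ∈ Ioo (f p) (f q) → x ∈ Ioo p q ∧ f x = z := by
    intro z
    by_cases hz : z ∈ Ioo (f p) (f q)
    · obtain ⟨x, hx, hxz⟩ := intermediate_value_Ioo hpq.le (fun x hx => (hd x (hsub hx)).continuousAt.continuousWithinAt) hz
      exact ⟨x, fun _ => ⟨hx, hxz⟩⟩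
    · exact ⟨0, fun h => absurd h hz⟩
  choose Ξ hΞ using hex
  have main : ∀ z ∈ Ioo (f p) (f q), ContDiffAt ℝ (⊤:ℕ∞) Ξ z := by
    intro z hz
    obtain ⟨hx, hxz⟩ := hΞ z hz
    have hxa := hsub (Ioo_subset_Icc_self hx)
    have hc : ContDiffAt ℝ (⊤:ℕ∞) f (Ξ z) := hf.contDiffAt (isOpen_Ioo.mem_nhds hxa)
    have hne : f' (Ξ z) ≠ 0 := (hp _ hxa).ne'
    have hfd : HasFDerivAt f ((ContinuousLinearEquiv.unitsEquivAut ℝ (Units.mk0 (f' (Ξ z)) hne) : ℝ ≃L[ℝ] ℝ) : ℝ →L[ℝ] ℝ) (Ξ z) := by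
      refine (hd _ hxa).hasFDerivAt.congr_fderiv ?_
      ext; simp
    have hn : ((⊤:ℕ∞) : WithTop ℕ∞) ≠ 0 := by simp
    have h1 := hc.to_localInverse hfd hn
    have hst := hc.hasStrictFDerivAt' hfd hn
    rw [hxz] at h1
    refine h1.congr_of_eventuallyEq ?_
    have r1 := hst.eventually_right_inverse
    have r2 := hst.localInverse_tendsto.eventually (isOpen_Ioo.mem_nhds hx)
    rw [hxz] at r1 r2
    filter_upwards [r1, r2, isOpen_Ioo.mem_nhds hz] with t h3 h4 h5
    have := hΞ t h5
    exact hmono.injOn (Ioo_subset_Icc_self this.1) (Ioo_subset_Icc_self h4) (by rw [this.2]; exact h3.symm)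
  have hinv : ∀ x ∈ Ioo p q, Ξ (f x) = x := fun x hx => by
    have hm : f x ∈ Ioo (f p) (f q) := ⟨hmono ⟨le_rfl, hpq.le⟩ (Ioo_subset_Icc_self hx) hx.1, hmono (Ioo_subset_Icc_self hx) ⟨hpq.le, le_rfl⟩ hx.2⟩
    have := hΞ _ hm
    exact hmono.injOn (Ioo_subset_Icc_self this.1) (Ioo_subset_Icc_self hx) this.2
  refine ⟨Ξ, fun z hz => (main z hz).contDiffWithinAt, fun z hz => ⟨(hΞ z hz).1, (hΞ z hz).2, ?_⟩, hinv, hmono⟩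
  have hxa := hsub (Ioo_subset_Icc_self (hΞ z hz).1)
  exact HasDerivAt.of_local_left_inverse (main z hz).continuousAt (hd _ hxa) (hp _ hxa).ne'
    (by filter_upwards [isOpen_Ioo.mem_nhds hz] with t ht using (hΞ t ht).2)


lemma vode_alg {k σ y x g Z S w : ℝ} (hk : k ≠ 0) (hs0 : σ ≠ 0) (hs1 : 1-σ ≠ 0) (hx : 1+σ*x ≠ 0) (hZ : Z ≠ 0) (hS : S = SS k σ y x g)
    (hw : w = Z*S) (hth : w^2 = th σ x) (hd : 1-Z*w ≠ 0) (hZ1 : 1-Z^2 ≠ 0) :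
    (1-w^2)*(1-g)/(1-Z*w)^2*(σ*(1-Z*((Z-w)/(1-Z*w)))^2-(Z-(Z-w)/(1-Z*w))^2)
      = σ*(1-((Z-w)/(1-Z*w))^2)*(k*y*(1-((Z-w)/(1-Z*w))^2)-k*((1-S)/(1-Z*w))*(1-Z*((Z-w)/(1-Z*w)))) := by
  have e1 : σ - w^2 = -σ*x*(1-w^2) := by
    rw [hth]; unfold th; field_simp; ring
  have e2 : x*(1-g)*(1-w^2) = k*(1-S)-k*y*(1-w^2) := by
    rw [hth, one_sub_th hx, hS]; unfold SS; field_simp; ring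
  have f1 : 1-Z*((Z-w)/(1-Z*w)) = (1-Z^2)/(1-Z*w) := by field_simp; ring
  have f2 : Z-(Z-w)/(1-Z*w) = w*(1-Z^2)/(1-Z*w) := by field_simp; ring
  have f3 : 1-((Z-w)/(1-Z*w))^2 = (1-Z^2)*(1-w^2)/(1-Z*w)^2 := by field_simp; ring
  rw [f1, f2, f3]
  have : σ*((1-Z^2)/(1-Z*w))^2-(w*(1-Z^2)/(1-Z*w))^2 = (1-Z^2)^2/(1-Z*w)^2*(-σ*x*(1-w^2)) := by
    rw [← e1]; field_simp
  rw [this]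
  have e3 : k*y*((1-Z^2)*(1-w^2)/(1-Z*w)^2) - k*((1-S)/(1-Z*w))*((1-Z^2)/(1-Z*w)) = -((1-Z^2)/(1-Z*w)^2)*(x*(1-g)*(1-w^2)) := by
    rw [e2]; field_simp; ring
  rw [e3]; field_simp

lemma v_lt_one {Z w : ℝ} (hZ : Z^2 < 1) (hw : w^2 < 1) : |(Z-w)/(1-Z*w)| < 1 := by
  have h1 : 0 < 1-Z*w := by nlinarith [sq_nonneg (Z-w)]
  rw [abs_div, abs_of_pos h1, div_lt_one h1, abs_lt]
  have := (sq_lt_one_iff_abs_lt_one Z).1 hZ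
  have := (sq_lt_one_iff_abs_lt_one w).1 hw
  rw [abs_lt] at *
  constructor <;> nlinarith

set_option maxHeartbeats 1000000 in
theorem zlocal {k σ y e ε xe : ℝ} {g : ℝ → ℝ} (X : XP k σ y e ε xe g) : ∃ (ψ : ℝ → ℝ) (Z0 Z2 : ℝ), 0 < Z0 ∧ Z0 < Z2 ∧ Z2 < 1 ∧
    ContDiffOn ℝ (⊤:ℕ∞) ψ (Ioo (-Z2) Z2) ∧ (∀ Z ∈ Ioo (-Z2) Z2, |Z*ψ Z| < 1) ∧
    (∀ Z ∈ Ioo 0 Z2, ∃ v', HasDerivAt (fun Z => Z*ψ Z) v' Z ∧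
      v'*(σ*(1-Z*(Z*ψ Z))^2-(Z-Z*ψ Z)^2) = σ*(1-(Z*ψ Z)^2)*(k*y*(1-(Z*ψ Z)^2)-k*ψ Z*(1-Z*(Z*ψ Z)))) ∧
    √(th σ (k*(1-y)/(1-e)))*(1-Z0*(Z0*ψ Z0)) < Z0 - Z0*ψ Z0 := by
  have hs0 := X.hs0; have hs1 := X.hs1; have hk := X.hk; have hε := X.hε; have hxe := X.hxe
  set x1 := k*(1-y)/(1-e) with hx1
  have hx1p : 0 < x1 := div_pos (mul_pos (by linarith) (by linarith [X.y1])) (by linarith [X.e1])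
  have hxeq : xe = xe := rfl
  set s := Ioo (-1-ε) xe with hs
  set S : ℝ → ℝ := fun x => SS k σ y x (g x) with hS
  set f : ℝ → ℝ := fun x => th σ x/(S x)^2 with hf
  have hSsm : ContDiffOn ℝ (⊤:ℕ∞) S s := by
    have h1 := X.sol.1
    have h2 : ContDiffOn ℝ (⊤:ℕ∞) (fun x => 1+σ*x) s := by fun_prop
    have h3 : ContDiffOn ℝ (⊤:ℕ∞) (fun x => (1-σ)/k*(x*(1-g x)+k*y)) s := by fun_prop
    have h4 : ContDiffOn ℝ (⊤:ℕ∞) (fun x => 1-(1-σ)/k*(x*(1-g x)+k*y)/(1+σ*x)) s := contDiffOn_const.sub (h3.div h2 fun x hx => (X.hx x hx).ne')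
    exact h4
  have hthsm : ContDiffOn ℝ (⊤:ℕ∞) (th σ) s := by
    have h2 : ContDiffOn ℝ (⊤:ℕ∞) (fun x => 1+σ*x) s := by fun_prop
    have h3 : ContDiffOn ℝ (⊤:ℕ∞) (fun x => σ*(1+x)) s := by fun_prop
    exact h3.div h2 fun x hx => (X.hx x hx).ne'
  have hSp : ∀ x ∈ s, 0 < S x := X.hS
  have hfsm : ContDiffOn ℝ (⊤:ℕ∞) f s := hthsm.div (hSsm.pow 2) fun x hx => pow_ne_zero 2 (hSp x hx).ne'
  set f' : ℝ → ℝ := fun x => σ*(1-σ)/(1+σ*x)^2*((S x)^2 - th σ x)/(((1-σ)/(1+σ*x)*g x)*(S x)^3) with hf'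
  have hfd : ∀ x ∈ s, HasDerivAt f (f' x) x := by
    intro x hx
    obtain ⟨h1, g', h2, h3⟩ := X.sol.2 x hx
    exact ze_deriv (by linarith) (by linarith) (X.hx x hx).ne' h1.ne' h2 (hSp x hx).ne' h3
  have hfp : ∀ x ∈ s, 0 < f' x := by
    intro x hx
    have h1 := (X.sol.2 x hx).1; have h2 := X.hx x hx; have h3 := hSp x hx; have h4 := X.hU x hx
    have h5 : 0 < (S x)^2 - th σ x := sub_pos.2 h4
    have h6 : 0 < 1-σ := by linarith
    simp only [hf']; positivity
  set x0 := (x1+xe)/2 with hx0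
  set q := (x0+xe)/2 with hq
  set p := -1-ε/2 with hp
  obtain ⟨Ξ, hΞs, hΞ, hinv, hmono⟩ := smooth_inverse hfsm hfd hfp (show -1-ε < p by rw [hp]; linarith) (show p < q by rw [hp, hq]; linarith) (show q < xe by linarith)
  have hfm1 : f (-1) = 0 := by simp [hf, th]
  have hfpn : f p < 0 := by rw [← hfm1]; exact hmono ⟨le_rfl, by linarith⟩ ⟨by linarith, by linarith⟩ (by linarith)
  have hfq1 : ∀ x ∈ s, f x < 1 := fun x hx => by
    simp only [hf]; rw [div_lt_one (pow_pos (hSp x hx) 2)]; exact X.hU x hx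
  have hfx0q : f x0 < f q := hmono ⟨by linarith, by linarith⟩ ⟨by linarith, by linarith⟩ (by linarith)
  have hfx0 : 0 < f x0 := by rw [← hfm1]; exact hmono ⟨by linarith, by linarith⟩ ⟨by linarith, by linarith⟩ (by linarith)
  have hq1 : f q < 1 := hfq1 q ⟨by linarith, by linarith⟩
  have hthlt : ∀ x ∈ s, th σ x < 1 := fun x hx => by
    have := one_sub_th (X.hx x hx).ne'
    have h2 : 0 < (1-σ)/(1+σ*x) := div_pos (by linarith) (X.hx x hx)
    linarith
  -- domain
  have hdom : ∀ Z ∈ Ioo (-√(f q)) (√(f q)), Z^2 ∈ Ioo (f p) (f q) := fun Z hZ => by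
    refine ⟨by nlinarith [sq_nonneg Z], ?_⟩
    have : |Z| < √(f q) := abs_lt.2 hZ
    rw [← sq_abs, ← Real.sq_sqrt (by linarith : 0 ≤ f q)]
    exact pow_lt_pow_left₀ this (abs_nonneg _) (by norm_num)
  have hpqs : ∀ x ∈ Ioo p q, x ∈ s := fun x hx => ⟨by linarith [hx.1], by linarith [hx.2]⟩
  have hmem : ∀ Z ∈ Ioo (-√(f q)) (√(f q)), Ξ (Z^2) ∈ s := fun Z hZ => hpqs _ (hΞ _ (hdom Z hZ)).1
  have hZZ : ∀ Z ∈ Ioo (-√(f q)) (√(f q)), (Z*S (Ξ (Z^2)))^2 = th σ (Ξ (Z^2)) := fun Z hZ => by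
    have h1 := (hΞ _ (hdom Z hZ)).2.1
    have h2 := hSp _ (hmem Z hZ)
    simp only [hf] at h1
    rw [div_eq_iff (by positivity)] at h1
    rw [h1]; ring
  have hw1 : ∀ Z ∈ Ioo (-√(f q)) (√(f q)), (Z*S (Ξ (Z^2)))^2 < 1 := fun Z hZ => by
    rw [hZZ Z hZ]; exact hthlt _ (hmem Z hZ)
  have hZ1 : ∀ Z ∈ Ioo (-√(f q)) (√(f q)), Z^2 < 1 := fun Z hZ => (hdom Z hZ).2.trans hq1
  have hdp : ∀ Z ∈ Ioo (-√(f q)) (√(f q)), 0 < 1-Z*(Z*S (Ξ (Z^2))) := fun Z hZ => by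
    have h1 := hw1 Z hZ; have h2 := hZ1 Z hZ
    nlinarith [sq_nonneg (Z - Z*S (Ξ (Z^2)))]
  set ψ : ℝ → ℝ := fun Z => (1-S (Ξ (Z^2)))/(1-Z*(Z*S (Ξ (Z^2)))) with hψ
  have hv : ∀ Z, Z*ψ Z = (Z-Z*S (Ξ (Z^2)))/(1-Z*(Z*S (Ξ (Z^2)))) := fun Z => by
    simp only [hψ]; ring
  have hSΞ : ContDiffOn ℝ (⊤:ℕ∞) (fun Z => S (Ξ (Z^2))) (Ioo (-√(f q)) (√(f q))) := by
    have h1 : ContDiffOn ℝ (⊤:ℕ∞) (fun Z : ℝ => Ξ (Z^2)) (Ioo (-√(f q)) (√(f q))) := hΞs.comp (by fun_prop) hdom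
    exact hSsm.comp h1 hmem
  have hsq0 : √(f x0) ∈ Ioo (-√(f q)) (√(f q)) := ⟨by have := Real.sqrt_nonneg (f q); have := Real.sqrt_pos.2 hfx0; linarith, Real.sqrt_lt_sqrt hfx0.le hfx0q⟩
  refine ⟨ψ, √(f x0), √(f q), Real.sqrt_pos.2 hfx0, hsq0.2, ?_, ?_, ?_, ?_, ?_⟩
  · rw [Real.sqrt_lt' one_pos]; simpa using hq1
  · exact (contDiffOn_const.sub hSΞ).div (contDiffOn_const.sub (contDiffOn_id.mul (contDiffOn_id.mul hSΞ))) fun Z hZ => (hdp Z hZ).ne'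
  · intro Z hZ
    rw [hv]; exact v_lt_one (hZ1 Z hZ) (hw1 Z hZ)
  · intro Z hZ
    have hZ' : Z ∈ Ioo (-√(f q)) (√(f q)) := ⟨by linarith [hZ.1, Real.sqrt_nonneg (f q)], hZ.2⟩
    have hZ0 := hZ.1
    have hx := hmem Z hZ'
    set x := Ξ (Z^2) with hxdef
    have hSx := hSp x hx
    have hgx := (X.sol.2 x hx).1
    have h1x := X.hx x hx
    obtain ⟨w', hw'⟩ : ∃ w', HasDerivAt (fun Z => Z*S (Ξ (Z^2))) w' Z := by
      have := ((contDiffOn_id.mul hSΞ).contDiffAt (isOpen_Ioo.mem_nhds hZ')).differentiableAt (by simp)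
      exact ⟨_, this.hasDerivAt⟩
    have hΞd : HasDerivAt (fun Z : ℝ => Ξ (Z^2)) ((f' x)⁻¹*(2*Z)) Z := by
      have h1 := (hΞ _ (hdom Z hZ')).2.2
      have := HasDerivAt.comp Z (h₂ := Ξ) (h := fun Z : ℝ => Z^2) h1 (by simpa using hasDerivAt_pow 2 Z : HasDerivAt (fun Z : ℝ => Z^2) (2*Z) Z)
      exact this
    have hthd : HasDerivAt (fun Z : ℝ => th σ (Ξ (Z^2))) (σ*(1-σ)/(1+σ*x)^2*((f' x)⁻¹*(2*Z))) Z :=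
      HasDerivAt.comp Z (h₂ := th σ) (th_deriv h1x.ne') hΞd
    have heq : HasDerivAt (fun Z => (Z*S (Ξ (Z^2)))^2) (σ*(1-σ)/(1+σ*x)^2*((f' x)⁻¹*(2*Z))) Z := by
      refine hthd.congr_of_eventuallyEq ?_
      filter_upwards [isOpen_Ioo.mem_nhds hZ'] with t ht using hZZ t ht
    have hww := (hw'.pow 2).unique heq
    have hth := hZZ Z hZ'
    have hd := hdp Z hZ'
    have hZ2 := hZ1 Z hZ'
    rw [← hxdef] at hth hd
    have hw'eq : w' = (1-(Z*S x)^2)*g x/(1-Z^2) := by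
      have hU : 0 < (S x)^2 - th σ x := sub_pos.2 (X.hU x hx)
      have hU' : (S x)^2 - th σ x = (S x)^2*(1-Z^2) := by rw [← hth]; ring
      have h6 : 0 < 1-σ := by linarith
      have hot : 1-(Z*S x)^2 = (1-σ)/(1+σ*x) := by rw [hth, one_sub_th h1x.ne']
      have hf'x : f' x = σ*(1-σ)/(1+σ*x)^2*((S x)^2*(1-Z^2))/((1-(Z*S x)^2)*g x*(S x)^3) := by
        simp only [hf']; rw [hU', hot]
      have hop : 0 < 1-(Z*S x)^2 := by rw [hot]; positivity
      have hoz : 0 < 1-Z^2 := by linarith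
      have hT : 0 < σ*(1-σ)/(1+σ*x)^2 := by positivity
      rw [hf'x] at hww
      simp only [Nat.cast_ofNat, Nat.add_one_sub_one, pow_one] at hww
      rw [← hxdef] at hww
      generalize σ*(1-σ)/(1+σ*x)^2 = T at *
      generalize 1-(Z*S x)^2 = o at *
      generalize 1-Z^2 = oz at *
      generalize S x = s at *
      field_simp at hww ⊢
      norm_num at hww
      nlinarith
    refine ⟨(1-(Z*S x)^2)*(1-g x)/(1-Z*(Z*S x))^2, ?_, ?_⟩
    · have h1 : HasDerivAt (fun Z => (Z-Z*S (Ξ (Z^2)))/(1-Z*(Z*S (Ξ (Z^2)))))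
        (((1-w')*(1-Z*(Z*S x))-(Z-Z*S x)*(-(1*(Z*S x)+Z*w')))/(1-Z*(Z*S x))^2) Z := by
        have a1 := (hasDerivAt_id Z).sub hw'
        have a2 := ((hasDerivAt_id Z).mul hw').const_sub 1
        exact a1.div a2 hd.ne'
      have h2 : (fun Z => Z*ψ Z) = (fun Z => (Z-Z*S (Ξ (Z^2)))/(1-Z*(Z*S (Ξ (Z^2))))) := funext hv
      rw [h2]
      refine h1.congr_deriv ?_
      have hoz : 0 < 1-Z^2 := by linarith
      have e1 : w'*(1-Z^2) = (1-(Z*S x)^2)*g x := by rw [hw'eq]; field_simp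
      congr 1
      linear_combination -e1
    · have := vode_alg (k := k) (σ := σ) (y := y) (x := x) (g := g x) (Z := Z) (S := S x) (w := Z*S x) (by linarith) hs0.ne' (by linarith) h1x.ne' hZ0.ne' rfl rfl hth hd.ne' (by linarith)
      rw [hv]
      exact this
  · have hx0s : x0 ∈ s := ⟨by linarith, by linarith⟩
    have hxx : Ξ ((√(f x0))^2) = x0 := by rw [Real.sq_sqrt hfx0.le]; exact hinv x0 ⟨by linarith, by linarith⟩
    have hd := hdp _ hsq0
    have h2 := hZ1 _ hsq0
    have hth := hZZ _ hsq0
    rw [hv]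
    rw [hxx] at *
    have hS0 := hSp _ hx0s
    set Z := √(f x0) with hZ
    have hZp : 0 < Z := Real.sqrt_pos.2 hfx0
    have hlt : √(th σ x1) < Z*S x0 := by
      rw [Real.sqrt_lt' (by positivity), hth]
      have h1 := X.hx x0 hx0s
      have h3 : 0 < 1+σ*x1 := by positivity
      unfold th
      rw [div_lt_div_iff₀ h3 h1]
      have : 0 < σ*(1-σ)*(x0-x1) := mul_pos (mul_pos hs0 (by linarith)) (by linarith)
      nlinarith
    generalize Z*S x0 = w at *
    have f1 : 1-Z*((Z-w)/(1-Z*w)) = (1-Z^2)/(1-Z*w) := by field_simp; ring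
    have f2 : Z-(Z-w)/(1-Z*w) = w*(1-Z^2)/(1-Z*w) := by field_simp; ring
    rw [f1, f2, mul_div_assoc]
    exact mul_lt_mul_of_pos_right hlt (div_pos (by linarith) hd)


lemma trap_up {V : ℝ → ℝ} {G : ℝ × ℝ → ℝ} {t0 : ℝ} (hG : ContinuousOn G (Ici t0 ×ˢ Icc (-1) 1))
    (hV : ∀ t, t0 ≤ t → HasDerivWithinAt V ((1-(cl (-1) 1 (V t))^2)*G (t, cl (-1) 1 (V t))) (Ici t0) t)
    (h0 : V t0 < 1) (h0' : -1 < V t0) : ∀ t, t0 ≤ t → V t < 1 := by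
  intro t ht
  set b := t+1 with hb
  have hcomp : IsCompact (Icc t0 b ×ˢ Icc (-1:ℝ) 1) := isCompact_Icc.prod isCompact_Icc
  obtain ⟨K, hK⟩ := hcomp.exists_bound_of_continuousOn (hG.mono (prod_mono (fun x hx => hx.1) le_rfl))
  have hK0 : 0 ≤ K := (norm_nonneg _).trans (hK (t0, 0) ⟨⟨le_rfl, by linarith⟩, by norm_num⟩)
  set d0 := 1 - V t0 with hd0
  have hd0p : 0 < d0 := by linarith
  set C := 2*K+1 with hC
  have hexp : ∀ x, HasDerivAt (fun x => d0/2*Real.exp (-C*(x-t0))) (d0/2*(Real.exp (-C*(x-t0))*(-C))) x := fun x => by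
    have := ((((hasDerivAt_id x).sub_const t0).const_mul (-C)).exp).const_mul (d0/2)
    simpa using this
  have key : ∀ s ∈ Ico t0 b, 0 < (1 - V s) - d0/2*Real.exp (-C*(s-t0)) := by
    refine barrier (fun s hs => ((hV s hs.1).const_sub 1).sub (hexp s).hasDerivWithinAt) ?_ ?_
    · simp; linarith
    · intro s hs _ hc
      set η := d0/2*Real.exp (-C*(s-t0)) with hη
      have hηp : 0 < η := by positivity
      have hη1 : η < 1 := by
        have h1 : Real.exp (-C*(s-t0)) ≤ 1 := Real.exp_le_one_iff.2 (by nlinarith [hs.1])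
        have h2 : η ≤ d0/2*1 := mul_le_mul_of_nonneg_left h1 (by linarith)
        linarith
      have hv : V s = 1-η := by linarith
      have hcl : cl (-1) 1 (V s) = V s := cl_eq (by rw [hv]; constructor <;> linarith)
      have hk := hK (s, V s) ⟨⟨hs.1.le, hs.2.le⟩, by rw [hv]; constructor <;> linarith⟩
      rw [hcl]
      rw [Real.norm_eq_abs, abs_le] at hk
      have e1 : (1-(V s)^2) = η*(2-η) := by rw [hv]; ring
      rw [e1]
      have e2 : η*(2-η)*G (s, V s) ≤ η*(2-η)*K := mul_le_mul_of_nonneg_left hk.2 (mul_nonneg hηp.le (by linarith))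
      have e3 : η*(2-η)*K ≤ η*2*K := mul_le_mul_of_nonneg_right (mul_le_mul_of_nonneg_left (by linarith) hηp.le) hK0
      have e4 : d0/2*(Real.exp (-C*(s-t0))*(-C)) = -(η*C) := by rw [hη]; ring
      rw [e4, hC]; linarith
  have := key t ⟨ht, by linarith⟩
  have h2 : 0 < d0/2*Real.exp (-C*(t-t0)) := by positivity
  linarith

lemma cl_neg (x : ℝ) : cl (-1) 1 (-x) = - cl (-1) 1 x := by
  unfold cl
  rcases le_total x 1 with h1 | h1 <;> rcases le_total (-1) x with h2 | h2
  · rw [min_eq_right (by linarith : -x ≤ 1), max_eq_right (by linarith), min_eq_right h1, max_eq_right h2]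
  · rw [min_eq_left (by linarith : 1 ≤ -x), max_eq_right (by linarith), min_eq_right h1, max_eq_left h2]; norm_num
  · rw [min_eq_right (by linarith : -x ≤ 1), max_eq_left (by linarith), min_eq_left h1, max_eq_right (by norm_num)]
  · linarith

lemma trap {V : ℝ → ℝ} {G : ℝ × ℝ → ℝ} {t0 : ℝ} (hG : ContinuousOn G (Ici t0 ×ˢ Icc (-1) 1))
    (hV : ∀ t, t0 ≤ t → HasDerivWithinAt V ((1-(cl (-1) 1 (V t))^2)*G (t, cl (-1) 1 (V t))) (Ici t0) t)
    (h0 : |V t0| < 1) : ∀ t, t0 ≤ t → |V t| < 1 := by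
  rw [abs_lt] at h0
  intro t ht
  rw [abs_lt]
  refine ⟨?_, trap_up hG hV h0.2 h0.1 t ht⟩
  have := trap_up (V := fun t => -V t) (G := fun z => -G (z.1, -z.2)) (t0 := t0) ?_ ?_ (by linarith) (by linarith) t ht
  · linarith
  · apply ContinuousOn.neg
    refine hG.comp (by fun_prop) ?_
    rintro ⟨a, b⟩ ⟨h1, h2⟩
    exact ⟨h1, by constructor <;> linarith [h2.1, h2.2]⟩
  · intro s hs
    refine (hV s hs).neg.congr_deriv ?_
    rw [cl_neg]; simp

noncomputable section
def Nn (σ Z v : ℝ) : ℝ := (Z-v)^2 - σ*(1-Z*v)^2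
def Hh (k σ y Z v : ℝ) : ℝ := σ*(k*v*(1-Z*v)/Z - k*y*(1-v^2))
end

lemma wkey {k σ y e w1 Z V : ℝ} (hk : 0 < k) (hs : 0 < σ) (hy : 0 < y) (hy1 : y < 1) (he : 0 < e) (hZ : 0 < Z) (hZ1 : Z < 1)
    (hV : -1 < V) (hV1 : V < 1) (hw10 : 0 < w1) (hw : w1 ≤ (Z-V)/(1-Z*V)) (h1 : σ < w1^2)
    (h2 : σ*k*(1-y)*(1-w1^2) ≤ (1-e)*(w1^2-σ)) :
    0 < 1-Z*V ∧ 0 < Nn σ Z V ∧ (Z-V)/(1-Z*V) < 1 ∧ e ≤ 1-Hh k σ y Z V/Nn σ Z V*(1-Z^2) ∧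
    Hh k σ y Z V/Nn σ Z V ≤ σ*k/(w1^2-σ)*((1-V^2)/(1-Z*V)^2) := by
  have hp : 0 < 1-Z*V := by nlinarith
  set w := (Z-V)/(1-Z*V) with hwd
  have hzv : Z-V = w*(1-Z*V) := by rw [hwd]; field_simp
  have hw1w : w1^2 ≤ w^2 := pow_le_pow_left₀ hw10.le hw 2
  have hN : Nn σ Z V = (1-Z*V)^2*(w^2-σ) := by unfold Nn; rw [hzv]; ring
  have hd : 0 < w^2-σ := by linarith
  have hNp : 0 < Nn σ Z V := by rw [hN]; positivity
  have how : 1-w^2 = (1-V^2)*(1-Z^2)/(1-Z*V)^2 := by rw [hwd]; field_simp; ring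
  have hZ2 : 0 < 1-Z^2 := by nlinarith
  have hV2 : 0 < 1-V^2 := by nlinarith
  have how' : 0 < 1-w^2 := by rw [how]; positivity
  have hwlt : w < 1 := by nlinarith
  have hw0 : 0 < w := by linarith
  have hS : 1-w/Z = V*(1-Z^2)/(Z*(1-Z*V)) := by rw [hwd]; field_simp; ring
  have ha : Hh k σ y Z V/Nn σ Z V*(1-Z^2) = σ*k*((1-w/Z)-y*(1-w^2))/(w^2-σ) := by
    rw [hN, hS, how]; unfold Hh; field_simp
  have hSle : 1-w/Z ≤ 1-w^2 := by
    have : w^2 ≤ w/Z := by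
      rw [le_div_iff₀ hZ]; nlinarith
    linarith
  have hd1 : 0 < w1^2-σ := by linarith
  refine ⟨hp, hNp, hwlt, ?_, ?_⟩
  · rw [ha]
    have : σ*k*((1-w/Z)-y*(1-w^2))/(w^2-σ) ≤ 1-e := by
      rw [div_le_iff₀ hd]
      have e1 : σ*k*((1-w/Z)-y*(1-w^2)) ≤ σ*k*((1-y)*(1-w^2)) := mul_le_mul_of_nonneg_left (by linarith) (by positivity)
      have e2 : σ*k*(1-y)*(1-w^2) ≤ σ*k*(1-y)*(1-w1^2) := mul_le_mul_of_nonneg_left (by linarith) (mul_nonneg (by positivity) (by linarith))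
      have e4 : 0 < 1-w1^2 := by linarith
      have e5 : 0 ≤ (1-e)*(w1^2-σ) := (mul_nonneg (mul_nonneg (by positivity) (by linarith)) e4.le).trans h2
      have e3 : 0 ≤ 1-e := nonneg_of_mul_nonneg_left e5 hd1
      have e6 : (1-e)*(w1^2-σ) ≤ (1-e)*(w^2-σ) := mul_le_mul_of_nonneg_left (by linarith) e3
      linarith
    linarith
  · have e0 : (1-V^2)/(1-Z*V)^2 = (1-w^2)/(1-Z^2) := by rw [how]; field_simp
    rw [e0, ← mul_div_assoc, le_div_iff₀ hZ2, ha, div_le_iff₀ hd]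
    have e1 : σ*k*((1-w/Z)-y*(1-w^2)) ≤ σ*k*(1-w^2) := mul_le_mul_of_nonneg_left (by nlinarith) (by positivity)
    refine e1.trans ?_
    have e2 : σ*k/(w1^2-σ)*(w1^2-σ) = σ*k := by field_simp
    have e3 : σ*k/(w1^2-σ)*(1-w^2)*(w1^2-σ) ≤ σ*k/(w1^2-σ)*(1-w^2)*(w^2-σ) := mul_le_mul_of_nonneg_left (by linarith) (by positivity)
    have e4 : σ*k/(w1^2-σ)*(1-w^2)*(w1^2-σ) = σ*k*(1-w^2) := by rw [mul_right_comm, e2]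
    linarith

/-- a smooth cutoff of the identity from below -/
lemma cutoff {δ : ℝ} (hδ : 0 < δ) : ∃ m : ℝ → ℝ, ContDiff ℝ (⊤:ℕ∞) m ∧ (∀ s, δ/2 ≤ m s) ∧ ∀ s, δ ≤ s → m s = s := by
  refine ⟨fun s => δ/2 + (s-δ/2)*Real.smoothTransition (2*s/δ-1), ?_, fun s => ?_, fun s hs => ?_⟩
  · have : ContDiff ℝ (⊤:ℕ∞) (fun s => Real.smoothTransition (2*s/δ-1)) := Real.smoothTransition.contDiff.comp (by fun_prop)
    fun_prop
  · rcases le_total s (δ/2) with h | h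
    · have : Real.smoothTransition (2*s/δ-1) = 0 := Real.smoothTransition.zero_of_nonpos (by
        rw [sub_nonpos, div_le_one hδ]; linarith)
      simp [this]
    · have := mul_nonneg (sub_nonneg.2 h) (Real.smoothTransition.nonneg (2*s/δ-1))
      simp only; linarith
  · have : Real.smoothTransition (2*s/δ-1) = 1 := Real.smoothTransition.one_of_one_le (by
      rw [le_sub_iff_add_le, le_div_iff₀ hδ]; linarith)
    simp [this]

/-- bound past `Z=1` -/
lemma far_bound {k σ y Z V : ℝ} (hk : 0 < k) (hs : 0 < σ) (hs1 : σ < 1) (hy : 0 < y) (hZ : 1 ≤ Z) (hV : -1 < V) (hV1 : V < 1) :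
    (1-σ)*(Z-V)^2 ≤ Nn σ Z V ∧ |Hh k σ y Z V| ≤ σ*k*(1+2*y)*(Z-V) ∧ 0 < Z-V := by
  have h0 : 0 < Z-V := by linarith
  have hab : |1-Z*V| ≤ Z-V := by
    rw [abs_le]; constructor <;> nlinarith
  have hsq : (1-Z*V)^2 ≤ (Z-V)^2 := by rw [← sq_abs]; exact pow_le_pow_left₀ (abs_nonneg _) hab 2
  refine ⟨?_, ?_, h0⟩
  · unfold Nn; nlinarith
  · unfold Hh
    rw [abs_mul, abs_of_pos hs]
    have hvz : |V/Z| ≤ 1 := by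
      rw [abs_div, abs_of_pos (by linarith : 0 < Z), div_le_one (by linarith)]
      exact (abs_lt.2 ⟨hV, hV1⟩).le.trans hZ
    have e1 : |k*V*(1-Z*V)/Z| ≤ k*(Z-V) := by
      have : k*V*(1-Z*V)/Z = k*((V/Z)*(1-Z*V)) := by ring
      rw [this, abs_mul, abs_of_pos hk, abs_mul]
      apply mul_le_mul_of_nonneg_left _ hk.le
      calc |V/Z| * |1-Z*V| ≤ 1*|1-Z*V| := mul_le_mul_of_nonneg_right hvz (abs_nonneg _)
        _ ≤ Z-V := by rw [one_mul]; exact hab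
    have e2 : |k*y*(1-V^2)| ≤ k*y*(2*(Z-V)) := by
      rw [abs_mul, abs_of_pos (by positivity : 0 < k*y)]
      apply mul_le_mul_of_nonneg_left _ (by positivity)
      rw [abs_of_nonneg (by nlinarith)]; nlinarith
    have := abs_sub (k*V*(1-Z*V)/Z) (k*y*(1-V^2))
    calc σ*_ ≤ σ*(k*(Z-V)+k*y*(2*(Z-V))) := mul_le_mul_of_nonneg_left (by linarith) hs.le
      _ = _ := by ring


lemma w_deriv {V : ℝ → ℝ} {t a : ℝ} {s : Set ℝ} (hV : HasDerivWithinAt V ((1-(V t)^2)*a) s t) (hd : 1-t*V t ≠ 0) :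
    HasDerivWithinAt (fun t => (t-V t)/(1-t*V t)) ((1-(V t)^2)/(1-t*V t)^2*(1-a*(1-t^2))) s t := by
  have a1 := (hasDerivWithinAt_id t s).sub hV
  have a2 := ((hasDerivWithinAt_id t s).mul hV).const_sub 1
  refine (a1.div a2 hd).congr_deriv ?_
  simp only [id, Pi.mul_apply, Pi.sub_apply]
  rw [div_mul_eq_mul_div]
  congr 1
  ring

set_option maxHeartbeats 1000000 in
lemma phaseA {k σ y e w1 Z0 T : ℝ} {V : ℝ → ℝ} (hk : 0 < k) (hs : 0 < σ) (hy : 0 < y) (hy1 : y < 1) (he : 0 < e) (hZ0 : 0 < Z0)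
    (hZT : Z0 < T) (hT1 : T ≤ 1) (hw10 : 0 < w1) (h1 : σ < w1^2)
    (h2 : σ*k*(1-y)*(1-w1^2) ≤ (1-e)*(w1^2-σ))
    (hVa : ∀ t, Z0 ≤ t → -1 < V t ∧ V t < 1)
    (hj : w1*(1-Z0*V Z0) < Z0-V Z0)
    (hV : ∀ t ∈ Ico Z0 T, HasDerivWithinAt V ((1-(V t)^2)*(Hh k σ y t (V t)/Nn σ t (V t))) (Ici Z0) t) :
    ∀ t ∈ Ico Z0 T, w1*(1-t*V t) ≤ t-V t ∧ (1-V Z0)*Real.exp (-(2*(σ*k/(w1^2-σ))/e)) ≤ 1-V t := by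
  have hp : ∀ t ∈ Ico Z0 T, 0 < 1-t*V t := fun t ht => by
    have := hVa t ht.1; have := ht.2; have := ht.1
    nlinarith
  have hpos : ∀ t ∈ Ico Z0 T, 0 < (1-(V t)^2)/(1-t*V t)^2 := fun t ht => by
    have h3 := hVa t ht.1
    have h4 := hp t ht
    have : 0 < 1-(V t)^2 := by nlinarith
    positivity
  have hb : ∀ t ∈ Ico Z0 T, 0 < (t-V t)/(1-t*V t) - w1 := by
    refine barrier (fun t ht => (w_deriv (hV t ht) (hp t ht).ne').sub_const w1) ?_ ?_
    · rw [sub_pos, lt_div_iff₀ (hp Z0 ⟨le_rfl, hZT⟩)]; exact hj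
    · intro t ht _ hc
      have h3 := hVa t ht.1.le
      have ht' : t ∈ Ico Z0 T := ⟨ht.1.le, ht.2⟩
      have := wkey (k := k) (y := y) (e := e) hk hs hy hy1 he (by linarith [ht.1]) (by linarith [ht.2]) h3.1 h3.2 hw10 (by linarith : w1 ≤ (t-V t)/(1-t*V t)) h1 h2
      exact mul_pos (hpos t ht') (by linarith [this.2.2.2.1])
  intro t ht
  have hbt := hb t ht
  rw [sub_pos, lt_div_iff₀ (hp t ht)] at hbt
  refine ⟨hbt.le, ?_⟩
  set C := σ*k/(w1^2-σ) with hC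
  have hC0 : 0 < C := div_pos (by positivity) (by linarith)
  have hder : ∀ s ∈ Ico Z0 T, HasDerivWithinAt (fun t => Real.log (1-V t) + 2*C/e*((t-V t)/(1-t*V t)))
      (-((1-(V s)^2)*(Hh k σ y s (V s)/Nn σ s (V s)))/(1-V s) + 2*C/e*((1-(V s)^2)/(1-s*V s)^2*(1-(Hh k σ y s (V s)/Nn σ s (V s))*(1-s^2)))) (Ici Z0) s := fun s hs => by
    have h3 := hVa s hs.1
    exact (((hV s hs).const_sub 1).log (by linarith)).add ((w_deriv (hV s hs) (hp s hs).ne').const_mul _)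
  have hmono : MonotoneOn (fun t => Real.log (1-V t) + 2*C/e*((t-V t)/(1-t*V t))) (Icc Z0 t) := by
    apply monotoneOn_of_deriv_nonneg (convex_Icc _ _)
    · intro s hs
      exact (hder s ⟨hs.1, by linarith [hs.2, ht.2]⟩).continuousWithinAt.mono (fun x hx => hx.1)
    · intro s hs
      rw [interior_Icc] at hs
      exact ((hder s ⟨hs.1.le, by linarith [hs.2, ht.2]⟩).hasDerivAt (Ici_mem_nhds hs.1)).differentiableAt.differentiableWithinAt
    · intro s hs
      rw [interior_Icc] at hs
      have hs' : s ∈ Ico Z0 T := ⟨hs.1.le, by linarith [hs.2, ht.2]⟩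
      rw [((hder s hs').hasDerivAt (Ici_mem_nhds hs.1)).deriv]
      have h3 := hVa s hs'.1
      obtain ⟨-, -, -, k1, k2⟩ := wkey (k := k) (y := y) (e := e) hk ‹0 < σ› hy hy1 he (by linarith [hs'.1]) (by linarith [hs'.2]) h3.1 h3.2 hw10 (by linarith [hb s hs'] : w1 ≤ (s-V s)/(1-s*V s)) h1 h2
      have hr := hpos s hs'
      have e1 : -((1-(V s)^2)*(Hh k σ y s (V s)/Nn σ s (V s)))/(1-V s) = -((1+V s)*(Hh k σ y s (V s)/Nn σ s (V s))) := by
        have : 1-V s ≠ 0 := by linarith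
        rw [div_eq_iff this]; ring
      rw [e1]
      rw [← hC] at k2
      generalize Hh k σ y s (V s)/Nn σ s (V s) = a at *
      generalize (1-(V s)^2)/(1-s*V s)^2 = r at *
      have e2 : (1+V s)*a ≤ (1+V s)*(C*r) := mul_le_mul_of_nonneg_left k2 (by linarith)
      have e3 : (1+V s)*(C*r) ≤ 2*(C*r) := mul_le_mul_of_nonneg_right (by linarith) (by positivity)
      have e4 : 2*C/e*(r*e) ≤ 2*C/e*(r*(1-a*(1-s^2))) := mul_le_mul_of_nonneg_left (mul_le_mul_of_nonneg_left k1 hr.le) (by positivity)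
      have e5 : 2*C/e*(r*e) = 2*(C*r) := by field_simp
      linarith
  have hm := hmono ⟨le_rfl, ht.1⟩ ⟨ht.1, le_rfl⟩ ht.1
  simp only at hm
  have hZt : Z0 ∈ Ico Z0 T := ⟨le_rfl, ht.1.trans_lt ht.2⟩
  have h3 := hVa t ht.1
  have h30 := hVa Z0 le_rfl
  have hw0 : 0 < (Z0-V Z0)/(1-Z0*V Z0) := by linarith [hb Z0 hZt]
  have hwt : (t-V t)/(1-t*V t) < 1 := (wkey (k := k) (y := y) (e := e) hk hs hy hy1 he (by linarith [ht.1]) (by linarith [ht.2]) h3.1 h3.2 hw10 (by linarith [hb t ht] : w1 ≤ (t-V t)/(1-t*V t)) h1 h2).2.2.1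
  have hc : 0 < 2*C/e := by positivity
  have hl : Real.log (1-V Z0) - 2*C/e ≤ Real.log (1-V t) := by
    have := mul_lt_mul_of_pos_left hwt hc
    have := mul_pos hc hw0
    linarith
  have := Real.exp_le_exp.2 hl
  rw [sub_eq_add_neg, Real.exp_add, Real.exp_log (by linarith), Real.exp_log (by linarith)] at this
  exact this

lemma phaseB {k σ y D T : ℝ} {V : ℝ → ℝ} (hk : 0 < k) (hs : 0 < σ) (hs1 : σ < 1) (hy : 0 < y)
    (hT1 : 1 ≤ T) (hD : 0 < D) (hD' : D ≤ 1 - V 1)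
    (hVa : ∀ t, 1 ≤ t → -1 < V t ∧ V t < 1) (hc : ContinuousOn V (Icc 1 T))
    (hV : ∀ t ∈ Ioo 1 T, HasDerivAt V ((1-(V t)^2)*(Hh k σ y t (V t)/Nn σ t (V t))) t) :
    D/(1+2*σ*k*(1+2*y)/(1-σ)) ≤ T - V T := by
  set c := 2*σ*k*(1+2*y)/(1-σ) with hcd
  have h1s : 0 < 1-σ := by linarith
  have hc0 : 0 < c := by positivity
  have hmono : MonotoneOn (fun t => c*t - V t) (Icc 1 T) := by
    apply monotoneOn_of_deriv_nonneg (convex_Icc _ _)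
    · exact (continuousOn_const.mul continuousOn_id).sub hc
    · intro t ht
      rw [interior_Icc] at ht
      exact (((hasDerivAt_id t).const_mul c).sub (hV t ht)).differentiableAt.differentiableWithinAt
    · intro t ht
      rw [interior_Icc] at ht
      have hd := ((hasDerivAt_id t).const_mul c).sub (hV t ht)
      have : deriv (fun t => c*t - V t) t = c*1 - (1-(V t)^2)*(Hh k σ y t (V t)/Nn σ t (V t)) := hd.deriv
      rw [this]
      have h3 := hVa t ht.1.le
      obtain ⟨b1, b2, b3⟩ := far_bound (y := y) hk hs hs1 hy ht.1.le h3.1 h3.2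
      have hNp : 0 < Nn σ t (V t) := lt_of_lt_of_le (by positivity) b1
      have e1 : Hh k σ y t (V t) ≤ σ*k*(1+2*y)*(t-V t) := (le_abs_self _).trans b2
      have e2 : (1-(V t)^2) ≤ 2*(t-V t) := by nlinarith [ht.1]
      have e3 : 0 ≤ 1-(V t)^2 := by nlinarith
      have e4 : (1-(V t)^2)*Hh k σ y t (V t) ≤ c*Nn σ t (V t) := by
        calc _ ≤ (1-(V t)^2)*(σ*k*(1+2*y)*(t-V t)) := mul_le_mul_of_nonneg_left e1 e3
          _ ≤ 2*(t-V t)*(σ*k*(1+2*y)*(t-V t)) := mul_le_mul_of_nonneg_right e2 (by positivity)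
          _ = c*((1-σ)*(t-V t)^2) := by rw [hcd]; field_simp
          _ ≤ _ := mul_le_mul_of_nonneg_left b1 hc0.le
      rw [← mul_div_assoc, sub_nonneg, div_le_iff₀ hNp, mul_one]; exact e4
  have hm := hmono ⟨le_rfl, hT1⟩ ⟨hT1, le_rfl⟩ hT1
  simp only at hm
  have h3 := hVa T hT1
  rw [div_le_iff₀ (by positivity)]
  nlinarith

set_option maxHeartbeats 1000000 in
theorem vglobal {k σ y e w1 Z0 v0 : ℝ} (hk : 0 < k) (hs : 0 < σ) (hs1 : σ < 1) (hy : 0 < y) (hy1 : y < 1) (he : 0 < e) (hZ0 : 0 < Z0)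
    (hZ01 : Z0 < 1) (hw10 : 0 < w1) (h1 : σ < w1^2)
    (h2 : σ*k*(1-y)*(1-w1^2) ≤ (1-e)*(w1^2-σ)) (hv0 : |v0| < 1)
    (hj : w1*(1-Z0*v0) < Z0-v0) : ∃ V : ℝ → ℝ, V Z0 = v0 ∧ ∀ t, Z0 ≤ t → |V t| < 1 ∧ 0 < Nn σ t (V t) ∧
      HasDerivWithinAt V ((1-(V t)^2)*(Hh k σ y t (V t)/Nn σ t (V t))) (Ici Z0) t := by
  have hv0' := abs_lt.1 hv0
  obtain ⟨D, hD⟩ : ∃ D, D = min 1 ((1-v0)*Real.exp (-(2*(σ*k/(w1^2-σ))/e))) := ⟨_, rfl⟩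
  have hDp : 0 < D := by rw [hD]; exact lt_min one_pos (mul_pos (by linarith) (Real.exp_pos _))
  have h1s : 0 < 1-σ := by linarith
  obtain ⟨s0, hs0⟩ : ∃ s0, s0 = D/(1+2*σ*k*(1+2*y)/(1-σ)) := ⟨_, rfl⟩
  have hs0p : 0 < s0 := by rw [hs0]; positivity
  have hd1 : 0 < w1^2-σ := by linarith
  obtain ⟨δ, hδ, hδ1, hδ2⟩ : ∃ δ, 0 < δ ∧ δ < (w1^2-σ)*D^2 ∧ δ < (1-σ)*s0^2 := by
    have a1 : 0 < (w1^2-σ)*D^2 := by positivity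
    have a2 : 0 < (1-σ)*s0^2 := by positivity
    refine ⟨min ((w1^2-σ)*D^2) ((1-σ)*s0^2)/2, by have := lt_min a1 a2; linarith, ?_, ?_⟩
    · have := min_le_left ((w1^2-σ)*D^2) ((1-σ)*s0^2); linarith
    · have := min_le_right ((w1^2-σ)*D^2) ((1-σ)*s0^2); linarith
  obtain ⟨m, hm, hmlow, hmid⟩ := cutoff hδ
  have hmpos : ∀ s, 0 < m s := fun s => by linarith [hmlow s]
  set G : ℝ × ℝ → ℝ := fun z => Hh k σ y z.1 z.2/m (Nn σ z.1 z.2) with hG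
  have hGsm : ∀ z : ℝ × ℝ, z.1 ≠ 0 → ContDiffAt ℝ (⊤:ℕ∞) G z := by
    intro z hz
    have a1 : ContDiffAt ℝ (⊤:ℕ∞) (fun z : ℝ × ℝ => k*z.2*(1-z.1*z.2)/z.1) z :=
      ContDiffAt.div (by fun_prop) (by fun_prop) hz
    have a2 : ContDiffAt ℝ (⊤:ℕ∞) (fun z : ℝ × ℝ => Hh k σ y z.1 z.2) z := by
      unfold Hh
      exact contDiffAt_const.mul (a1.sub (by fun_prop))
    have a3 : ContDiffAt ℝ (⊤:ℕ∞) (fun z : ℝ × ℝ => m (Nn σ z.1 z.2)) z := by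
      have : ContDiffAt ℝ (⊤:ℕ∞) (fun z : ℝ × ℝ => Nn σ z.1 z.2) z := by unfold Nn; fun_prop
      exact hm.contDiffAt.comp z this
    exact a2.div a3 (hmpos _).ne'
  obtain ⟨Yf, Y0, Yd, -⟩ := ode_solve (fun z : ℝ × ℝ × ℝ => (1-z.2.2^2)*G (z.1, z.2.2)) (Ici Z0) Z0 0 0 (-1) 1 le_rfl (by norm_num) (mem_Ici.2 le_rfl)
    (fun s hs => ⟨hs, fun t ht => ht.1⟩) (fun s hs => ⟨s+1, by have := mem_Ici.1 hs; exact mem_Ici.2 (by linarith), by linarith⟩)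
    (fun t ht p hp yy hy => by
      have ht' : Z0 ≤ t := ht
      have a1 := hGsm (t, yy) (by simp only; linarith)
      have a2 : ContDiffAt ℝ (⊤:ℕ∞) (fun z : ℝ × ℝ × ℝ => (z.1, z.2.2)) (t, p, yy) := by fun_prop
      have a3 := ContDiffAt.comp (t, p, yy) (g := G) a1 a2
      have a4 : ContDiffAt ℝ (⊤:ℕ∞) (fun z : ℝ × ℝ × ℝ => 1-z.2.2^2) (t, p, yy) := by fun_prop
      exact (a4.mul a3).of_le (by exact_mod_cast le_top))
    (fun _ => v0) continuousOn_const
  set V := Yf 0 with hVdef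
  have V0 : V Z0 = v0 := Y0 0 (by simp)
  have Vd : ∀ t, Z0 ≤ t → HasDerivWithinAt V ((1-(cl (-1) 1 (V t))^2)*G (t, cl (-1) 1 (V t))) (Ici Z0) t := fun t ht => Yd 0 (by simp) t ht
  have hVa : ∀ t, Z0 ≤ t → |V t| < 1 := by
    refine trap (G := G) ?_ Vd (by rw [V0]; exact hv0)
    rintro z ⟨hz, -⟩
    have hz' : Z0 ≤ z.1 := hz
    exact (hGsm z (by linarith)).continuousAt.continuousWithinAt
  have hVa' : ∀ t, Z0 ≤ t → -1 < V t ∧ V t < 1 := fun t ht => abs_lt.1 (hVa t ht)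
  have Vc : ContinuousOn V (Ici Z0) := fun t ht => (Vd t ht).continuousWithinAt
  have Vd' : ∀ t, Z0 ≤ t → δ < Nn σ t (V t) → HasDerivWithinAt V ((1-(V t)^2)*(Hh k σ y t (V t)/Nn σ t (V t))) (Ici Z0) t := by
    intro t ht hn
    have := Vd t ht
    rw [cl_eq ⟨(hVa' t ht).1.le, (hVa' t ht).2.le⟩] at this
    simp only [hG] at this
    rwa [hmid _ hn.le] at this
  have hnc : ContinuousOn (fun t => Nn σ t (V t)) (Ici Z0) := by
    unfold Nn
    exact ((continuousOn_id.sub Vc).pow 2).sub (continuousOn_const.mul ((continuousOn_const.sub (continuousOn_id.mul Vc)).pow 2))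
  -- the estimate for Z ≤ 1
  have estA : ∀ T, Z0 ≤ T → T ≤ 1 → w1*(1-T*V T) ≤ T-V T → D ≤ 1-V T → δ < Nn σ T (V T) := by
    intro T hT hT1 a1 a2
    have h3 := hVa' T hT
    have a3 : D ≤ 1-T*V T := by
      rcases le_total 0 (V T) with h | h
      · have : T*V T ≤ 1*V T := mul_le_mul_of_nonneg_right hT1 h
        linarith
      · have : T*V T ≤ 0 := mul_nonpos_of_nonneg_of_nonpos (by linarith) h
        have : D ≤ 1 := by rw [hD]; exact min_le_left _ _
        linarith
    refine hδ1.trans_le ?_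
    have a4 : (w1*(1-T*V T))^2 ≤ (T-V T)^2 := pow_le_pow_left₀ (mul_nonneg hw10.le (by linarith)) a1 2
    have a5 : D^2 ≤ (1-T*V T)^2 := pow_le_pow_left₀ hDp.le a3 2
    have a6 := mul_le_mul_of_nonneg_left a5 hd1.le
    unfold Nn
    rw [mul_pow] at a4
    linarith
  have hclos : ∀ T, Z0 ≤ T → T ≤ 1 → (∀ t ∈ Ico Z0 T, δ < Nn σ t (V t)) → w1*(1-T*V T) ≤ T-V T ∧ D ≤ 1-V T := by
    intro T hT hT1 hn
    rcases eq_or_lt_of_le hT with h | h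
    · rw [← h, V0]; refine ⟨hj.le, ?_⟩
      rw [hD]
      refine (min_le_right _ _).trans ?_
      have : Real.exp (-(2*(σ*k/(w1^2-σ))/e)) ≤ 1 := Real.exp_le_one_iff.2 (by
        have : 0 < 2*(σ*k/(w1^2-σ))/e := by positivity
        linarith)
      have := mul_le_mul_of_nonneg_left this (by linarith : 0 ≤ 1-v0)
      linarith
    · have hA := phaseA (k := k) (y := y) hk hs hy hy1 he hZ0 h hT1 hw10 h1 h2 hVa' (by rw [V0]; exact hj) (fun t ht => Vd' t ht.1 (hn t ht))
      rw [V0] at hA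
      have hcl : closure (Ico Z0 T) = Icc Z0 T := closure_Ico h.ne
      have hVc : ContinuousOn V (closure (Ico Z0 T)) := Vc.mono (by rw [hcl]; exact fun x hx => hx.1)
      have hTm : T ∈ closure (Ico Z0 T) := by rw [hcl]; exact ⟨hT, le_rfl⟩
      constructor
      · exact le_on_closure (fun t ht => (hA t ht).1) (continuousOn_const.mul (continuousOn_const.sub (continuousOn_id.mul hVc))) (continuousOn_id.sub hVc) hTm
      · refine le_on_closure (f := fun _ => D) (g := fun t => 1-V t) (fun t ht => ?_) continuousOn_const (continuousOn_const.sub hVc) hTm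
        rw [hD]; exact (min_le_right _ _).trans (hA t ht).2
  have boot : ∀ b, ∀ t ∈ Ico Z0 b, δ < Nn σ t (V t) := by
    intro b
    refine bootstrap (hnc.mono fun x hx => hx.1) ?_ ?_
    · have := hclos Z0 le_rfl hZ01.le (fun t ht => absurd ht.2 (not_lt.2 ht.1))
      exact estA Z0 le_rfl hZ01.le this.1 this.2
    · intro T hT hn
      rcases le_total T 1 with h | h
      · have := hclos T hT.1 h hn
        exact estA T hT.1 h this.1 this.2
      · have hb := hclos 1 hZ01.le le_rfl (fun t ht => hn t ⟨ht.1, by linarith [ht.2]⟩)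
        have := phaseB (k := k) (y := y) hk hs hs1 hy h hDp hb.2 (fun t ht => hVa' t (by linarith)) (Vc.mono fun x hx => by
          have := hx.1; exact mem_Ici.2 (by linarith)) (fun t ht => (Vd' t (by linarith [ht.1]) (hn t ⟨by linarith [ht.1], ht.2⟩)).hasDerivAt (Ici_mem_nhds (by linarith [ht.1])))
        rw [← hs0] at this
        have h3 := hVa' T hT.1
        have b1 := (far_bound (k := k) (y := y) hk hs hs1 hy h h3.1 h3.2).1
        have b2 : s0^2 ≤ (T-V T)^2 := pow_le_pow_left₀ hs0p.le this 2
        have := mul_le_mul_of_nonneg_left b2 h1s.le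
        linarith
  refine ⟨V, V0, fun t ht => ?_⟩
  have hn := boot (t+1) t ⟨ht, by linarith⟩
  exact ⟨hVa t ht, hδ.trans hn, Vd' t ht hn⟩


structure VP (k σ y ε : ℝ) (ψ : ℝ → ℝ) : Prop where
  hk : 1 ≤ k
  hs0 : 0 < σ
  hs1 : σ < 1
  y0 : 0 < y
  y1 : y < 1/2
  hε : 0 < ε
  sm : ContDiffOn ℝ (⊤:ℕ∞) ψ (Ioi (-ε))
  lt : ∀ Z, -ε < Z → |Z*ψ Z| < 1
  ode : ∀ Z, 0 < Z → ∃ v', HasDerivAt (fun Z => Z*ψ Z) v' Z ∧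
      v'*(σ*(1-Z*(Z*ψ Z))^2-(Z-Z*ψ Z)^2) = σ*(1-(Z*ψ Z)^2)*(k*y*(1-(Z*ψ Z)^2)-k*ψ Z*(1-Z*(Z*ψ Z)))

lemma field_z_smooth {k σ y : ℝ} {z : ℝ × ℝ} (hz : z.1 ≠ 0) (hn : Nn σ z.1 z.2 ≠ 0) :
    ContDiffAt ℝ (⊤:ℕ∞) (fun z : ℝ × ℝ => (1-z.2^2)*(Hh k σ y z.1 z.2/Nn σ z.1 z.2)) z := by
  have a1 : ContDiffAt ℝ (⊤:ℕ∞) (fun z : ℝ × ℝ => k*z.2*(1-z.1*z.2)/z.1) z :=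
    ContDiffAt.div (by fun_prop) (by fun_prop) hz
  have a2 : ContDiffAt ℝ (⊤:ℕ∞) (fun z : ℝ × ℝ => Hh k σ y z.1 z.2) z := by
    unfold Hh
    exact contDiffAt_const.mul (a1.sub (by fun_prop))
  have a3 : ContDiffAt ℝ (⊤:ℕ∞) (fun z : ℝ × ℝ => Nn σ z.1 z.2) z := by unfold Nn; fun_prop
  have a4 : ContDiffAt ℝ (⊤:ℕ∞) (fun z : ℝ × ℝ => 1-z.2^2) z := by fun_prop
  exact a4.mul (a2.div a3 hn)

set_option maxHeartbeats 1000000 in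
theorem vprofile {k σ y e ε xe : ℝ} {g : ℝ → ℝ} (X : XP k σ y e ε xe g) : ∃ ε0 ψ, VP k σ y ε0 ψ := by
  have hs0 := X.hs0; have hs1 := X.hs1; have hk := X.hk
  obtain ⟨ψ, Z0, Z2, hZ0, hZ02, hZ21, hsm, hlt, hode, hj⟩ := zlocal X
  set x1 := k*(1-y)/(1-e) with hx1
  have he1 : 0 < 1-e := by linarith [X.e1]
  have hx1p : 0 < x1 := div_pos (mul_pos (by linarith) (by linarith [X.y1])) he1
  have h1x : 0 < 1+σ*x1 := by positivity
  have hth : 0 < th σ x1 := by unfold th; positivity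
  have hsq : (√(th σ x1))^2 = th σ x1 := Real.sq_sqrt hth.le
  have hts : th σ x1 - σ = σ*x1*(1-th σ x1) := by rw [one_sub_th h1x.ne']; unfold th; field_simp; ring
  have hot : 0 < 1-th σ x1 := by rw [one_sub_th h1x.ne']; exact div_pos (by linarith) h1x
  have hx1e : x1*(1-e) = k*(1-y) := by rw [hx1]; field_simp
  have hm0 : Z0 ∈ Ioo (-Z2) Z2 := ⟨by linarith, hZ02⟩
  have hgt : σ < (√(th σ x1))^2 := by rw [hsq]; have : 0 < σ*x1*(1-th σ x1) := by positivity
                                      linarith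
  obtain ⟨V, V0, hV⟩ := vglobal (k := k) (y := y) (e := e) (by linarith) hs0 hs1 X.y0 (by linarith [X.y1]) X.e0 hZ0 (by linarith) (Real.sqrt_pos.2 hth)
    hgt (by rw [hsq, hts]; apply le_of_eq; linear_combination (-σ*(1-th σ x1))*hx1e) (hlt Z0 hm0) hj
  set F : ℝ × ℝ → ℝ := fun z => (1-z.2^2)*(Hh k σ y z.1 z.2/Nn σ z.1 z.2) with hF
  have hψc : ∀ Z ∈ Ioo (-Z2) Z2, ContinuousAt ψ Z := fun Z hZ => hsm.continuousOn.continuousAt (isOpen_Ioo.mem_nhds hZ)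
  have hnc : ContinuousAt (fun Z => Nn σ Z (Z*ψ Z)) Z0 := by
    have := hψc Z0 hm0
    unfold Nn; fun_prop
  have hn0 : 0 < Nn σ Z0 (Z0*ψ Z0) := by rw [← V0]; exact (hV Z0 le_rfl).2.1
  obtain ⟨η, hη, hη'⟩ := Metric.eventually_nhds_iff.1 (hnc.eventually (lt_mem_nhds hn0))
  set a := max 0 (Z0-η) with ha
  set c := min Z2 (Z0+η) with hc
  have haZ : a < Z0 := max_lt hZ0 (by linarith)
  have hcZ : Z0 < c := lt_min hZ02 (by linarith)
  have ha0 : 0 ≤ a := le_max_left _ _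
  have hc2 : c ≤ Z2 := min_le_left _ _
  have hnn : ∀ t ∈ Ioo a c, 0 < Nn σ t (t*ψ t) := fun t ht => hη' (by
    rw [Real.dist_eq, abs_lt]; constructor
    · linarith [ht.1, le_max_right 0 (Z0-η)]
    · linarith [ht.2, min_le_right Z2 (Z0+η)])
  have hHh : ∀ Z p : ℝ, Z ≠ 0 → Hh k σ y Z (Z*p) = σ*(k*p*(1-Z*(Z*p))-k*y*(1-(Z*p)^2)) := fun Z p hZ => by
    unfold Hh; field_simp
  have hloc : ∀ t ∈ Ioo a c, HasDerivAt (fun Z => Z*ψ Z) (F (t, t*ψ t)) t := by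
    intro t ht
    obtain ⟨v', h1, h2⟩ := hode t ⟨by linarith [ht.1], by linarith [ht.2]⟩
    refine h1.congr_deriv ?_
    have h3 := hnn t ht
    simp only [hF]
    rw [← mul_div_assoc, eq_div_iff h3.ne', hHh t (ψ t) (by linarith [ht.1])]
    unfold Nn
    linear_combination -h2
  obtain ⟨q1, q2, q3⟩ := ode_glue (F := F) (y1 := fun Z => Z*ψ Z) (y2 := V) (J := Ici Z0) haZ hcZ
    (fun s hs _ => ⟨s+1, by have := mem_Ici.1 hs; exact mem_Ici.2 (by linarith), by linarith⟩) V0.symm (mem_Ici.2 le_rfl) hloc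
    (fun t ht => (hV t ht).2.2)
  set v : ℝ → ℝ := fun t => if t ≤ Z0 then t*ψ t else V t with hv
  change ∀ t ≤ Z0, v t = t*ψ t at q1
  change ∀ t ≥ Z0, v t = V t at q2
  change ∀ t, a < t → (t ≤ Z0 ∨ t ∈ Ici Z0) → HasDerivAt v (F (t, v t)) t at q3
  have q3' : ∀ t, a < t → HasDerivAt v (F (t, v t)) t := fun t ht => q3 t ht (le_total t Z0)
  have hnv : ∀ t, a < t → 0 < Nn σ t (v t) := by
    intro t ht
    rcases le_total t Z0 with h | h
    · rw [q1 t h]; exact hnn t ⟨ht, by linarith⟩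
    · rw [q2 t h]; exact (hV t h).2.1
  have hvsm : ContDiffOn ℝ (⊤:ℕ∞) v (Ioi a) := ode_smooth (F := F) isOpen_Ioi (fun t ht => q3' t ht)
    (fun t ht => field_z_smooth (by have := mem_Ioi.1 ht; simp only; linarith) (hnv t ht).ne')
  set ψf : ℝ → ℝ := fun t => if t ≤ Z0 then ψ t else V t/t with hψf
  have hψ1 : ∀ t, t ≤ Z0 → ψf t = ψ t := fun t ht => by simp [hψf, ht]
  have hψv : ∀ t, t*ψf t = v t := fun t => by
    rcases le_or_gt t Z0 with h | h
    · rw [hψ1 t h, q1 t h]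
    · simp only [hψf, hv, if_neg (not_le.2 h)]
      have : t ≠ 0 := by linarith
      field_simp
  have hψ2 : ∀ t, a < t → ψf t = v t/t := fun t ht => by
    rw [← hψv]; have : t ≠ 0 := by linarith
    field_simp
  have hfun : (fun Z => Z*ψf Z) = v := funext hψv
  refine ⟨Z2, ψf, hk, hs0, hs1, X.y0, X.y1, by linarith, ?_, ?_, ?_⟩
  · intro t ht
    have ht' : -Z2 < t := ht
    apply ContDiffAt.contDiffWithinAt
    rcases lt_or_ge t Z0 with h | h
    · have h1 : ContDiffAt ℝ (⊤:ℕ∞) ψ t := hsm.contDiffAt (isOpen_Ioo.mem_nhds ⟨ht', by linarith⟩)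
      refine h1.congr_of_eventuallyEq ?_
      filter_upwards [Iio_mem_nhds h] with s hs using hψ1 s (le_of_lt hs)
    · have hta : a < t := by linarith
      have h1 : ContDiffAt ℝ (⊤:ℕ∞) v t := hvsm.contDiffAt (Ioi_mem_nhds hta)
      have h2 : ContDiffAt ℝ (⊤:ℕ∞) (fun t => v t/t) t := h1.div contDiffAt_id (ne_of_gt (by linarith : 0 < t))
      refine h2.congr_of_eventuallyEq ?_
      filter_upwards [Ioi_mem_nhds hta] with s hs using hψ2 s hs
  · intro t ht
    rw [hψv]
    rcases le_total t Z0 with h | h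
    · rw [q1 t h]; exact hlt t ⟨ht, by linarith⟩
    · rw [q2 t h]; exact (hV t h).1
  · intro t ht
    rcases lt_or_ge t Z0 with h | h
    · obtain ⟨v', h1, h2⟩ := hode t ⟨ht, by linarith⟩
      refine ⟨v', ?_, ?_⟩
      · rw [hfun]
        refine h1.congr_of_eventuallyEq ?_
        filter_upwards [Iio_mem_nhds h] with s hs using q1 s (le_of_lt hs)
      · rw [hψ1 t h.le]; exact h2
    · have hta : a < t := by linarith
      refine ⟨_, by rw [hfun]; exact q3' t hta, ?_⟩
      have h3 := hnv t hta
      rw [← hψv] at h3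
      simp only [hF]
      rw [← hψv t, hHh t (ψf t) ht.ne']
      have h4 : Nn σ t (t*ψf t) = -(σ*(1-t*(t*ψf t))^2-(t-t*ψf t)^2) := by unfold Nn; ring
      rw [h4] at h3 ⊢
      generalize σ*(1-t*(t*ψf t))^2-(t-t*ψf t)^2 = n at *
      have : n ≠ 0 := by linarith
      field_simp
      ring


lemma lim_of_bound {f f' : ℝ → ℝ} {C : ℝ} (h : ∀ Z, 2 ≤ Z → HasDerivAt f (f' Z) Z)
    (hb : ∀ Z, 2 ≤ Z → |f' Z| ≤ C/Z^2) : ∃ L, Tendsto f atTop (𝓝 L) := by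
  have hC : 0 ≤ C := by
    have := (abs_nonneg _).trans (hb 2 le_rfl); norm_num at this; linarith
  have hi : ∀ Z : ℝ, 2 ≤ Z → HasDerivAt (fun Z : ℝ => C/Z) (-(C/Z^2)) Z := by
    intro Z hZ
    have := (hasDerivAt_inv (by linarith : Z ≠ 0)).const_mul C
    have h2 : HasDerivAt (fun Z : ℝ => C/Z) (C*(-(Z^2)⁻¹)) Z := by simpa [div_eq_mul_inv] using this
    exact h2.congr_deriv (by rw [div_eq_mul_inv]; ring)
  have d1 : ∀ Z, 2 ≤ Z → HasDerivAt (fun Z => f Z + C/Z) (f' Z + -(C/Z^2)) Z := fun Z hZ => (h Z hZ).add (hi Z hZ)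
  have d2 : ∀ Z, 2 ≤ Z → HasDerivAt (fun Z => f Z - C/Z) (f' Z - -(C/Z^2)) Z := fun Z hZ => (h Z hZ).sub (hi Z hZ)
  have an : AntitoneOn (fun Z => f Z + C/Z) (Ici 2) := by
    refine antitoneOn_of_deriv_nonpos (convex_Ici _) (fun Z hZ => (d1 Z hZ).continuousAt.continuousWithinAt) ?_ ?_
    · intro Z hZ; rw [interior_Ici] at hZ; exact (d1 Z (le_of_lt hZ)).differentiableAt.differentiableWithinAt
    · intro Z hZ; rw [interior_Ici] at hZ; rw [(d1 Z (le_of_lt hZ)).deriv]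
      linarith [(abs_le.1 (hb Z (le_of_lt hZ))).2]
  have mo : MonotoneOn (fun Z => f Z - C/Z) (Ici 2) := by
    refine monotoneOn_of_deriv_nonneg (convex_Ici _) (fun Z hZ => (d2 Z hZ).continuousAt.continuousWithinAt) ?_ ?_
    · intro Z hZ; rw [interior_Ici] at hZ; exact (d2 Z (le_of_lt hZ)).differentiableAt.differentiableWithinAt
    · intro Z hZ; rw [interior_Ici] at hZ; rw [(d2 Z (le_of_lt hZ)).deriv]
      linarith [(abs_le.1 (hb Z (le_of_lt hZ))).1]
  set G : ℝ → ℝ := fun Z => f (max 2 Z) + C/(max 2 Z) with hG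
  have aG : Antitone G := fun a b hab => an (le_max_left 2 a) (le_max_left 2 b) (max_le_max le_rfl hab)
  have bG : BddBelow (range G) := by
    refine ⟨f 2 - C/2, ?_⟩
    rintro _ ⟨Z, rfl⟩
    have h2 : (2:ℝ) ≤ max 2 Z := le_max_left _ _
    have m := mo (self_mem_Ici) h2 h2
    have : 0 ≤ C/(max 2 Z) := by positivity
    simp only [hG] at *
    linarith
  have t := tendsto_atTop_ciInf aG bG
  have t2 : Tendsto (fun Z : ℝ => C/Z) atTop (𝓝 0) := tendsto_const_nhds.div_atTop tendsto_id
  refine ⟨_, (t.sub t2).congr' ?_⟩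
  filter_upwards [eventually_ge_atTop (2:ℝ)] with Z hZ
  simp only [hG, max_eq_right hZ]; ring

structure FP (k σ y ε : ℝ) (ψ φ R γ : ℝ → ℝ) : Prop where
  V : VP k σ y ε ψ
  sR : ContDiffOn ℝ (⊤:ℕ∞) R (Ioi (-ε))
  sγ : ContDiffOn ℝ (⊤:ℕ∞) γ (Ioi (-ε))
  γ0 : ∀ Z, -ε < Z → 0 < γ Z
  γ1 : ∀ Z, -ε < Z → (γ Z)^2*(1-(Z*ψ Z)^2) = 1
  dγ : ∀ Z, -ε < Z → HasDerivAt γ (Z*ψ Z*φ Z*γ Z) Z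
  dv : ∀ Z, -ε < Z → HasDerivAt (fun Z => Z*ψ Z) (φ Z*(1-(Z*ψ Z)^2)) Z
  o : ∀ Z, 0 < Z → φ Z*((Z-Z*ψ Z)^2-σ*(1-Z*(Z*ψ Z))^2) = σ*(k*ψ Z*(1-Z*(Z*ψ Z))-k*y*(1-(Z*ψ Z)^2))
  A : ∀ Z, 0 < Z → (1-Z*(Z*ψ Z))*R Z = (1+σ)/σ*φ Z*(Z-Z*ψ Z) + k*y*(1+σ)*(Z*ψ Z)
  D : ∀ Z, 0 < Z → (Z-Z*ψ Z)*R Z = (1+σ)*(φ Z*(1-Z*(Z*ψ Z))+k*ψ Z-k*y)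

lemma AD_pos {Z v : ℝ} (hv : |v| < 1) : 0 < (1-Z*v)^2+(Z-v)^2 := by
  have h := abs_lt.1 hv
  have h1 : 0 < 1-v^2 := by nlinarith
  have : (1-Z*v)^2+(Z-v)^2 = (1-Z*v)^2+(Z-v)^2 := rfl
  by_contra hc
  have e2 : Z - v = 0 := by nlinarith [sq_nonneg (1-Z*v), sq_nonneg (Z-v)]
  have e1 : 1 - Z*v = 0 := by nlinarith [sq_nonneg (1-Z*v), sq_nonneg (Z-v)]
  have : Z = v := by linarith
  subst this
  nlinarith

lemma solveR {A D X1 X2 : ℝ} (h : 0 < A^2+D^2) (e : D*X2 = A*X1) :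
    A*((A*X2+D*X1)/(A^2+D^2)) = X2 ∧ D*((A*X2+D*X1)/(A^2+D^2)) = X1 := by
  constructor
  · rw [← mul_div_assoc, div_eq_iff h.ne']; linear_combination (-D)*e
  · rw [← mul_div_assoc, div_eq_iff h.ne']; linear_combination A*e

lemma alg_e {k σ y Z p v φ : ℝ} (hs : 0 < σ) 
    (o : φ*((Z-v)^2-σ*(1-Z*v)^2) = σ*(k*p*(1-Z*v)-k*y*(1-v^2))) :
    (Z-v)*((1+σ)/σ*φ*(Z-v) + k*y*(1+σ)*v) = (1-Z*v)*((1+σ)*(φ*(1-Z*v)+k*p-k*y)) := by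
  field_simp
  linear_combination o

set_option maxHeartbeats 1000000 in
theorem fprofile {k σ y ε : ℝ} {ψ : ℝ → ℝ} (V : VP k σ y ε ψ) : ∃ φ R γ, FP k σ y ε ψ φ R γ := by
  have hs0 := V.hs0
  set v : ℝ → ℝ := fun Z => Z*ψ Z with hv
  have sv : ContDiffOn ℝ (⊤:ℕ∞) v (Ioi (-ε)) := contDiffOn_id.mul V.sm
  have sdv : ContDiffOn ℝ (⊤:ℕ∞) (deriv v) (Ioi (-ε)) := ((contDiffOn_infty_iff_deriv_of_isOpen isOpen_Ioi).1 sv).2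
  have w0 : ∀ Z, -ε < Z → 0 < 1 - (v Z)^2 := by
    intro Z hZ
    have := abs_lt.1 (V.lt Z hZ)
    change -1 < v Z ∧ v Z < 1 at this
    nlinarith
  have dv0 : ∀ Z, -ε < Z → HasDerivAt v (deriv v Z) Z := fun Z hZ =>
    (((sv.contDiffAt (Ioi_mem_nhds hZ))).differentiableAt (by simp)).hasDerivAt
  have sw : ContDiffOn ℝ (⊤:ℕ∞) (fun Z => 1-(v Z)^2) (Ioi (-ε)) := contDiffOn_const.sub (sv.pow 2)
  set φ : ℝ → ℝ := fun Z => deriv v Z/(1-(v Z)^2) with hφ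
  have sφ : ContDiffOn ℝ (⊤:ℕ∞) φ (Ioi (-ε)) := sdv.div sw (fun Z hZ => (w0 Z hZ).ne')
  have dφ : ∀ Z, -ε < Z → deriv v Z = φ Z*(1-(v Z)^2) := fun Z hZ => by
    simp only [hφ]; rw [div_mul_cancel₀ _ (w0 Z hZ).ne']
  set γ : ℝ → ℝ := fun Z => (√(1-(v Z)^2))⁻¹ with hγ
  have ssq : ContDiffOn ℝ (⊤:ℕ∞) (fun Z => √(1-(v Z)^2)) (Ioi (-ε)) := sw.sqrt (fun Z hZ => (w0 Z hZ).ne')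
  have sγ : ContDiffOn ℝ (⊤:ℕ∞) γ (Ioi (-ε)) := ssq.inv (fun Z hZ => (Real.sqrt_pos.2 (w0 Z hZ)).ne')
  set A : ℝ → ℝ := fun Z => 1-Z*v Z with hA
  set D : ℝ → ℝ := fun Z => Z-v Z with hD
  set X1 : ℝ → ℝ := fun Z => (1+σ)*(φ Z*A Z+k*ψ Z-k*y) with hX1
  set X2 : ℝ → ℝ := fun Z => (1+σ)/σ*φ Z*D Z+k*y*(1+σ)*v Z with hX2
  have sA : ContDiffOn ℝ (⊤:ℕ∞) A (Ioi (-ε)) := contDiffOn_const.sub (contDiffOn_id.mul sv)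
  have sD : ContDiffOn ℝ (⊤:ℕ∞) D (Ioi (-ε)) := contDiffOn_id.sub sv
  have sX1 : ContDiffOn ℝ (⊤:ℕ∞) X1 (Ioi (-ε)) :=
    contDiffOn_const.mul (((sφ.mul sA).add (contDiffOn_const.mul V.sm)).sub contDiffOn_const)
  have sX2 : ContDiffOn ℝ (⊤:ℕ∞) X2 (Ioi (-ε)) :=
    ((contDiffOn_const.mul sφ).mul sD).add (contDiffOn_const.mul sv)
  have hAD : ∀ Z, -ε < Z → 0 < (A Z)^2+(D Z)^2 := fun Z hZ => AD_pos (V.lt Z hZ)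
  have o : ∀ Z, 0 < Z → φ Z*((Z-v Z)^2-σ*(1-Z*(v Z))^2) = σ*(k*ψ Z*(1-Z*(v Z))-k*y*(1-(v Z)^2)) := by
    intro Z hZ
    have hZ' : -ε < Z := by linarith [V.hε]
    obtain ⟨v', h1, h2⟩ := V.ode Z hZ
    have h3 : v' = φ Z*(1-(v Z)^2) := by rw [← dφ Z hZ']; exact h1.deriv.symm
    change v'*(σ*(1-Z*v Z)^2-(Z-v Z)^2) = σ*(1-(v Z)^2)*(k*y*(1-(v Z)^2)-k*ψ Z*(1-Z*v Z)) at h2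
    rw [h3] at h2
    apply mul_left_cancel₀ (w0 Z hZ').ne'
    linear_combination -h2
  have key : ∀ Z, 0 < Z → D Z*X2 Z = A Z*X1 Z := fun Z hZ => alg_e hs0 (o Z hZ)
  refine ⟨φ, fun Z => (A Z*X2 Z+D Z*X1 Z)/((A Z)^2+(D Z)^2), γ, V, ?_, sγ, ?_, ?_, ?_, ?_, o, ?_, ?_⟩
  · exact ((sA.mul sX2).add (sD.mul sX1)).div ((sA.pow 2).add (sD.pow 2)) (fun Z hZ => (hAD Z hZ).ne')
  · intro Z hZ; exact inv_pos.2 (Real.sqrt_pos.2 (w0 Z hZ))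
  · intro Z hZ
    change ((√(1-(v Z)^2))⁻¹)^2*(1-(v Z)^2) = 1
    rw [inv_pow, Real.sq_sqrt (w0 Z hZ).le, inv_mul_cancel₀ (w0 Z hZ).ne']
  · intro Z hZ
    have d1 : HasDerivAt (fun Z => 1-(v Z)^2) (-(2*v Z*(φ Z*(1-(v Z)^2)))) Z := by
      have := ((dv0 Z hZ).pow 2).const_sub 1
      exact HasDerivAt.congr_deriv this (by rw [dφ Z hZ]; simp)
    have d2 := (d1.sqrt (w0 Z hZ).ne').inv (Real.sqrt_pos.2 (w0 Z hZ)).ne'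
    have hsq := Real.sq_sqrt (w0 Z hZ).le
    have hsp := Real.sqrt_pos.2 (w0 Z hZ)
    have d3 : HasDerivAt γ _ Z := d2
    refine d3.congr_deriv ?_
    symm
    change v Z*φ Z*(√(1-(v Z)^2))⁻¹ = _
    generalize √(1-(v Z)^2) = s at hsq hsp ⊢
    rw [← hsq]
    field_simp
  · intro Z hZ
    have := dv0 Z hZ
    rw [dφ Z hZ] at this; exact this
  · intro Z hZ; exact (solveR (hAD Z (by linarith [V.hε])) (key Z hZ)).1
  · intro Z hZ; exact (solveR (hAD Z (by linarith [V.hε])) (key Z hZ)).2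


lemma AD_bds {Z v : ℝ} (hZ : 2 ≤ Z) (hv : |v| < 1) : |1-Z*v| ≤ Z-v ∧ Z/2 ≤ Z-v ∧ Z-v ≤ 2*Z := by
  have h := abs_lt.1 hv
  refine ⟨abs_le.2 ⟨by nlinarith, by nlinarith⟩, by linarith, by linarith⟩

lemma phi_bound {k σ y Z p v φ : ℝ} (hk : 1 ≤ k) (hs : 0 < σ) (hs1 : σ < 1) (hy : 0 < y) (hZ : 2 ≤ Z)
    (hvp : v = Z*p) (hv : |v| < 1)
    (o : φ*((Z-v)^2-σ*(1-Z*v)^2) = σ*(k*p*(1-Z*v)-k*y*(1-v^2))) :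
    |φ| ≤ (4*σ*(2*k+k*y)/(1-σ))/Z^2 := by
  obtain ⟨a1, a2, a3⟩ := AD_bds hZ hv
  have hv2 : |v| ≤ 1 := hv.le
  have hZ0 : 0 < Z := by linarith
  have pA : |p*(1-Z*v)| ≤ 2 := by
    have e : Z*|p*(1-Z*v)| = |v| * |1-Z*v| := by
      rw [hvp, abs_mul, abs_mul, abs_of_pos hZ0]; ring
    have : |v| * |1-Z*v| ≤ 1*(2*Z) := mul_le_mul hv2 (a1.trans a3) (abs_nonneg _) zero_le_one
    nlinarith
  have v1 : |1-v^2| ≤ 1 := by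
    have h := abs_lt.1 hv
    exact abs_le.2 ⟨by nlinarith, by nlinarith⟩
  have hky : 0 < k*y := by nlinarith
  have r : |σ*(k*p*(1-Z*v)-k*y*(1-v^2))| ≤ σ*(2*k+k*y) := by
    rw [abs_mul, abs_of_pos hs]
    refine mul_le_mul_of_nonneg_left ?_ hs.le
    have e1 : |k*p*(1-Z*v)| ≤ 2*k := by
      rw [mul_assoc, abs_mul, abs_of_pos (by linarith : 0 < k)]; nlinarith
    have e2 : |k*y*(1-v^2)| ≤ k*y := by
      rw [abs_mul, abs_of_pos hky]; nlinarith
    exact (abs_sub _ _).trans (add_le_add e1 e2)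
  have A2 : (1-Z*v)^2 ≤ (Z-v)^2 := by
    rw [← sq_abs]; exact pow_le_pow_left₀ (abs_nonneg _) a1 2
  have D2 : (Z/2)^2 ≤ (Z-v)^2 := pow_le_pow_left₀ (by positivity) a2 2
  have N1 : (1-σ)*(Z/2)^2 ≤ (Z-v)^2-σ*(1-Z*v)^2 := by
    have := mul_le_mul_of_nonneg_left A2 hs.le
    have := mul_le_mul_of_nonneg_left D2 (by linarith : 0 ≤ 1-σ)
    linarith
  have N0 : 0 < (1-σ)*(Z/2)^2 := mul_pos (by linarith) (by positivity)
  rw [← o, abs_mul, abs_of_pos (N0.trans_le N1)] at r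
  have r2 := (mul_le_mul_of_nonneg_left N1 (abs_nonneg φ)).trans r
  rw [le_div_iff₀ (by positivity), le_div_iff₀ (by linarith)]
  linarith

lemma R_bound {k σ y Z p v φ R C : ℝ} (hk : 1 ≤ k) (hs : 0 < σ) (hy : 0 < y) (hZ : 2 ≤ Z)
    (hvp : v = Z*p) (hv : |v| < 1) (hφ : |φ| ≤ C/Z^2)
    (D : (Z-v)*R = (1+σ)*(φ*(1-Z*v)+k*p-k*y)) :
    |k*y*(1+σ)/Z+R| ≤ ((1+σ)*(C+2*(k+k*y)))/Z^2 := by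
  obtain ⟨a1, a2, a3⟩ := AD_bds hZ hv
  have hZ0 : 0 < Z := by linarith
  have hD : 0 < Z-v := by linarith
  have hky : 0 < k*y := by nlinarith
  have e : (k*y*(1+σ)/Z+R)*((Z-v)*Z) = (1+σ)*(Z*(φ*(1-Z*v))+k*v-k*y*v) := by
    have : (k*y*(1+σ)/Z+R)*((Z-v)*Z) = k*y*(1+σ)*(Z-v)+Z*((Z-v)*R) := by field_simp
    rw [this, D, hvp]; ring
  have b : |Z*(φ*(1-Z*v))+k*v-k*y*v| ≤ Z*(|φ| * (Z-v)) + k + k*y := by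
    have b1 : |Z*(φ*(1-Z*v))| ≤ Z*(|φ| * (Z-v)) := by
      rw [abs_mul, abs_mul, abs_of_pos hZ0]
      exact mul_le_mul_of_nonneg_left (mul_le_mul_of_nonneg_left a1 (abs_nonneg _)) hZ0.le
    have b2 : |k*v| ≤ k := by rw [abs_mul, abs_of_pos (by linarith : 0 < k)]; nlinarith
    have b3 : |k*y*v| ≤ k*y := by rw [abs_mul, abs_of_pos hky]; nlinarith
    exact (abs_sub _ _).trans (add_le_add ((abs_add_le _ _).trans (add_le_add b1 b2)) b3)
  have hDZ : 0 < (Z-v)*Z := mul_pos hD hZ0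
  have e2 : |k*y*(1+σ)/Z+R| * ((Z-v)*Z) ≤ (1+σ)*(Z*(|φ| * (Z-v)) + k + k*y) := by
    rw [← abs_of_pos hDZ, ← abs_mul, e, abs_mul, abs_of_pos (by linarith : 0 < 1+σ)]
    exact mul_le_mul_of_nonneg_left b (by linarith)
  have hφ2 : |φ| * Z^2 ≤ C := (le_div_iff₀ (by positivity)).1 hφ
  rw [le_div_iff₀ (by positivity)]
  refine le_of_mul_le_mul_right ?_ hD
  have e3 := mul_le_mul_of_nonneg_right e2 hZ0.le
  have e4 : (k+k*y)*Z ≤ 2*(k+k*y)*(Z-v) := by nlinarith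
  have e5 : |φ| * Z^2*(Z-v) ≤ C*(Z-v) := mul_le_mul_of_nonneg_right hφ2 hD.le
  have e6 := mul_le_mul_of_nonneg_left (add_le_add e4 e5) (by linarith : 0 ≤ 1+σ)
  calc |k*y*(1+σ)/Z+R| * Z^2*(Z-v) = |k*y*(1+σ)/Z+R| * ((Z-v)*Z)*Z := by ring
    _ ≤ _ := e3
    _ = (1+σ)*((k+k*y)*Z+|φ| * Z^2*(Z-v)) := by ring
    _ ≤ _ := e6
    _ = _ := by ring

lemma primitive_smooth {R : ℝ → ℝ} {ε : ℝ} (hε : 0 < ε) (sR : ContDiffOn ℝ (⊤:ℕ∞) R (Ioi (-ε))) :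
    ∃ P : ℝ → ℝ, ContDiffOn ℝ (⊤:ℕ∞) P (Ioi (-ε)) ∧ ∀ Z, -ε < Z → HasDerivAt P (R Z) Z := by
  have hc : ContinuousOn R (Ioi (-ε)) := sR.continuousOn
  have hd : ∀ Z, -ε < Z → HasDerivAt (fun Z => ∫ t in (0:ℝ)..Z, R t) (R Z) Z := by
    intro Z hZ
    refine intervalIntegral.integral_hasDerivAt_right ?_ ?_ (hc.continuousAt (Ioi_mem_nhds hZ))
    · refine (hc.mono ?_).intervalIntegrable
      intro t ht
      have h1 := ht.1
      have : -ε < min 0 Z := lt_min (by linarith) hZ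
      exact lt_of_lt_of_le this h1
    · exact hc.stronglyMeasurableAtFilter isOpen_Ioi _ hZ
  refine ⟨_, ?_, hd⟩
  refine ode_smooth (F := fun z : ℝ × ℝ => R z.1) isOpen_Ioi hd ?_
  intro t ht
  have h1 : ContDiffAt ℝ (⊤:ℕ∞) R t := sR.contDiffAt (Ioi_mem_nhds ht)
  exact ContDiffAt.comp (g := R) (f := Prod.fst) (t, _) h1 contDiffAt_fst

set_option maxHeartbeats 1000000 in
theorem assemble {k σ y ε ℓ : ℝ} {ψ φ R γ : ℝ → ℝ} (H : FP k σ y ε ψ φ R γ) (hl : σ*ℓ = 1) :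
      ∃ β : ℝ, 0 < β ∧ β < k ∧
      ∃ ϱ u0 u : ℝ → ℝ, ∃ ϱs u0s us : ℝ,
        ContDiffOn ℝ (⊤ : ℕ∞) ϱ (Ici 0) ∧
        ContDiffOn ℝ (⊤ : ℕ∞) u0 (Ici 0) ∧
        ContDiffOn ℝ (⊤ : ℕ∞) u (Ici 0) ∧
        0 < ϱs ∧ u0s ≠ 0 ∧
        (∀ Z : ℝ, 0 ≤ Z → 0 < ϱ Z) ∧
        (∀ Z : ℝ, 0 ≤ Z → u0 Z < 0) ∧
        (∀ Z : ℝ, 0 ≤ Z → (u0 Z) ^ 2 - (u Z) ^ 2 = 1) ∧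
        u 0 = 0 ∧
        (∀ Z : ℝ, 0 < Z →
          (β * ℓ / (ℓ + 1)) * u0 Z + Z * deriv u0 Z + deriv u Z
            + (k / Z) * u Z
            + (ℓ / (ℓ + 1)) * (Z * u0 Z + u Z) * (deriv ϱ Z / ϱ Z) = 0) ∧
        (∀ Z : ℝ, 0 < Z →
          (β / (ℓ + 1)) * u Z + Z * deriv u Z + deriv u0 Z
            + (1 / (ℓ + 1)) * (Z * u Z + u0 Z) * (deriv ϱ Z / ϱ Z) = 0) ∧
        Tendsto (fun Z : ℝ => Z ^ β * ϱ Z) atTop (𝓝 ϱs) ∧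
        Tendsto u0 atTop (𝓝 u0s) ∧
        Tendsto u atTop (𝓝 us) := by
  have hk := H.V.hk; have hs := H.V.hs0; have hs1 := H.V.hs1; have hy := H.V.y0; have hy1 := H.V.y1
  have hε := H.V.hε
  have hkp : 0 < k := by linarith
  have hky : 0 < k*y := mul_pos hkp hy
  have hl0 : 0 < ℓ := by
    by_contra hc
    push Not at hc
    nlinarith
  have hσ : σ = 1/ℓ := by field_simp; exact hl
  have up : ∀ Z : ℝ, 0 ≤ Z → -ε < Z := fun Z hZ => by linarith
  have sub : Ici (0:ℝ) ⊆ Ioi (-ε) := fun Z hZ => up Z hZ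
  obtain ⟨P, sP, dP⟩ := primitive_smooth hε H.sR
  have du0 : ∀ Z, -ε < Z → HasDerivAt (fun Z => -γ Z) (-(Z*ψ Z*φ Z*γ Z)) Z := fun Z hZ => (H.dγ Z hZ).neg
  have du : ∀ Z, -ε < Z → HasDerivAt (fun Z => Z*ψ Z*γ Z) (φ Z*γ Z) Z := fun Z hZ => by
    have := (H.dv Z hZ).mul (H.dγ Z hZ)
    exact HasDerivAt.congr_deriv this (by ring)
  have dϱ : ∀ Z, -ε < Z → HasDerivAt (fun Z => exp (P Z)) (exp (P Z)*R Z) Z := fun Z hZ => (dP Z hZ).exp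
  -- limits
  set C := 4*σ*(2*k+k*y)/(1-σ) with hC
  have bφ : ∀ Z, 2 ≤ Z → |φ Z| ≤ C/Z^2 := fun Z hZ =>
    phi_bound hk hs hs1 hy hZ rfl (H.V.lt Z (up Z (by linarith))) (H.o Z (by linarith))
  have bR : ∀ Z, 2 ≤ Z → |k*y*(1+σ)/Z+R Z| ≤ ((1+σ)*(C+2*(k+k*y)))/Z^2 := fun Z hZ =>
    R_bound hk hs hy hZ rfl (H.V.lt Z (up Z (by linarith))) (bφ Z hZ) (H.D Z (by linarith))
  obtain ⟨L1, hL1⟩ : ∃ L, Tendsto (fun Z => log (γ Z)) atTop (𝓝 L) := by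
    refine lim_of_bound (f' := fun Z => Z*ψ Z*φ Z) (C := C) ?_ ?_
    · intro Z hZ
      have hZ' := up Z (by linarith)
      have g0 := H.γ0 Z hZ'
      refine ((H.dγ Z hZ').log g0.ne').congr_deriv ?_
      field_simp
    · intro Z hZ
      have h1 := (H.V.lt Z (up Z (by linarith))).le
      rw [abs_mul]
      calc _ ≤ 1*|φ Z| := mul_le_mul_of_nonneg_right h1 (abs_nonneg _)
        _ ≤ _ := by rw [one_mul]; exact bφ Z hZ
  have hγL : Tendsto γ atTop (𝓝 (exp L1)) := by
    refine ((continuous_exp.tendsto L1).comp hL1).congr' ?_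
    filter_upwards [eventually_ge_atTop (0:ℝ)] with Z hZ
    exact exp_log (H.γ0 Z (up Z hZ))
  obtain ⟨L2, hL2⟩ : ∃ L, Tendsto (fun Z => Z*ψ Z) atTop (𝓝 L) := by
    refine lim_of_bound (f' := fun Z => φ Z*(1-(Z*ψ Z)^2)) (C := C) ?_ ?_
    · intro Z hZ; exact H.dv Z (up Z (by linarith))
    · intro Z hZ
      have h1 := abs_lt.1 (H.V.lt Z (up Z (by linarith)))
      have h2 : |1-(Z*ψ Z)^2| ≤ 1 := abs_le.2 ⟨by nlinarith, by nlinarith⟩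
      rw [abs_mul]
      calc _ ≤ |φ Z| * 1 := mul_le_mul_of_nonneg_left h2 (abs_nonneg _)
        _ ≤ _ := by rw [mul_one]; exact bφ Z hZ
  obtain ⟨L3, hL3⟩ : ∃ L, Tendsto (fun Z => k*y*(1+σ)*log Z + P Z) atTop (𝓝 L) := by
    refine lim_of_bound (f' := fun Z => k*y*(1+σ)/Z+R Z) (C := (1+σ)*(C+2*(k+k*y))) ?_ bR
    intro Z hZ
    have h1 := ((Real.hasDerivAt_log (by linarith : Z ≠ 0)).const_mul (k*y*(1+σ))).add (dP Z (up Z (by linarith)))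
    exact HasDerivAt.congr_deriv h1 (by rw [div_eq_mul_inv])
  refine ⟨k*y*(1+σ), by positivity, ?_, fun Z => exp (P Z), fun Z => -γ Z, fun Z => Z*ψ Z*γ Z,
    exp L3, -exp L1, L2*exp L1, (sP.exp).mono sub, (H.sγ.neg).mono sub,
    ((contDiffOn_id.mul H.V.sm).mul H.sγ).mono sub, exp_pos _, ?_, fun Z _ => exp_pos _, ?_, ?_, ?_, ?_, ?_, ?_, hγL.neg,
    hL2.mul hγL⟩
  · have : y*(1+σ) < 1 := by nlinarith
    rw [mul_assoc]; nlinarith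
  · exact neg_ne_zero.2 (exp_pos _).ne'
  · intro Z hZ; linarith [H.γ0 Z (up Z hZ)]
  · intro Z hZ; have := H.γ1 Z (up Z hZ); simp only; linear_combination this
  · simp
  · intro Z hZ
    have hZ' := up Z hZ.le
    rw [(du0 Z hZ').deriv, (du Z hZ').deriv, (dϱ Z hZ').deriv, mul_div_cancel_left₀ _ (exp_pos _).ne']
    have e1 : k*y*(1+σ)*ℓ/(ℓ+1) = k*y := by rw [hσ]; field_simp
    have e2 : ℓ/(ℓ+1) = 1/(1+σ) := by rw [hσ]; field_simp
    have e3 : k/Z*(Z*ψ Z*γ Z) = k*ψ Z*γ Z := by field_simp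
    have hD := H.D Z hZ
    have e4 : 1/(1+σ)*((Z-Z*ψ Z)*R Z) = φ Z*(1-Z*(Z*ψ Z))+k*ψ Z-k*y := by rw [hD]; field_simp
    rw [e1, e2, e3]
    linear_combination (-γ Z)*e4
  · intro Z hZ
    have hZ' := up Z hZ.le
    rw [(du0 Z hZ').deriv, (du Z hZ').deriv, (dϱ Z hZ').deriv, mul_div_cancel_left₀ _ (exp_pos _).ne']
    have e1 : k*y*(1+σ)/(ℓ+1) = k*y*σ := by rw [hσ]; field_simp
    have e2 : 1/(ℓ+1) = σ/(1+σ) := by rw [hσ]; field_simp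
    have hA := H.A Z hZ
    have e4 : σ/(1+σ)*((1-Z*(Z*ψ Z))*R Z) = φ Z*(Z-Z*ψ Z)+k*y*σ*(Z*ψ Z) := by rw [hA]; field_simp
    rw [e1, e2]
    linear_combination (-γ Z)*e4
  · refine ((continuous_exp.tendsto L3).comp hL3).congr' ?_
    filter_upwards [eventually_gt_atTop (0:ℝ)] with Z hZ
    simp only [Function.comp]
    rw [exp_add, rpow_def_of_pos hZ, mul_comm (log Z)]

theorem main_thm (k : ℕ) (hk : 1 ≤ k) : ∃ ℓstar : ℝ, 1 < ℓstar ∧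
      ∀ ℓ : ℝ, 1 < ℓ → (ℓ < ℓstar ∨ k = 1 ∨ k = 2) → ∃ σ y ε : ℝ, ∃ ψ φ R γ : ℝ → ℝ,
        FP k σ y ε ψ φ R γ ∧ σ*ℓ = 1 := by
  obtain ⟨s0, h1, h0, H⟩ := params_exist k hk
  refine ⟨1/s0, by rw [lt_div_iff₀ h0]; linarith, fun ℓ hl hc => ?_⟩
  have hl0 : 0 < ℓ := by linarith
  have S : Sel k (1/ℓ) := by
    refine H (1/ℓ) (by positivity) (by rw [div_lt_iff₀ hl0]; linarith) ?_
    rcases hc with hc | hc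
    · left
      rw [lt_div_iff₀ h0] at hc
      rw [lt_div_iff₀ hl0]; linarith
    · exact Or.inr hc
  obtain ⟨y, e, ε, xe, g, X⟩ := xprofile S
  obtain ⟨ε0, ψ, V⟩ := vprofile X
  obtain ⟨φ, R, γ, F⟩ := fprofile V
  exact ⟨_, _, _, _, _, _, _, F, by field_simp⟩

/-- Existence of smooth self-similar imploding profiles for the relativistic Euler
equations with isothermal equation of state `p = ϱ/ℓ` in `d = k+1` space dimensions. -/
theorem relativistic_euler_self_similar_profiles :
    ∀ k : ℕ, 1 ≤ k →
    ∃ ℓstar : ℝ, 1 < ℓstar ∧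
      ∀ ℓ : ℝ, 1 < ℓ → (ℓ < ℓstar ∨ k = 1 ∨ k = 2) →
      ∃ β : ℝ, 0 < β ∧ β < (k : ℝ) ∧
      ∃ ϱ u0 u : ℝ → ℝ, ∃ ϱs u0s us : ℝ,
        ContDiffOn ℝ (⊤ : ℕ∞) ϱ (Ici 0) ∧
        ContDiffOn ℝ (⊤ : ℕ∞) u0 (Ici 0) ∧
        ContDiffOn ℝ (⊤ : ℕ∞) u (Ici 0) ∧
        0 < ϱs ∧ u0s ≠ 0 ∧
        (∀ Z : ℝ, 0 ≤ Z → 0 < ϱ Z) ∧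
        (∀ Z : ℝ, 0 ≤ Z → u0 Z < 0) ∧
        (∀ Z : ℝ, 0 ≤ Z → (u0 Z) ^ 2 - (u Z) ^ 2 = 1) ∧
        u 0 = 0 ∧
        (∀ Z : ℝ, 0 < Z →
          (β * ℓ / (ℓ + 1)) * u0 Z + Z * deriv u0 Z + deriv u Z
            + ((k : ℝ) / Z) * u Z
            + (ℓ / (ℓ + 1)) * (Z * u0 Z + u Z) * (deriv ϱ Z / ϱ Z) = 0) ∧
        (∀ Z : ℝ, 0 < Z →
          (β / (ℓ + 1)) * u Z + Z * deriv u Z + deriv u0 Z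
            + (1 / (ℓ + 1)) * (Z * u Z + u0 Z) * (deriv ϱ Z / ϱ Z) = 0) ∧
        Tendsto (fun Z : ℝ => Z ^ β * ϱ Z) atTop (𝓝 ϱs) ∧
        Tendsto u0 atTop (𝓝 u0s) ∧
        Tendsto u atTop (𝓝 us) := by
  intro k hk
  obtain ⟨ℓstar, h1, H⟩ := main_thm k hk
  refine ⟨ℓstar, h1, fun ℓ hl hc => ?_⟩
  obtain ⟨σ, y, ε, ψ, φ, R, γ, F, hs⟩ := H ℓ hl hc
  exact assemble F hs
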